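/- Let d ≥ 3, k ≥ 0, R = ℤ[x_1,…,x_k], G = SL_d(R), and set N = (3d² − d − 2)/2 + 18(k+2). There exists a sequence of pairs of distinct indices (i_1,j_1),…,(i_N,j_N) (depending only on d and k) such that for every normal subgroup H of finite index in G, every element g ∈ G can be written as g = E_{i_1 j_1}(r_1)·E_{i_2 j_2}(r_2)⋯E_{i_N j_N}(r_N)·h for some r_1,…,r_N ∈ R and h ∈ H. In other words, every finite quotient of G is the product, in a fixed order, of the images of N elementary subgroups. -/

import Mathlib

/-- The elementary matrix `E_{ij}(r)`: the identity matrix with the entry `r`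
added in position `(i,j)`, as an element of `SL_d(A)`. -/
def elem {A : Type*} [CommRing A] {d : ℕ} (i j : Fin d) (h : i ≠ j) (r : A) :
    Matrix.SpecialLinearGroup (Fin d) A :=
  ⟨Matrix.transvection i j r, Matrix.det_transvection_of_ne i j h r⟩

namespace BG

abbrev SL (n : ℕ) (R : Type*) [CommRing R] := Matrix.SpecialLinearGroup (Fin n) R

section basics
variable {n : ℕ} {R S : Type*} [CommRing R] [CommRing S]

/-- underlying matrix -/
def mat (g : SL n R) : Matrix (Fin n) (Fin n) R := g.1

theorem mat_mul (g h : SL n R) : mat (g * h) = mat g * mat h := rfl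
@[simp] theorem mat_one : mat (1 : SL n R) = 1 := rfl
theorem mat_det (g : SL n R) : (mat g).det = 1 := g.2
theorem mat_mk (M : Matrix (Fin n) (Fin n) R) (h : M.det = 1) : mat (⟨M, h⟩ : SL n R) = M := rfl
theorem mat_inj {g h : SL n R} (e : mat g = mat h) : g = h := Subtype.ext e
theorem mat_ext {g h : SL n R} (e : ∀ a b, mat g a b = mat h a b) : g = h :=
  mat_inj (by ext a b; exact e a b)
theorem mat_transpose (g : SL n R) : mat g.transpose = (mat g).transpose := rfl
theorem mat_map (f : R →+* S) (g : SL n R) (a b : Fin n) :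
    mat (Matrix.SpecialLinearGroup.map f g) a b = f (mat g a b) := rfl
theorem mat_mul_apply (g h : SL n R) (a b : Fin n) :
    mat (g * h) a b = ∑ c, mat g a c * mat h c b := by
  rw [mat_mul, Matrix.mul_apply]
theorem mat_one_apply (a b : Fin n) : mat (1 : SL n R) a b = if a = b then 1 else 0 := by
  rw [mat_one, Matrix.one_apply]

/-- total version of `elem` -/
def tv (i j : Fin n) (r : R) : SL n R := if h : i ≠ j then elem i j h r else 1

theorem tv_of_ne {i j : Fin n} (h : i ≠ j) (r : R) : tv i j r = elem i j h r := by
  simp [tv, h]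

theorem tv_coe {i j : Fin n} (h : i ≠ j) (r : R) :
    mat (tv i j r) = Matrix.transvection i j r := by
  rw [tv_of_ne h]; rfl

theorem tv_apply {i j : Fin n} (h : i ≠ j) (r : R) (a b : Fin n) :
    mat (tv i j r) a b = (if a = b then 1 else 0) + (if i = a ∧ j = b then r else 0) := by
  rw [tv_coe h]; simp [Matrix.transvection, Matrix.one_apply, Matrix.single_apply]

@[simp] theorem tv_self (i : Fin n) (r : R) : tv i i r = 1 := by simp [tv]

@[simp] theorem tv_zero (i j : Fin n) : tv i j (0 : R) = 1 := by
  by_cases h : i = j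
  · subst h; simp
  · apply mat_inj; rw [tv_coe h]; simp

theorem tv_add (i j : Fin n) (r s : R) : tv i j (r + s) = tv i j r * tv i j s := by
  by_cases h : i = j
  · subst h; simp
  · apply mat_inj
    rw [mat_mul, tv_coe h, tv_coe h, tv_coe h,
      Matrix.transvection_mul_transvection_same _ _ h]

theorem tv_neg (i j : Fin n) (r : R) : tv i j (-r) = (tv i j r)⁻¹ := by
  rw [eq_inv_iff_mul_eq_one, ← tv_add]; simp

theorem tv_c1 {i j k : Fin n} (hij : i ≠ j) (hjk : j ≠ k) (hik : i ≠ k) (a b : R) :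
    tv i j a * tv j k b = tv i k (a * b) * tv j k b * tv i j a := by
  apply mat_inj
  simp only [mat_mul]
  rw [tv_coe hij, tv_coe hjk, tv_coe hik]
  simp only [Matrix.transvection, mul_add, add_mul, mul_one, one_mul,
    Matrix.single_mul_single_same]
  have e1 : Matrix.single j k b * Matrix.single i j a = 0 := by
    rw [Matrix.single_mul_single_of_ne (h := hik.symm)]
  have e2 : Matrix.single i k (a*b) * Matrix.single j k b = 0 := by
    rw [Matrix.single_mul_single_of_ne (h := hjk.symm)]
  have e3 : Matrix.single i k (a*b) * Matrix.single i j a = 0 := by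
    rw [Matrix.single_mul_single_of_ne (h := hik.symm)]
  rw [e1, e2, e3]
  simp
  abel

theorem tv_c2 {i j k l : Fin n} (hij : i ≠ j) (hkl : k ≠ l) (hjk : j ≠ k) (hil : i ≠ l) (a b : R) :
    tv i j a * tv k l b = tv k l b * tv i j a := by
  apply mat_inj
  simp only [mat_mul]
  rw [tv_coe hij, tv_coe hkl]
  simp only [Matrix.transvection, mul_add, add_mul, mul_one, one_mul]
  rw [Matrix.single_mul_single_of_ne (h := hjk) , Matrix.single_mul_single_of_ne (h := hil.symm)]
  abel

theorem map_tv (f : R →+* S) (i j : Fin n) (r : R) :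
    Matrix.SpecialLinearGroup.map f (tv i j r) = tv i j (f r) := by
  by_cases h : i = j
  · subst h; simp
  · apply mat_inj
    ext a b
    have := tv_apply h (f r) a b
    refine Eq.trans ?_ this.symm
    have h2 := tv_apply h r a b
    refine (congrArg f h2).trans ?_
    simp [apply_ite f]

/-- the elementary subgroup -/
def E (n : ℕ) (R : Type*) [CommRing R] : Subgroup (SL n R) :=
  Subgroup.closure {g | ∃ i j r, g = tv i j r}

theorem tv_mem (i j : Fin n) (r : R) : tv i j r ∈ E n R :=
  Subgroup.subset_closure ⟨i, j, r, rfl⟩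

theorem E_induction {p : SL n R → Prop} (one : p 1)
    (step : ∀ i j, i ≠ j → ∀ r e, e ∈ E n R → p e → p (tv i j r * e)) {g : SL n R} (hg : g ∈ E n R) : p g := by
  have key : ∀ i j r e, e ∈ E n R → p e → p (tv i j r * e) := by
    intro i j r e he hp
    by_cases h : i = j
    · subst h; simpa using hp
    · exact step i j h r e he hp
  induction hg using Subgroup.closure_induction_left with
  | one => exact one
  | mul_left x hx y hy ih =>
    obtain ⟨i, j, r, rfl⟩ := hx
    exact key i j r y hy ih
  | inv_mul_cancel x hx y hy ih =>
    obtain ⟨i, j, r, rfl⟩ := hx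
    rw [← tv_neg]
    exact key i j _ y hy ih

/-- `SL_n` map -/
abbrev mp (f : R →+* S) : SL n R →* SL n S := Matrix.SpecialLinearGroup.map f

theorem mp_tv (f : R →+* S) (i j : Fin n) (r : R) : mp f (tv i j r) = tv i j (f r) := map_tv f i j r

theorem mp_mem (f : R →+* S) {g : SL n R} (hg : g ∈ E n R) : mp f g ∈ E n S := by
  refine E_induction (p := fun g => mp f g ∈ E n S) ?_ ?_ hg
  · simp [one_mem]
  · intro i j _ r e _ h
    rw [map_mul, mp_tv]
    exact mul_mem (tv_mem _ _ _) h

theorem mp_surj (f : R →+* S) (hf : Function.Surjective f) {g : SL n S} (hg : g ∈ E n S) :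
    ∃ e ∈ E n R, mp f e = g := by
  refine E_induction (p := fun g => ∃ e ∈ E n R, mp f e = g) ⟨1, one_mem _, map_one _⟩ ?_ hg
  rintro i j _ r e _ ⟨e', he', rfl⟩
  obtain ⟨r, rfl⟩ := hf r
  exact ⟨tv i j r * e', mul_mem (tv_mem _ _ _) he', by rw [map_mul, mp_tv]⟩

theorem mp_apply (f : R →+* S) (g : SL n R) (i j : Fin n) : mat (mp f g) i j = f (mat g i j) := rfl

theorem mp_comp {T : Type*} [CommRing T] (f : R →+* S) (f' : S →+* T) (g : SL n R) :
    mp f' (mp f g) = mp (f'.comp f) g := by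
  apply mat_inj; ext i j; simp [mp_apply]

theorem mp_id (g : SL n R) : mp (RingHom.id R) g = g := by
  apply mat_inj; ext i j; simp [mp_apply]

theorem mp_inj (f : R →+* S) (hf : Function.Injective f) {g g' : SL n R} (h : mp f g = mp f g') : g = g' := by
  apply mat_inj; ext i j
  apply hf
  rw [← mp_apply, ← mp_apply, h]

/-- transpose inverse-free statement -/
theorem transpose_mem {g : SL n R} (hg : g ∈ E n R) : g.transpose ∈ E n R := by
  refine E_induction (p := fun g => g.transpose ∈ E n R) ?_ ?_ hg
  · convert one_mem (E n R)
    apply mat_inj; simp [mat_transpose]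
  · intro i j h r e _ he
    have : (tv i j r * e).transpose = e.transpose * tv j i r := by
      apply mat_inj
      rw [mat_mul, tv_coe h.symm, mat_transpose,
        mat_mul, tv_coe h, Matrix.transpose_mul,
        mat_transpose]
      simp [Matrix.transvection]
    rw [this]
    exact mul_mem he (tv_mem _ _ _)

def Full (n : ℕ) (R : Type*) [CommRing R] : Prop := ∀ g : SL n R, g ∈ E n R

theorem Full.of_equiv (e : R ≃+* S) (h : Full n R) : Full n S := by
  intro g
  have := mp_mem e.toRingHom (h (mp e.symm.toRingHom g))
  rw [mp_comp] at this
  convert this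
  symm; convert mp_id g
  ext x; simp

theorem mem_E_equiv (e : R ≃+* S) {g : SL n R} : mp e.toRingHom g ∈ E n S ↔ g ∈ E n R := by
  refine ⟨fun h => ?_, fun h => mp_mem _ h⟩
  have := mp_mem e.symm.toRingHom h
  rw [mp_comp] at this
  convert this
  symm; convert mp_id g
  ext x; simp

end basics

/-- A Steinberg system: a family of root subgroups satisfying the Steinberg relations. -/
structure StSys (n : ℕ) (A : Type*) [CommRing A] (Γ : Type*) [Group Γ] where
  x : Fin n → Fin n → A → Γ
  add : ∀ i j, i ≠ j → ∀ a b, x i j (a + b) = x i j a * x i j b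
  c1 : ∀ i j k, i ≠ j → j ≠ k → i ≠ k → ∀ a b,
    x i j a * x j k b = x i k (a * b) * x j k b * x i j a
  c2 : ∀ i j k l, i ≠ j → k ≠ l → j ≠ k → i ≠ l → ∀ a b,
    x i j a * x k l b = x k l b * x i j a

def tvSys (n : ℕ) (A : Type*) [CommRing A] : StSys n A (SL n A) where
  x := tv
  add i j _ a b := tv_add i j a b
  c1 _ _ _ h1 h2 h3 a b := tv_c1 h1 h2 h3 a b
  c2 _ _ _ _ h1 h2 h3 h4 a b := tv_c2 h1 h2 h3 h4 a b

end BG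

namespace BG

section pat
variable {n : ℕ} {A : Type*} {Γ : Type*} [Group Γ]

/-- products with a given pattern of root positions -/
def Pat (x : Fin n → Fin n → A → Γ) : List (Fin n × Fin n) → Set Γ
  | [] => {1}
  | p :: L => {g | ∃ r, ∃ h ∈ Pat x L, g = x p.1 p.2 r * h}

theorem Pat_append (x : Fin n → Fin n → A → Γ) {L1 L2 : List (Fin n × Fin n)} {g h : Γ}
    (hg : g ∈ Pat x L1) (hh : h ∈ Pat x L2) : g * h ∈ Pat x (L1 ++ L2) := by
  induction L1 generalizing g with
  | nil => simp only [Pat, Set.mem_singleton_iff] at hg; subst hg; simpa using hh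
  | cons p L ih =>
    obtain ⟨r, k, hk, rfl⟩ := hg
    exact ⟨r, k * h, ih hk, mul_assoc _ _ _⟩

theorem Pat_single (x : Fin n → Fin n → A → Γ) (i j : Fin n) (r : A) : x i j r ∈ Pat x [(i,j)] :=
  ⟨r, 1, rfl, by simp⟩

theorem Pat_one (x : Fin n → Fin n → A → Γ) (a0 : A) (h : ∀ i j, x i j a0 = 1)
    (L : List (Fin n × Fin n)) : (1 : Γ) ∈ Pat x L := by
  induction L with
  | nil => rfl
  | cons p L ih => exact ⟨a0, 1, ih, by simp [h]⟩

end pat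

section elim
variable {n : ℕ} {R : Type*} [CommRing R]

theorem tv_mul_apply {i j : Fin n} (h : i ≠ j) (r : R) (g : SL n R) (a b : Fin n) :
    mat (tv i j r * g) a b = mat g a b + if a = i then r * mat g j b else 0 := by
  rw [mat_mul, tv_coe h]
  by_cases ha : a = i
  · subst ha; simp [Matrix.transvection_mul_apply_same]
  · rw [Matrix.transvection_mul_apply_of_ne _ _ _ _ ha]; simp [ha]

theorem mul_tv_apply {i j : Fin n} (h : i ≠ j) (r : R) (g : SL n R) (a b : Fin n) :
    mat (g * tv i j r) a b = mat g a b + if b = j then r * mat g a i else 0 := by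
  rw [mat_mul, tv_coe h]
  by_cases ha : b = j
  · subst ha; simp [Matrix.mul_transvection_apply_same]
  · rw [Matrix.mul_transvection_apply_of_ne _ _ _ _ ha]; simp [ha]

theorem Pat_inv {L : List (Fin n × Fin n)} {g : SL n R} (hg : g ∈ Pat tv L) :
    g⁻¹ ∈ Pat (tv (R := R)) L.reverse := by
  induction L generalizing g with
  | nil => simp only [Pat, Set.mem_singleton_iff] at hg; subst hg; simp [Pat]
  | cons p L ih =>
    obtain ⟨r, k, hk, rfl⟩ := hg
    rw [_root_.mul_inv_rev, ← tv_neg, List.reverse_cons]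
    exact Pat_append _ (ih hk) (Pat_single _ _ _ _)

theorem Pat_mem_E {L : List (Fin n × Fin n)} {g : SL n R} (hg : g ∈ Pat tv L) : g ∈ E n R := by
  induction L generalizing g with
  | nil => simp only [Pat, Set.mem_singleton_iff] at hg; subst hg; exact one_mem _
  | cons p L ih =>
    obtain ⟨r, k, hk, rfl⟩ := hg
    exact mul_mem (tv_mem _ _ _) (ih hk)

/-- matrices which are the identity in rows and columns `< m` -/
def Stab (n : ℕ) (R : Type*) [CommRing R] (m : ℕ) : Subgroup (SL n R) where
  carrier := {g | ∀ a b : Fin n, (a.1 < m ∨ b.1 < m) → mat g a b = if a = b then 1 else 0}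
  one_mem' := by intro a b _; simp [mat_one_apply]
  mul_mem' := by
    intro g h hg hh a b hab
    rw [mat_mul_apply]
    rcases hab with hab | hab
    · rw [Finset.sum_eq_single a]
      · rw [hg a a (Or.inl hab), hh a b (Or.inl hab)]; simp
      · intro c _ hc
        rw [hg a c (Or.inl hab)]; simp [hc.symm]
      · simp
    · rw [Finset.sum_eq_single b]
      · rw [hg a b (Or.inr hab), hh b b (Or.inl hab)]; simp
      · intro c _ hc
        rw [hh c b (Or.inr hab)]; simp [hc]
      · simp
  inv_mem' := by
    intro g hg a b hab
    rcases hab with hab | hab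
    · have h1 : mat (g * g⁻¹) a b = if a = b then 1 else 0 := by simp [mat_one_apply]
      rw [mat_mul_apply, Finset.sum_eq_single a, hg a a (Or.inl hab)] at h1
      · simpa using h1
      · intro c _ hc
        rw [hg a c (Or.inl hab)]; simp [hc.symm]
      · simp
    · have h1 : mat (g⁻¹ * g) a b = if a = b then 1 else 0 := by simp [mat_one_apply]
      rw [mat_mul_apply, Finset.sum_eq_single b, hg b b (Or.inr hab)] at h1
      · simpa using h1
      · intro c _ hc
        rw [hg c b (Or.inr hab)]; simp [hc]
      · simp

theorem tv_mem_Stab {m : ℕ} {i j : Fin n} (hi : m ≤ i.1) (hj : m ≤ j.1) (r : R) : tv i j r ∈ Stab n R m := by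
  by_cases h : i = j
  · subst h; rw [tv_self]; exact one_mem _
  intro a b hab
  rw [tv_apply h]
  have : ¬ (i = a ∧ j = b) := by
    rintro ⟨rfl, rfl⟩; omega
  simp [this]

theorem Pat_mem_Stab {m : ℕ} {L : List (Fin n × Fin n)} (hL : ∀ p ∈ L, m ≤ p.1.1 ∧ m ≤ p.2.1)
    {g : SL n R} (hg : g ∈ Pat tv L) : g ∈ Stab n R m := by
  induction L generalizing g with
  | nil => simp only [Pat, Set.mem_singleton_iff] at hg; subst hg; exact one_mem _
  | cons p L ih =>
    obtain ⟨r, k, hk, rfl⟩ := hg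
    refine mul_mem (tv_mem_Stab (hL p (by simp)).1 (hL p (by simp)).2 _) (ih ?_ hk)
    intro q hq; exact hL q (by simp [hq])

/-- row operations into row `i` -/
theorem row_ops (i : Fin n) (c : Fin n → R) (l : List (Fin n)) (hl : i ∉ l) :
    ∃ P ∈ Pat (tv (R := R)) (l.map fun j => (i, j)), ∀ g : SL n R, ∀ a b,
      mat (P * g) a b = mat g a b + if a = i then (l.map fun j => c j * mat g j b).sum else 0 := by
  induction l with
  | nil => exact ⟨1, rfl, by simp⟩
  | cons j l ih =>
    simp only [List.mem_cons, not_or] at hl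
    obtain ⟨P, hP, hPg⟩ := ih hl.2
    refine ⟨tv i j (c j) * P, ⟨c j, P, hP, rfl⟩, ?_⟩
    intro g a b
    rw [mul_assoc, tv_mul_apply hl.1, hPg, hPg]
    by_cases ha : a = i
    · subst ha
      simp [Ne.symm hl.1]; ring
    · simp [ha]

/-- clearing column `m` -/
theorem col_clear (m : Fin n) (l : List (Fin n)) (hl : m ∉ l) (g : SL n R) (hg : mat g m m = 1) :
    ∃ P ∈ Pat (tv (R := R)) (l.map fun j => (j, m)),
      (∀ a, a ∉ l → ∀ b, mat (P * g) a b = mat g a b) ∧ (∀ a ∈ l, mat (P * g) a m = 0) := by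
  induction l with
  | nil => exact ⟨1, rfl, by simp⟩
  | cons j l ih =>
    simp only [List.mem_cons, not_or] at hl
    obtain ⟨P, hP, h1, h2⟩ := ih hl.2
    have hmm : mat (P * g) m m = 1 := by rw [h1 m hl.2, hg]
    refine ⟨tv j m (-mat (P * g) j m) * P, ⟨_, P, hP, rfl⟩, ?_, ?_⟩
    · intro a ha b
      simp only [List.mem_cons, not_or] at ha
      rw [mul_assoc, tv_mul_apply (Ne.symm hl.1), h1 a ha.2]; simp [ha.1]
    · intro a ha
      rw [mul_assoc, tv_mul_apply (Ne.symm hl.1), hmm]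
      by_cases haj : a = j
      · subst haj; simp
      · simp only [List.mem_cons, haj, false_or] at ha
        simp [haj, h2 a ha]

theorem sum_filter_list (p : Fin n → Prop) [DecidablePred p] (f : Fin n → R) :
    (((List.finRange n).filter p).map f).sum = ∑ j, if p j then f j else 0 := by
  rw [← Finset.sum_filter]
  rw [← List.sum_toFinset f (List.Nodup.filter _ (List.nodup_finRange n))]
  congr 1; ext; simp

def above (n m : ℕ) : List (Fin n) := (List.finRange n).filter fun j => m < j.1

/-- from pivot one to the next stabilizer -/
theorem pivot_step (m : Fin n) (g : SL n R) (hg : g ∈ Stab n R m.1) (h1 : mat g m m = 1) :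
    ∃ P ∈ Pat (tv (R := R)) (((above n m.1).map fun j => (m, j)) ++ ((above n m.1).map fun j => (j, m))),
      P * g ∈ Stab n R (m.1 + 1) := by
  have hm : m ∉ above n m.1 := by simp [above]
  obtain ⟨P, hP, hP1, hP2⟩ := col_clear m (above n m.1) hm g h1
  set g2 := P * g with hg2
  have hPs : P ∈ Stab n R m.1 := by
    refine Pat_mem_Stab ?_ hP
    intro p hp
    simp only [above, List.mem_map, List.mem_filter] at hp
    obtain ⟨j, hj, rfl⟩ := hp
    simp at hj; exact ⟨hj.le, le_refl _⟩
  have hg2s : g2 ∈ Stab n R m.1 := mul_mem hPs hg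
  have hcol : ∀ a, mat g2 a m = if a = m then 1 else 0 := by
    intro a
    rcases lt_trichotomy a.1 m.1 with h | h | h
    · exact hg2s a m (Or.inl h)
    · have : a = m := Fin.ext h
      subst this; rw [hP1 a hm, h1]; simp
    · rw [hP2 a (by simp [above]; exact h)]
      rw [if_neg]; rintro rfl; omega
  have hinv : mat (g2⁻¹) m m = 1 := by
    have h3 : mat (g2⁻¹ * g2) m m = 1 := by simp
    rw [mat_mul_apply, Finset.sum_eq_single m] at h3
    · rw [hcol] at h3; simpa using h3
    · intro c _ hc; rw [hcol]; simp [hc]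
    · simp
  obtain ⟨Q, hQ, hQ1⟩ := row_ops m (fun j => mat (g2⁻¹) m j) (above n m.1) hm
  refine ⟨Q * P, Pat_append _ hQ hP, ?_⟩
  have hQs : Q ∈ Stab n R m.1 := by
    refine Pat_mem_Stab ?_ hQ
    intro p hp
    simp only [above, List.mem_map, List.mem_filter] at hp
    obtain ⟨j, hj, rfl⟩ := hp
    simp at hj; exact ⟨le_refl _, hj.le⟩
  have hg3 : Q * P * g ∈ Stab n R m.1 := by rw [mul_assoc]; exact mul_mem hQs hg2s
  have hrow : ∀ b, mat (Q * P * g) m b = if m = b then 1 else 0 := by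
    intro b
    rw [mul_assoc, ← hg2, hQ1 g2 m b]
    have h4 : mat (g2⁻¹ * g2) m b = if m = b then 1 else 0 := by
      simp [mat_one_apply]
    rw [← h4, mat_mul_apply g2⁻¹ g2, if_pos rfl, above, sum_filter_list]
    have : ∀ j : Fin n, mat (g2⁻¹) m j * mat g2 j b = (if m.1 < j.1 then mat (g2⁻¹) m j * mat g2 j b else 0)
        + if j = m then mat g2 m b else 0 := by
      intro j
      rcases lt_trichotomy j.1 m.1 with h | h | h
      · rw [(inv_mem hg2s) m j (Or.inr h), if_neg (by rintro rfl; omega), if_neg (by omega),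
          if_neg (by rintro rfl; omega)]; simp
      · have : j = m := Fin.ext h
        subst this; simp [hinv]
      · rw [if_pos h, if_neg (by rintro rfl; omega)]; simp
    rw [Finset.sum_congr rfl (fun j _ => this j), Finset.sum_add_distrib]
    simp
    ring
  intro a b hab
  by_cases ha : a = m
  · subst ha; exact hrow b
  by_cases hb : b = m
  · subst hb
    rw [mul_assoc, ← hg2, hQ1 g2 a b, hcol]
    simp [ha]
  refine hg3 a b ?_
  rcases hab with h | h
  · left; have : a.1 ≠ m.1 := fun h => ha (Fin.ext h)
    omega
  · right; have : b.1 ≠ m.1 := fun h => hb (Fin.ext h)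
    omega

theorem Stab_last {m : ℕ} (hm : n ≤ m + 1) {g : SL n R} (hg : g ∈ Stab n R m) : g = 1 := by
  have hdiag : mat g = Matrix.diagonal fun a => mat g a a := by
    ext a b
    by_cases hab : a = b
    · subst hab; simp
    · rw [Matrix.diagonal_apply_ne _ hab]
      have : a.1 < m ∨ b.1 < m := by
        have : a.1 ≠ b.1 := fun h => hab (Fin.ext h)
        omega
      rw [hg a b this]; simp [hab]
  have hdet := mat_det g
  rw [hdiag, Matrix.det_diagonal] at hdet
  apply mat_ext
  intro a b
  by_cases hab : a = b
  · subst hab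
    by_cases ha : a.1 < m
    · rw [hg a a (Or.inl ha)]; simp
    · rw [Finset.prod_eq_single a] at hdet
      · rw [hdet]; simp
      · intro c _ hc
        have : c.1 ≠ a.1 := fun h => hc (Fin.ext h)
        rw [hg c c (Or.inl (by omega))]; simp
      · simp
  · rw [hdiag, Matrix.diagonal_apply_ne _ hab]; simp [hab]

theorem col_unimod {m : Fin n} {g : SL n R} (hg : g ∈ Stab n R m.1) :
    ∃ c : Fin n → R, (∀ j, j.1 < m.1 → c j = 0) ∧ ∑ j, c j * mat g j m = 1 := by
  refine ⟨fun j => if j.1 < m.1 then 0 else mat (g⁻¹) m j, fun j hj => by simp [hj], ?_⟩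
  have h3 : mat (g⁻¹ * g) m m = 1 := by simp
  rw [mat_mul_apply] at h3
  rw [← h3]
  refine Finset.sum_congr rfl fun j _ => ?_
  by_cases hj : j.1 < m.1
  · simp [hj, hg j m (Or.inl hj)]
    rintro rfl; omega
  · simp [hj]

/-- stable rank one -/
def SR1 (R : Type*) [CommRing R] : Prop := ∀ a b : R, IsCoprime a b → ∃ c, IsUnit (a + c * b)

def lvl (n m : ℕ) (hm : m + 1 < n) : List (Fin n × Fin n) :=
  (((above n m).map fun j => (⟨m, by omega⟩, j)) ++ ((above n m).map fun j => (j, ⟨m, by omega⟩)))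
  ++ (⟨m, by omega⟩, ⟨m+1, hm⟩) ::
   ((List.finRange n).filter fun j => m ≤ j.1 ∧ j.1 ≠ m + 1).map fun j => (⟨m+1,hm⟩, j)

theorem sr1_step (hR : SR1 R) (m : ℕ) (hm : m + 1 < n) (g : SL n R) (hg : g ∈ Stab n R m) :
    ∃ P ∈ Pat (tv (R := R)) (lvl n m hm), P * g ∈ Stab n R (m + 1) := by
  set i : Fin n := ⟨m, by omega⟩
  set i1 : Fin n := ⟨m+1, hm⟩
  have hne : i ≠ i1 := by simp [i, i1]
  obtain ⟨c, hc0, hc1⟩ := col_unimod (m := i) hg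
  set l := (List.finRange n).filter fun j : Fin n => m ≤ j.1 ∧ j.1 ≠ m + 1 with hl
  have hcop : IsCoprime (mat g i1 i) (∑ j, if (m ≤ j.1 ∧ j.1 ≠ m + 1) then c j * mat g j i else 0) := by
    refine ⟨c i1, 1, ?_⟩
    rw [one_mul]; refine Eq.trans ?_ hc1
    have : ∀ j : Fin n, c j * mat g j i = (if j = i1 then c i1 * mat g i1 i else 0) +
       if (m ≤ j.1 ∧ j.1 ≠ m + 1) then c j * mat g j i else 0 := by
      intro j
      by_cases hj : j = i1
      · subst hj; simp [i1]
      · have : j.1 ≠ m + 1 := fun h => hj (Fin.ext h)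
        by_cases hjm : m ≤ j.1
        · simp [hj, this, hjm]
        · simp [hj, this, hjm, hc0 j (not_le.mp hjm)]
    rw [Finset.sum_congr rfl (fun j _ => this j), Finset.sum_add_distrib]
    simp
  obtain ⟨t, ht⟩ := hR _ _ hcop
  have hi1l : i1 ∉ l := by simp [hl, i1]
  obtain ⟨P1, hP1, hP1g⟩ := row_ops i1 (fun j => t * c j) l hi1l
  have hu : IsUnit (mat (P1 * g) i1 i) := by
    rw [hP1g, if_pos rfl, hl, sum_filter_list]
    convert ht using 2
    rw [Finset.mul_sum]
    refine Finset.sum_congr rfl fun j _ => ?_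
    split_ifs <;> ring
  obtain ⟨u, hu⟩ := hu
  set P2 := tv i i1 (↑u⁻¹ * (1 - mat (P1 * g) i i)) * P1 with hP2
  have hP2' : P2 ∈ Pat (tv (R := R)) ((i, i1) :: l.map fun j => (i1, j)) := ⟨_, P1, hP1, rfl⟩
  have hone : mat (P2 * g) i i = 1 := by
    rw [hP2, mul_assoc, tv_mul_apply hne, if_pos rfl, ← hu]
    have : (↑u⁻¹ : R) * u = 1 := Units.inv_mul u
    linear_combination (1 - mat (P1 * g) i i) * this
  have hP2s : P2 * g ∈ Stab n R m := by
    refine mul_mem (Pat_mem_Stab ?_ hP2') hg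
    intro p hp
    simp only [List.mem_cons, List.mem_map] at hp
    rcases hp with rfl | ⟨j, hj, rfl⟩
    · simp [i, i1]
    · simp [hl] at hj; simp [i1, hj.1]
  obtain ⟨P3, hP3, h⟩ := pivot_step i (P2 * g) hP2s hone
  exact ⟨P3 * P2, Pat_append _ hP3 hP2', by rw [mul_assoc]; exact h⟩

end elim
end BG

namespace BG

theorem card_filter_ge (n m : ℕ) : ((List.finRange n).filter fun j : Fin n => m ≤ j.1).length = n - m := by
  have h : (((List.finRange n).filter fun j : Fin n => m ≤ j.1).map Fin.val) = (List.range n).filter (fun j => m ≤ j) := by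
    rw [← List.map_coe_finRange_eq_range, List.filter_map]; rfl
  rw [← List.length_map (f := Fin.val), h]
  induction n with
  | zero => simp
  | succ n ih =>
    rw [List.range_succ, List.filter_append, List.length_append]
    have := ih (by rw [← List.map_coe_finRange_eq_range, List.filter_map]; rfl)
    rw [this]
    by_cases hm : m ≤ n
    · simp [hm]; omega
    · simp [hm]; omega

theorem card_above (n m : ℕ) : (above n m).length = n - (m+1) := card_filter_ge n (m+1)

theorem card_filter_ne (n m : ℕ) (hm : m + 1 < n) :
    ((List.finRange n).filter fun j : Fin n => m ≤ j.1 ∧ j.1 ≠ m + 1).length = n - (m + 1) := by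
  have h1 := card_filter_ge n m
  have hnd : ∀ p : Fin n → Bool, ((List.finRange n).filter p).length = (Finset.univ.filter fun j => p j = true).card := by
    intro p
    rw [← List.toFinset_card_of_nodup (List.Nodup.filter _ (List.nodup_finRange n))]
    congr 1; ext; simp
  rw [hnd] at h1 ⊢
  have : (Finset.univ.filter fun j : Fin n => decide (m ≤ j.1 ∧ j.1 ≠ m + 1) = true) =
    (Finset.univ.filter fun j : Fin n => decide (m ≤ j.1) = true).erase ⟨m+1, hm⟩ := by
    ext j; simp [Fin.ext_iff]; tauto
  rw [this, Finset.card_erase_of_mem (by simp), h1]; omega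

theorem lvl_length (n m : ℕ) (hm : m + 1 < n) : (lvl n m hm).length = 3 * (n - (m+1)) + 1 := by
  simp [lvl, card_above]
  have := card_filter_ne n m hm
  simp at this
  rw [this]; ring

theorem lvl_ne (n m : ℕ) (hm : m + 1 < n) : ∀ p ∈ lvl n m hm, p.1 ≠ p.2 := by
  intro p hp
  simp only [lvl, above, List.mem_append, List.mem_map, List.mem_cons, List.mem_filter, List.mem_finRange, true_and] at hp
  rcases hp with (⟨j, hj, rfl⟩ | ⟨j, hj, rfl⟩) | rfl | ⟨j, hj, rfl⟩ <;> simp [Fin.ext_iff] at * <;> omega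

theorem sr1_pattern (n q : ℕ) (hq : q < n) : ∃ L : List (Fin n × Fin n), (∀ p ∈ L, p.1 ≠ p.2) ∧
    2 * L.length = 3 * q^2 + 5 * q ∧ ∀ (R : Type) [CommRing R], SR1 R →
      ∀ g ∈ Stab n R (n - 1 - q), g ∈ Pat (tv (R := R)) L := by
  induction q with
  | zero =>
    refine ⟨[], by simp, by simp, ?_⟩
    intro R _ _ g hg
    exact Stab_last (by omega) hg
  | succ q ih =>
    obtain ⟨L, h1, h2, h3⟩ := ih (by omega)
    have hm : n - 1 - (q+1) + 1 < n := by omega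
    refine ⟨(lvl n (n-1-(q+1)) hm).reverse ++ L, ?_, ?_, ?_⟩
    · intro p hp
      simp only [List.mem_append, List.mem_reverse] at hp
      exact hp.elim (lvl_ne _ _ _ p) (h1 p)
    · rw [List.length_append, List.length_reverse, lvl_length, mul_add, h2]
      have : n - (n - 1 - (q+1) + 1) = q + 1 := by omega
      rw [this]; ring
    · intro R _ hR g hg
      obtain ⟨P, hP, hPg⟩ := sr1_step hR _ hm g hg
      have : g = P⁻¹ * (P * g) := by group
      rw [this]
      refine Pat_append _ (Pat_inv hP) (h3 R hR _ ?_)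
      convert hPg using 2
      omega

theorem Stab_zero {n : ℕ} {R : Type*} [CommRing R] (g : SL n R) : g ∈ Stab n R 0 := by
  intro a b h; omega

theorem sr1_full_pattern (n : ℕ) (hn : 1 ≤ n) : ∃ L : List (Fin n × Fin n), (∀ p ∈ L, p.1 ≠ p.2) ∧
    L.length = (3 * n^2 - n - 2) / 2 ∧ ∀ (R : Type) [CommRing R], SR1 R →
      ∀ g : SL n R, g ∈ Pat (tv (R := R)) L := by
  obtain ⟨L, h1, h2, h3⟩ := sr1_pattern n (n-1) (by omega)
  refine ⟨L, h1, ?_, fun R _ hR g => h3 R hR g ?_⟩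
  · obtain ⟨m, rfl⟩ : ∃ m, n = m + 1 := ⟨n - 1, by omega⟩
    simp only [Nat.add_sub_cancel] at h2
    have : 3 * (m+1)^2 - (m+1) - 2 = 3 * m^2 + 5 * m := by
      have : 3 * (m+1)^2 = 3 * m^2 + 5 * m + (m + 1) + 2 := by ring
      omega
    omega
  · simpa using Stab_zero g

theorem sr1_Full {n : ℕ} (hn : 1 ≤ n) {R : Type} [CommRing R] (h : SR1 R) : Full n R := by
  obtain ⟨L, _, _, h3⟩ := sr1_full_pattern n hn
  exact fun g => Pat_mem_E (h3 R h g)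

theorem sr1_local (R : Type*) [CommRing R] [IsLocalRing R] : SR1 R := by
  rintro a b ⟨u, v, h⟩
  rcases IsLocalRing.isUnit_or_isUnit_of_add_one h with h1 | h1
  · exact ⟨0, by simpa using isUnit_of_mul_isUnit_right h1⟩
  · have hb := isUnit_of_mul_isUnit_right h1
    obtain ⟨w, rfl⟩ := hb
    exact ⟨(1 - a) * ↑w⁻¹, by simp [mul_assoc]⟩

theorem finite_idem_pow {R : Type*} [CommRing R] [Finite R] (a : R) :
    ∃ N, 0 < N ∧ IsIdempotentElem (a ^ N) := by
  obtain ⟨i, j, hij, h⟩ := Finite.exists_ne_map_eq_of_infinite (fun i : ℕ => a ^ i)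
  wlog hlt : i < j generalizing i j
  · exact this j i hij.symm h.symm (lt_of_le_of_ne (not_lt.mp hlt) hij.symm)
  -- a^i = a^(i+p)
  obtain ⟨p, rfl⟩ : ∃ p, j = i + p := ⟨j - i, by omega⟩
  have hp : 0 < p := by omega
  have hper : ∀ t m, i ≤ m → a ^ (m + t * p) = a ^ m := by
    intro t m hm
    induction t with
    | zero => simp
    | succ t ih =>
      obtain ⟨s, rfl⟩ : ∃ s, m = i + s := ⟨m - i, by omega⟩
      rw [← ih]
      have : i + s + (t+1)*p = (i + p) + (s + t * p) := by ring
      rw [this, pow_add, ← h, ← pow_add]; congr 1; ring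
  refine ⟨(i + 1) * p, by positivity, ?_⟩
  unfold IsIdempotentElem
  rw [← pow_add]
  apply hper
  nlinarith

theorem sr1_finite (R : Type*) [CommRing R] [Finite R] : SR1 R := by
  rintro a b ⟨u, v, h⟩
  obtain ⟨N, hN, hi⟩ := finite_idem_pow a
  -- a + (1 - a^N) v b
  refine ⟨(1 - a ^ N) * v, ?_⟩
  by_contra hu
  obtain ⟨M, hM, hmem⟩ := exists_max_ideal_of_mem_nonunits hu
  have hMp := hM.isPrime
  have h0 : a ^ N * (1 - a^N) = 0 := by
    have := hi.eq; linear_combination -this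
  by_cases ha : a ∈ M
  · have h1 : (1 - a^N) * v * b ∈ M := by
      have := M.sub_mem hmem ha; simpa using this
    have h2 : v * b ∈ M := by
      have e : v * b = (1 - a^N) * v * b + a * (a^(N-1) * v * b) := by
        obtain ⟨k, rfl⟩ : ∃ k, N = k + 1 := ⟨N-1, by omega⟩
        simp; ring
      rw [e]; exact M.add_mem h1 (M.mul_mem_right _ ha)
    have : (1:R) ∈ M := by rw [← h]; exact M.add_mem (M.mul_mem_left _ ha) h2
    exact hM.ne_top ((Ideal.eq_top_iff_one M).mpr this)
  · have h1 : (1 - a^N) ∈ M := by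
      have : a^N * (1 - a^N) ∈ M := by rw [h0]; exact M.zero_mem
      exact (hMp.mem_or_mem this).resolve_left (fun h => ha (hMp.mem_of_pow_mem _ h))
    apply ha
    have := M.sub_mem hmem (M.mul_mem_right b (M.mul_mem_right v h1))
    simpa using this

end BG

namespace BG
section emb
variable {m n l : ℕ} {R : Type*} [CommRing R]

def Umat (R : Type*) [CommRing R] (f : Fin m ↪ Fin n) : Matrix (Fin n) (Fin m) R :=
  Matrix.of fun x y => if x = f y then 1 else 0

theorem Umat_tr_mul (f : Fin m ↪ Fin n) : (Umat R f).transpose * Umat R f = 1 := by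
  ext a b
  rw [Matrix.mul_apply]
  simp [Umat, Matrix.one_apply, eq_comm]

/-- the embedding `SL_m → SL_n` given by an injection of index sets -/
def emb (f : Fin m ↪ Fin n) (M : SL m R) : SL n R :=
  ⟨1 + Umat R f * ((mat M - 1) * (Umat R f).transpose), by
    rw [Matrix.det_one_add_mul_comm, Matrix.mul_assoc, Umat_tr_mul, mul_one, add_sub_cancel, mat_det]⟩

theorem mat_emb (f : Fin m ↪ Fin n) (M : SL m R) :
    mat (emb f M) = 1 + Umat R f * ((mat M - 1) * (Umat R f).transpose) := rfl

theorem emb_mul (f : Fin m ↪ Fin n) (M N : SL m R) : emb f (M * N) = emb f M * emb f N := by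
  apply mat_inj
  rw [mat_mul, mat_emb, mat_emb, mat_emb, mat_mul]
  set U := Umat R f
  have h : U.transpose * U = 1 := Umat_tr_mul f
  have : U * ((mat M - 1) * U.transpose) * (U * ((mat N - 1) * U.transpose))
     = U * ((mat M - 1) * (mat N - 1) * U.transpose) := by
    simp only [Matrix.mul_assoc]
    rw [← Matrix.mul_assoc U.transpose U, h, Matrix.one_mul]
  rw [add_mul, mul_add, mul_add, this]
  simp only [mul_sub, sub_mul, mul_one, one_mul, Matrix.mul_sub, Matrix.sub_mul, Matrix.mul_add, Matrix.add_mul, Matrix.one_mul]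
  abel

theorem emb_one (f : Fin m ↪ Fin n) : emb f (1 : SL m R) = 1 := by
  apply mat_inj; rw [mat_emb]; simp

def embHom (f : Fin m ↪ Fin n) : SL m R →* SL n R := ⟨⟨emb f, emb_one f⟩, emb_mul f⟩

theorem emb_inv (f : Fin m ↪ Fin n) (M : SL m R) : emb f M⁻¹ = (emb f M)⁻¹ := map_inv (embHom f) M

theorem emb_comp (f : Fin m ↪ Fin n) (g : Fin l ↪ Fin m) (M : SL l R) :
    emb f (emb g M) = emb (g.trans f) M := by
  apply mat_inj
  rw [mat_emb, mat_emb, mat_emb]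
  have : Umat R (g.trans f) = Umat R f * Umat R g := by
    ext a b; rw [Matrix.mul_apply]; simp [Umat]
  rw [this, Matrix.transpose_mul]
  simp [Matrix.mul_assoc]

theorem emb_tv (f : Fin m ↪ Fin n) (i j : Fin m) (r : R) : emb f (tv i j r) = tv (f i) (f j) r := by
  by_cases h : i = j
  · subst h; simp [emb_one]
  apply mat_inj
  rw [mat_emb, tv_coe h, tv_coe (fun h' => h (f.injective h'))]
  have e1 : Umat R f * Matrix.single i j r = Matrix.single (f i) j r := by
    ext a b
    simp [Matrix.mul_apply, Umat, Matrix.single_apply, ite_and]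
    split_ifs <;> simp_all
  have e2 : Matrix.single (f i) j r * (Umat R f).transpose = Matrix.single (f i) (f j) r := by
    ext a b
    rw [Matrix.mul_apply, Finset.sum_eq_single j]
    · simp [Umat, Matrix.single_apply, ite_and, eq_comm]
      split_ifs <;> rfl
    · intro c _ hc; simp [Matrix.single_apply, hc.symm]
    · simp
  simp only [Matrix.transvection, add_sub_cancel_left]
  rw [← Matrix.mul_assoc, e1, e2]

theorem emb_mem (f : Fin m ↪ Fin n) {M : SL m R} (h : M ∈ E m R) : emb f M ∈ E n R := by
  refine E_induction (p := fun M => emb f M ∈ E n R) ?_ ?_ h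
  · rw [emb_one]; exact one_mem _
  · intro i j _ r e _ he
    rw [emb_mul, emb_tv]; exact mul_mem (tv_mem _ _ _) he

theorem emb_transpose (f : Fin m ↪ Fin n) (M : SL m R) : emb f M.transpose = (emb f M).transpose := by
  apply mat_inj
  rw [mat_transpose, mat_emb, mat_emb, mat_transpose]
  simp [Matrix.transpose_mul, Matrix.mul_assoc]

theorem mp_emb {S : Type*} [CommRing S] (φ : R →+* S) (f : Fin m ↪ Fin n) (M : SL m R) :
    mp φ (emb f M) = emb f (mp φ M) := by
  apply mat_ext
  intro a b
  rw [mp_apply, mat_emb, mat_emb]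
  simp [Matrix.mul_apply, Umat, Matrix.add_apply, Matrix.one_apply, apply_ite φ, mp_apply]

def J : Fin 2 ↪ Fin 3 := ⟨![0,1], by decide⟩
def J02 : Fin 2 ↪ Fin 3 := ⟨![0,2], by decide⟩
def J12 : Fin 2 ↪ Fin 3 := ⟨![1,2], by decide⟩

def El (a b : R) : Prop := ∀ M : SL 2 R, mat M 0 0 = a → mat M 0 1 = b → emb J M ∈ E 3 R

def mk2 (a b c d : R) (h : a * d - b * c = 1) : SL 2 R := ⟨!![a, b; c, d], by rw [Matrix.det_fin_two_of]; exact h⟩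

theorem mat_mk2 (a b c d : R) (h : a * d - b * c = 1) : mat (mk2 a b c d h) = !![a, b; c, d] := rfl

theorem eq_mk2 (M : SL 2 R) : ∃ a b c d, ∃ h : a * d - b * c = 1, M = mk2 a b c d h := by
  refine ⟨mat M 0 0, mat M 0 1, mat M 1 0, mat M 1 1, ?_, ?_⟩
  · rw [← Matrix.det_fin_two, mat_det]
  · apply mat_inj; rw [mat_mk2]; exact Matrix.eta_fin_two _

theorem exists_extend (hn : 3 ≤ n) (f : Fin 2 ↪ Fin n) : ∃ F : Fin 3 ↪ Fin n, f = J.trans F := by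
  obtain ⟨k, hk⟩ : ∃ k : Fin n, k ∉ ({f 0, f 1} : Finset (Fin n)) := by
    by_contra! h
    have h1 : (Finset.univ : Finset (Fin n)) ⊆ {f 0, f 1} := fun x _ => h x
    have h2 := Finset.card_le_card h1
    have h3 := Finset.card_le_two (a := f 0) (b := f 1)
    simp at h2; omega
  simp at hk
  have h01 : f 0 ≠ f 1 := fun h => by simpa using f.injective h
  refine ⟨⟨![f 0, f 1, k], ?_⟩, ?_⟩
  · intro a b hab
    fin_cases a <;> fin_cases b <;> simp_all [eq_comm]
  · ext a; fin_cases a <;> rfl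

theorem El.mem (hn : 3 ≤ n) {M : SL 2 R} (h : El (mat M 0 0) (mat M 0 1)) (f : Fin 2 ↪ Fin n) :
    emb f M ∈ E n R := by
  obtain ⟨F, rfl⟩ := exists_extend hn f
  rw [← emb_comp]
  exact emb_mem F (h M rfl rfl)

theorem emb_J (a b c d : R) (h) : mat (emb J (mk2 a b c d h)) = !![a, b, 0; c, d, 0; 0, 0, 1] := by
  rw [mat_emb, mat_mk2]
  ext i j; fin_cases i <;> fin_cases j <;> simp [Matrix.mul_apply, Umat, J, Fin.sum_univ_succ]

theorem emb_J02 (a b c d : R) (h) : mat (emb J02 (mk2 a b c d h)) = !![a, 0, b; 0, 1, 0; c, 0, d] := by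
  rw [mat_emb, mat_mk2]
  ext i j; fin_cases i <;> fin_cases j <;> simp [Matrix.mul_apply, Umat, J02, Fin.sum_univ_succ]

theorem emb_J12 (a b c d : R) (h) : mat (emb J12 (mk2 a b c d h)) = !![1, 0, 0; 0, a, b; 0, c, d] := by
  rw [mat_emb, mat_mk2]
  ext i j; fin_cases i <;> fin_cases j <;> simp [Matrix.mul_apply, Umat, J12, Fin.sum_univ_succ]

theorem tv01 (t : R) : mat (tv (0 : Fin 2) 1 t) = !![1, t; 0, 1] := by
  rw [tv_coe (by decide)]
  ext i j; fin_cases i <;> fin_cases j <;> simp [Matrix.transvection, Matrix.single_apply]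
theorem tv10 (t : R) : mat (tv (1 : Fin 2) 0 t) = !![1, 0; t, 1] := by
  rw [tv_coe (by decide)]
  ext i j; fin_cases i <;> fin_cases j <;> simp [Matrix.transvection, Matrix.single_apply]
theorem tv3_21 (t : R) : mat (tv (2 : Fin 3) 1 t) = !![1, 0, 0; 0, 1, 0; 0, t, 1] := by
  rw [tv_coe (by decide)]
  ext i j; fin_cases i <;> fin_cases j <;> simp [Matrix.transvection, Matrix.single_apply]
theorem tv3_20 (t : R) : mat (tv (2 : Fin 3) 0 t) = !![1, 0, 0; 0, 1, 0; t, 0, 1] := by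
  rw [tv_coe (by decide)]
  ext i j; fin_cases i <;> fin_cases j <;> simp [Matrix.transvection, Matrix.single_apply]
theorem tv3_02 (t : R) : mat (tv (0 : Fin 3) 2 t) = !![1, 0, t; 0, 1, 0; 0, 0, 1] := by
  rw [tv_coe (by decide)]
  ext i j; fin_cases i <;> fin_cases j <;> simp [Matrix.transvection, Matrix.single_apply]
theorem tv3_12 (t : R) : mat (tv (1 : Fin 3) 2 t) = !![1, 0, 0; 0, 1, t; 0, 0, 1] := by
  rw [tv_coe (by decide)]
  ext i j; fin_cases i <;> fin_cases j <;> simp [Matrix.transvection, Matrix.single_apply]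

theorem ext2 {a b c d a' b' c' d' : R} (h1 : a = a') (h2 : b = b') (h3 : c = c') (h4 : d = d') :
    (!![a, b; c, d] : Matrix (Fin 2) (Fin 2) R) = !![a', b'; c', d'] := by
  rw [h1, h2, h3, h4]

/-- one completion suffices -/
theorem El.of_mk {a b c d : R} {hd : a * d - b * c = 1} (h : emb J (mk2 a b c d hd) ∈ E 3 R) : El a b := by
  intro N h1 h2
  obtain ⟨a', b', c', d', hd', rfl⟩ := eq_mk2 N
  simp only [mat_mk2] at h1 h2
  simp at h1 h2
  subst h1 h2
  have : mk2 a' b' c' d' hd' = tv 1 0 (c' * d - c * d') * mk2 a' b' c d hd := by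
    apply mat_inj
    rw [mat_mul, tv10, mat_mk2, mat_mk2, Matrix.mul_fin_two]
    refine ext2 (by ring) (by ring) ?_ ?_
    · linear_combination (-c') * hd + c * hd'
    · linear_combination (-d') * hd + d * hd'
  rw [this, emb_mul, emb_tv]
  exact mul_mem (tv_mem _ _ _) h

theorem El.add_left {a b : R} (t : R) (h : El a b) : El (a + t * b) b := by
  intro M h1 h2
  obtain ⟨a', b', c, d, hd, rfl⟩ := eq_mk2 M
  simp only [mat_mk2] at h1 h2
  simp at h1 h2
  have : mk2 a' b' c d hd = mk2 a b (c - t * d) d (by subst h1 h2; linear_combination hd) * tv 1 0 t := by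
    apply mat_inj
    rw [mat_mul, tv10, mat_mk2, mat_mk2, Matrix.mul_fin_two]
    subst h1 h2
    exact ext2 (by ring) (by ring) (by ring) (by ring)
  rw [this, emb_mul, emb_tv]
  exact mul_mem (h _ rfl rfl) (tv_mem _ _ _)

theorem El.add_right {a b : R} (t : R) (h : El a b) : El a (b + t * a) := by
  intro M h1 h2
  obtain ⟨a', b', c, d, hd, rfl⟩ := eq_mk2 M
  simp only [mat_mk2] at h1 h2
  simp at h1 h2
  have : mk2 a' b' c d hd = mk2 a b c (d - t * c) (by subst h1 h2; linear_combination hd) * tv 0 1 t := by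
    apply mat_inj
    rw [mat_mul, tv01, mat_mk2, mat_mk2, Matrix.mul_fin_two]
    subst h1 h2
    exact ext2 (by ring) (by ring) (by ring) (by ring)
  rw [this, emb_mul, emb_tv]
  exact mul_mem (h _ rfl rfl) (tv_mem _ _ _)

theorem El.congr {a b a' b' : R} (h : El a b) (h1 : a = a') (h2 : b = b') : El a' b' := by
  subst h1 h2; exact h

theorem El.rot {a b : R} (h : El a b) : El (-b) a := by
  have h1 := ((h.add_right 1).add_left (-1)).add_right 1
  exact h1.congr (by ring) (by ring)

theorem w_mem (hn : 3 ≤ n) (f : Fin 2 ↪ Fin n) : emb f (mk2 (0:R) 1 (-1) 0 (by ring)) ∈ E n R := by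
  have : mk2 (0:R) 1 (-1) 0 (by ring) = tv 0 1 1 * tv 1 0 (-1) * tv 0 1 1 := by
    apply mat_inj
    simp only [mat_mul, mat_mk2, tv01, tv10, Matrix.mul_fin_two]
    exact ext2 (by ring) (by ring) (by ring) (by ring)
  rw [this, emb_mul, emb_mul, emb_tv, emb_tv]
  exact mul_mem (mul_mem (tv_mem _ _ _) (tv_mem _ _ _)) (tv_mem _ _ _)

theorem El.neg_right {a b : R} (h : El a b) : El a (-b) := by
  intro M h1 h2
  obtain ⟨a', b', c, d, hd, rfl⟩ := eq_mk2 M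
  simp only [mat_mk2] at h1 h2
  simp at h1 h2
  subst h1 h2
  set w : SL 3 R := emb J12 (mk2 (0:R) 1 (-1) 0 (by ring)) with hw
  have hwm : w ∈ E 3 R := w_mem le_rfl _
  have key : emb J (mk2 a' b (-c) d (by linear_combination hd)) ∈ E 3 R := h _ rfl rfl
  have : emb J (mk2 a' (-b) c d hd) = (w * w) * emb J (mk2 a' b (-c) d (by linear_combination hd)) * (w * w)⁻¹ := by
    rw [eq_mul_inv_iff_mul_eq]
    apply mat_inj
    simp only [mat_mul, hw, emb_J, emb_J12, Matrix.mul_fin_three]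
    simp
  rw [this]
  exact mul_mem (mul_mem (mul_mem hwm hwm) key) (inv_mem (mul_mem hwm hwm))

theorem El.swap {a b : R} (h : El a b) : El b a :=
  (h.neg_right.rot).congr (by ring) rfl

theorem El_unit {a : R} (ha : IsUnit a) (b : R) : El a b := by
  obtain ⟨u, rfl⟩ := ha
  have h1 : El (1 : R) 0 := by
    have : emb J (mk2 (1:R) 0 0 1 (by ring)) ∈ E 3 R := by
      have e : mk2 (1:R) 0 0 1 (by ring) = 1 := by
        apply mat_inj; rw [mat_mk2, mat_one, Matrix.one_fin_two]
      rw [e, emb_one]; exact one_mem _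
    exact El.of_mk this
  obtain ⟨v, hv⟩ : ∃ v : R, u * v = 1 := ⟨↑u⁻¹, Units.mul_inv u⟩
  exact (((h1.add_right 1).add_left ((u:R) - 1)).add_right (v * (b - 1))).congr (by ring)
    (by linear_combination (b - 1) * hv)

theorem mennicke_id {a b1 b2 c1 c2 d1 d2 : R} (h1 : a * d1 - b1 * c1 = 1) (h2 : a * d2 - b2 * c2 = 1) :
    ∃ t1 ∈ E 3 R, ∃ h3, emb J12 (mk2 d1 (-c1) (-b1) a (by linear_combination h1)) * emb J02 (mk2 a b2 c2 d2 h2) * t1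
     = emb J (mk2 a (b1 * b2) (-c1*c2) (d1 - c1*b1*d2) h3) := by
  refine ⟨tv 2 1 b1 * tv 0 2 (-(b2 * d1)) * tv 1 2 c1 * tv 2 0 (-(a * c2)) * tv 2 1 (b1 - a * b1 * d2), ?_, ?_, ?_⟩
  · exact mul_mem (mul_mem (mul_mem (mul_mem (tv_mem _ _ _) (tv_mem _ _ _)) (tv_mem _ _ _)) (tv_mem _ _ _)) (tv_mem _ _ _)
  · linear_combination h1 - b1 * c1 * h2
  · apply mat_inj
    simp only [mat_mul, tv3_21, tv3_20, tv3_02, tv3_12, emb_J, emb_J02, emb_J12, Matrix.mul_fin_three]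
    have e1 : a * d1 = 1 + b1 * c1 := by linear_combination h1
    have e2 : a * d2 = 1 + b2 * c2 := by linear_combination h2
    ext i j; fin_cases i <;> fin_cases j <;> simp
    all_goals grind

theorem El.theta {a b1 c1 d1 : R} (h1 : a * d1 - b1 * c1 = 1) (h : El a b1) (f : Fin 2 ↪ Fin 3) :
    emb f (mk2 d1 (-c1) (-b1) a (by linear_combination h1)) ∈ E 3 R := by
  have key : emb f (mk2 a b1 c1 d1 h1) ∈ E 3 R := El.mem le_rfl (by simpa [mat_mk2] using h) f
  have k2 := transpose_mem (inv_mem key)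
  rw [← emb_inv, ← emb_transpose] at k2
  convert k2 using 2
  have e2 : (mk2 a b1 c1 d1 h1)⁻¹ = mk2 d1 (-b1) (-c1) a (by linear_combination h1) := by
    symm
    apply eq_inv_of_mul_eq_one_left
    apply mat_inj
    rw [mat_mul, mat_mk2, mat_mk2, Matrix.mul_fin_two, mat_one, Matrix.one_fin_two]
    exact ext2 (by linear_combination h1) (by ring) (by ring) (by linear_combination h1)
  rw [e2]
  apply mat_inj
  rw [mat_transpose, mat_mk2, mat_mk2]
  ext i j; fin_cases i <;> fin_cases j <;> rfl

theorem El.mul {a b1 b2 : R} (h1 : El a b1) (h2 : El a b2) : El a (b1 * b2) := by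
  intro M e1 e2
  obtain ⟨a', b', c, d, hd, rfl⟩ := eq_mk2 M
  simp only [mat_mk2] at e1 e2
  simp at e1 e2
  subst e1 e2
  have hd1 : a' * d - b1 * (b2 * c) = 1 := by linear_combination hd
  have hd2 : a' * d - b2 * (b1 * c) = 1 := by linear_combination hd
  obtain ⟨t, ht, h3, he⟩ := mennicke_id hd1 hd2
  have : El a' (b1 * b2) := by
    refine El.of_mk (hd := h3) ?_
    rw [← he]
    exact mul_mem (mul_mem (h1.theta hd1 _) (El.mem le_rfl (by simpa [mat_mk2] using h2) _)) ht
  exact this _ rfl rfl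

theorem exists_fac : ∃ F : Fin 3 ↪ Fin 3, J = J02.trans F :=
  ⟨⟨![0,2,1], by decide⟩, by ext a; fin_cases a <;> rfl⟩

theorem El.div {a b1 b2 : R} (hc : IsCoprime a b1) (h1 : El a b1) (h2 : El a (b1 * b2)) : El a b2 := by
  intro M e1 e2
  obtain ⟨a', b', c, d, hd, rfl⟩ := eq_mk2 M
  simp only [mat_mk2] at e1 e2
  simp at e1 e2
  subst e1 e2
  obtain ⟨u, v, huv⟩ := hc
  have hd1 : a' * u - b1 * (-v) = 1 := by linear_combination huv
  obtain ⟨t, ht, h3, he⟩ := mennicke_id hd1 hd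
  have hm := h2 _ (show mat (mk2 a' (b1 * b') _ _ h3) 0 0 = a' by simp [mat_mk2]) (by simp [mat_mk2])
  rw [← he] at hm
  have k1 : emb J02 (mk2 a' b' c d hd) ∈ E 3 R := by
    have := (Subgroup.mul_mem_cancel_left _ (h1.theta hd1 J12)).mp ((Subgroup.mul_mem_cancel_right _ ht).mp hm)
    exact this
  obtain ⟨F, hF⟩ := exists_fac
  rw [hF, ← emb_comp]
  exact emb_mem F k1

theorem emb_mul_apply (f : Fin m ↪ Fin n) (M : SL m R) (g : SL n R) (x b : Fin n) :
    mat (emb f M * g) x b = mat g x b + ∑ p, if x = f p then ∑ q, (mat M - 1) p q * mat g (f q) b else 0 := by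
  rw [mat_mul, mat_emb, add_mul, one_mul, Matrix.add_apply, Matrix.mul_assoc, Matrix.mul_assoc]
  congr 1
  rw [Matrix.mul_apply]
  refine Finset.sum_congr rfl fun p _ => ?_
  rw [Matrix.mul_apply]
  have : ∀ q, ((Umat R f).transpose * mat g) q b = mat g (f q) b := by
    intro q; rw [Matrix.mul_apply]; simp [Umat]
  simp only [this]
  simp [Umat]

theorem emb_mem_Stab (f : Fin m ↪ Fin n) (M : SL m R) (k : ℕ) (hf : ∀ p, k ≤ (f p).1) : emb f M ∈ Stab n R k := by
  intro a b hab
  have : mat (emb f M) a b = mat (emb f M * 1) a b := by rw [mul_one]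
  rw [this, emb_mul_apply, mat_one_apply, Finset.sum_eq_zero, add_zero]
  intro p _
  split_ifs with h
  · apply Finset.sum_eq_zero
    intro q _
    have : f q ≠ b := by
      rintro rfl
      have := hf p; have := hf q
      subst h; omega
    simp [mat_one_apply, this]
  · rfl

def pr (i j : Fin n) (h : i ≠ j) : Fin 2 ↪ Fin n :=
  ⟨![i, j], by intro a b hab; fin_cases a <;> fin_cases b <;> simp_all [eq_comm]⟩

theorem pr_zero (i j : Fin n) (h : i ≠ j) : pr i j h 0 = i := rfl
theorem pr_one (i j : Fin n) (h : i ≠ j) : pr i j h 1 = j := rfl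

theorem pr_mul_apply (i j : Fin n) (h : i ≠ j) (a b c d : R) (hd) (g : SL n R) (x y : Fin n) :
    mat (emb (pr i j h) (mk2 a b c d hd) * g) x y =
      if x = i then a * mat g i y + b * mat g j y else if x = j then c * mat g i y + d * mat g j y
        else mat g x y := by
  rw [emb_mul_apply, mat_mk2]
  simp [pr_zero, pr_one, Fin.sum_univ_two, Matrix.one_apply]
  by_cases hi : x = i
  · subst hi; simp [h]; ring
  · by_cases hj : x = j
    · subst hj; simp [hi]; ring
    · simp [hi, hj]

/-- Elimination criterion for Bezout-type domains. -/
theorem bezout_Full (hn : 3 ≤ n) [IsDomain R] (hB : ∀ a b : R, ∃ d a' b', a = d * a' ∧ b = d * b' ∧ IsCoprime a' b')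
    (hE : ∀ a b : R, IsCoprime a b → El a b) : Full n R := by
  have key : ∀ q, q < n → ∀ g ∈ Stab n R (n - 1 - q), g ∈ E n R := by
    intro q
    induction q with
    | zero =>
      intro hq g hg
      rw [Stab_last (by omega) hg]; exact one_mem _
    | succ q ih =>
      intro hq g hg
      set m := n - 1 - (q + 1) with hm
      have hm1 : m + 1 < n := by omega
      set i : Fin n := ⟨m, by omega⟩ with hi
      set i1 : Fin n := ⟨m+1, hm1⟩ with hi1
      have hclear : ∀ l : List (Fin n), (∀ j ∈ l, m < j.1) → ∃ e ∈ E n R, e ∈ Stab n R m ∧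
          ∀ j ∈ l, mat (e * g) j i = 0 := by
        intro l
        induction l with
        | nil => intro _; exact ⟨1, one_mem _, one_mem _, by simp⟩
        | cons j l ihl =>
          intro hl
          obtain ⟨e, he, hes, hz⟩ := ihl fun j hj => hl j (by simp [hj])
          have hj := hl j (by simp)
          have hij : i ≠ j := by rintro rfl; simp [hi] at hj
          obtain ⟨d, a', b', ha, hb, u, v, huv⟩ := hB (mat (e * g) i i) (mat (e * g) j i)
          have hdet : u * a' - v * (-b') = 1 := by linear_combination huv
          refine ⟨emb (pr i j hij) (mk2 u v (-b') a' hdet) * e, mul_mem ?_ he, mul_mem ?_ hes, ?_⟩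
          · refine El.mem hn ?_ _
            simp only [mat_mk2]
            refine hE _ _ ⟨a', b', ?_⟩
            simp; linear_combination huv
          · refine emb_mem_Stab _ _ _ ?_
            intro p; fin_cases p <;> simp [pr, hi, hj.le]
          · intro x hx
            have hxi : x ≠ i := by
              rintro rfl; have := hl i hx; simp [hi] at this
            rw [mul_assoc, pr_mul_apply, if_neg hxi, ha, hb]
            split_ifs with hxj
            · ring
            · simp only [List.mem_cons, hxj, false_or] at hx
              exact hz x hx
      obtain ⟨e, he, hes, hz⟩ := hclear (above n m) (by intro j hj; simpa [above] using hj)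
      have hgs : e * g ∈ Stab n R m := mul_mem hes hg
      obtain ⟨c, hc0, hc1⟩ := col_unimod (m := i) hgs
      rw [Finset.sum_eq_single i] at hc1
      rotate_left
      · intro j _ hj
        rcases lt_or_ge m j.1 with h | h
        · rw [hz j (by simpa [above] using h), mul_zero]
        · rw [hc0 j (lt_of_le_of_ne h (fun h' => hj (Fin.ext h'))), zero_mul]
      · simp
      have hii : i ≠ i1 := by simp [hi, hi1]
      have hdet : c i * mat (e * g) i i - 0 * 0 = 1 := by rw [hc1]; ring
      set e2 := emb (pr i i1 hii) (mk2 (c i) 0 0 (mat (e * g) i i) hdet) with he2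
      have he2E : e2 ∈ E n R := by
        refine El.mem hn ?_ _
        simp only [mat_mk2]
        exact El_unit (IsUnit.of_mul_eq_one _ hc1) _
      have he2s : e2 ∈ Stab n R m := by
        refine emb_mem_Stab _ _ _ ?_
        intro p; fin_cases p <;> simp [pr, hi, hi1]
      have hone : mat (e2 * (e * g)) i i = 1 := by
        rw [he2, pr_mul_apply, if_pos rfl, hc1]; ring
      obtain ⟨P, hP, hPs⟩ := pivot_step i (e2 * (e * g)) (mul_mem he2s hgs) hone
      have := ih (by omega) (P * (e2 * (e * g))) (by convert hPs using 2; simp [hi]; omega)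
      rw [← mul_assoc, ← mul_assoc] at this
      refine (Subgroup.mul_mem_cancel_left _ ?_).mp this
      exact mul_mem (mul_mem (Pat_mem_E hP) he2E) he
  exact fun g => key (n-1) (by omega) g (by simpa using Stab_zero g)

end emb
end BG

namespace BG
section euclid
variable {n : ℕ} {R : Type*} [CommRing R]

theorem pid_coprime [IsDomain R] [IsPrincipalIdealRing R] (a b : R) :
    ∃ d a' b', a = d * a' ∧ b = d * b' ∧ IsCoprime a' b' := by
  by_cases h0 : a = 0 ∧ b = 0
  · exact ⟨0, 1, 0, by simp [h0.1], by simp [h0.2], isCoprime_one_left⟩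
  obtain ⟨d, hd⟩ := (IsPrincipalIdealRing.principal (Ideal.span {a, b})).principal
  have hd : Ideal.span {a, b} = Ideal.span {d} := hd
  have ha : a ∈ Ideal.span {d} := by rw [← hd]; exact Ideal.subset_span (by simp)
  have hb : b ∈ Ideal.span {d} := by rw [← hd]; exact Ideal.subset_span (by simp)
  have hdm : d ∈ Ideal.span {a, b} := by rw [hd]; exact Ideal.mem_span_singleton_self d
  obtain ⟨a', rfl⟩ := Ideal.mem_span_singleton'.mp ha
  obtain ⟨b', rfl⟩ := Ideal.mem_span_singleton'.mp hb
  obtain ⟨u, v, huv⟩ := Ideal.mem_span_pair.mp hdm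
  have hdn : d ≠ 0 := by rintro rfl; simp at h0
  refine ⟨d, a', b', mul_comm _ _, mul_comm _ _, u, v, ?_⟩
  apply mul_right_cancel₀ hdn
  linear_combination huv

theorem euclid_El {R : Type*} [EuclideanDomain R] (a b : R) (h : IsCoprime a b) : El a b := by
  revert h
  refine EuclideanDomain.GCD.induction (P := fun a b => IsCoprime a b → El a b) a b ?_ ?_
  · intro x h
    exact (El_unit (isCoprime_zero_left.mp h) 0).swap
  · intro a b ha ih h
    have e : b = b % a + (b / a) * a := by
      have := EuclideanDomain.mod_add_div b a; linear_combination -this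
    have h2 : IsCoprime (b % a) a := by
      rw [e] at h
      exact (IsCoprime.of_add_mul_right_right h).symm
    have := ((ih h2).swap).add_right (b / a)
    exact this.congr rfl e.symm

theorem euclid_Full (hn : 3 ≤ n) {R : Type*} [EuclideanDomain R] : Full n R :=
  bezout_Full hn pid_coprime euclid_El

theorem full_int (hn : 3 ≤ n) : Full n ℤ := euclid_Full hn
theorem full_polyField (hn : 3 ≤ n) (K : Type*) [Field K] : Full n (Polynomial K) := euclid_Full hn

end euclid
end BG

namespace BG
section dil
open Polynomial
variable {n : ℕ}

/-- group generated by `tv i j w`, `w ∈ W` -/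
def DD (n : ℕ) {B : Type*} [CommRing B] (W : Set B) : Subgroup (SL n B) :=
  Subgroup.closure {g | ∃ i j, i ≠ j ∧ ∃ r ∈ W, g = tv i j r}

theorem DD_mem {B : Type*} [CommRing B] {W : Set B} {i j : Fin n} {r : B} (h : r ∈ W) : tv i j r ∈ DD n W := by
  by_cases hij : i = j
  · subst hij; simp [one_mem]
  · exact Subgroup.subset_closure ⟨i, j, hij, r, h, rfl⟩

theorem tv_comm_eq {B : Type*} [CommRing B] {i j k : Fin n} (hij : i ≠ j) (hjk : j ≠ k) (hik : i ≠ k) (a b : B) :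
    tv i k (a * b) = tv i j a * tv j k b * (tv i j a)⁻¹ * (tv j k b)⁻¹ := by
  rw [tv_c1 hij hjk hik]; group

theorem DD_conj {B : Type*} [CommRing B] (hn : 3 ≤ n) (c : B) (W0 W1 W2 : Set B) (h10 : ∀ w ∈ W1, w ∈ W0) (hc : ∀ w ∈ W1, c * w ∈ W0)
    (h21 : ∀ w ∈ W2, w ∈ W1) (hp : ∀ w ∈ W2, ∃ a ∈ W1, ∃ b ∈ W1, w = a * b) {k l : Fin n} (hkl : k ≠ l) {g : SL n B}
    (hg : g ∈ DD n W2) : tv k l c * g * (tv k l c)⁻¹ ∈ DD n W0 := by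
  have non : ∀ i j, i ≠ j → ¬ (l = i ∧ k = j) → ∀ w ∈ W1, tv k l c * tv i j w * (tv k l c)⁻¹ ∈ DD n W0 := by
    intro i j hij hno w hw
    by_cases hli : l = i
    · subst hli
      have hkj : k ≠ j := fun h => hno ⟨rfl, h⟩
      rw [tv_c1 hkl hij hkj]
      have : tv k j (c * w) * tv l j w * tv k l c * (tv k l c)⁻¹ = tv k j (c * w) * tv l j w := by group
      rw [this]
      exact mul_mem (DD_mem (hc w hw)) (DD_mem (h10 w hw))
    · by_cases hkj : k = j
      · subst hkj
        have h1 := tv_c1 hij hkl (Ne.symm hli) w c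
        have h2 : tv k l c * tv i k w * (tv k l c)⁻¹ = (tv i l (c * w))⁻¹ * tv i k w := by
          rw [mul_comm w c] at h1
          rw [eq_inv_mul_iff_mul_eq, ← mul_assoc, ← mul_assoc, ← h1]; group
        rw [h2]
        exact mul_mem (inv_mem (DD_mem (hc w hw))) (DD_mem (h10 w hw))
      · rw [tv_c2 hkl hij hli hkj]
        have : tv i j w * tv k l c * (tv k l c)⁻¹ = tv i j w := by group
        rw [this]; exact DD_mem (h10 w hw)
  induction hg using Subgroup.closure_induction with
  | mem x hx =>
    obtain ⟨i, j, hij, w, hw, rfl⟩ := hx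
    by_cases hno : l = i ∧ k = j
    · obtain ⟨rfl, rfl⟩ := hno
      obtain ⟨d, hd⟩ : ∃ d : Fin n, d ∉ ({l, k} : Finset (Fin n)) := by
        by_contra! h
        have h1 : (Finset.univ : Finset (Fin n)) ⊆ {l, k} := fun x _ => h x
        have := Finset.card_le_card h1
        have := Finset.card_le_two (a := l) (b := k)
        simp at *; omega
      simp only [Finset.mem_insert, Finset.mem_singleton, not_or] at hd
      obtain ⟨a, ha, b, hb, rfl⟩ := hp w hw
      rw [tv_comm_eq (Ne.symm hd.1) hd.2 hij]
      have h1 := non l d (Ne.symm hd.1) (by rintro ⟨_, rfl⟩; exact hd.2 rfl) a ha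
      have h2 := non d k hd.2 (by rintro ⟨rfl, _⟩; exact hd.1 rfl) b hb
      have := mul_mem (mul_mem (mul_mem h1 h2) (inv_mem h1)) (inv_mem h2)
      convert this using 1
      group
    · exact non i j hij hno w (h21 w hw)
  | one => simp [one_mem]
  | mul x y _ _ hx hy =>
    convert mul_mem hx hy using 1; group
  | inv x _ hx =>
    convert inv_mem hx using 1; group

variable {P Q : Type*} [CommRing P] [CommRing Q]

/-- The set of polynomials over `Q` that are images of multiples of `s`. -/
def Wset (φ : P →+* Q) (s : P) : Set (Polynomial Q) := {w | ∃ q : Polynomial P, w = (C s * q).map φ}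

theorem poly_den (φ : P →+* Q) (M : Submonoid P) (hden : ∀ q : Q, ∃ s ∈ M, ∃ p, φ s * q = φ p) (f : Polynomial Q) :
    ∃ s ∈ M, ∃ p : Polynomial P, C (φ s) * f = p.map φ := by
  induction f using Polynomial.induction_on' with
  | add p q hp hq =>
    obtain ⟨s, hs, a, ha⟩ := hp
    obtain ⟨t, ht, b, hb⟩ := hq
    refine ⟨s * t, mul_mem hs ht, C t * a + C s * b, ?_⟩
    simp only [Polynomial.map_add, Polynomial.map_mul, Polynomial.map_C, map_mul, ← ha, ← hb]
    ring
  | monomial k a =>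
    obtain ⟨s, hs, p, hp⟩ := hden a
    exact ⟨s, hs, monomial k p, by rw [C_mul_monomial, hp, map_monomial]⟩

/-- substitution `Y ↦ a Y` -/
noncomputable def scl (a : P) : Polynomial P →+* Polynomial P := compRingHom (C a * X)

theorem scl_C (a b : P) : scl a (C b) = C b := by simp [scl]
theorem scl_X (a : P) : scl a X = C a * X := by simp [scl]

theorem map_scl (φ : P →+* Q) (a : P) (f : Polynomial P) : (scl a f).map φ = scl (φ a) (f.map φ) := by
  simp [scl, Polynomial.map_comp]

theorem scl_sub (φ : P →+* Q) (s0 s1 t : P) (r : Polynomial Q) (p : Polynomial P) (hp : C (φ s1) * r = p.map φ) :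
    scl (φ (s0 * s1 * t)) r - C (r.coeff 0) ∈ Wset φ s0 := by
  have hr : r = C (r.coeff 0) + X * r.divX := by
    conv_lhs => rw [← divX_mul_X_add r]
    ring
  have hp' : p.map φ - C ((p.map φ).coeff 0) = X * (p.divX).map φ := by
    conv_lhs => rw [← divX_mul_X_add p]
    simp; ring
  have h3 : C (φ s1) * (X * r.divX) = X * (p.divX).map φ := by
    rw [← hp', ← hp]
    have h0 : (C (φ s1) * r).coeff 0 = φ s1 * r.coeff 0 := by simp
    rw [h0]
    conv_rhs => rw [hr]
    simp
    ring
  have h4 : C (φ s1) * r.divX = (p.divX).map φ := by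
    have : X * (C (φ s1) * r.divX) = X * (p.divX).map φ := by rw [← h3]; ring
    ext m
    have := congrArg (fun f => f.coeff (m+1)) this
    simpa [coeff_X_mul] using this
  have e : scl (φ (s0 * s1 * t)) r - C (r.coeff 0) = C (φ (s0*s1*t)) * X * scl (φ (s0 * s1 * t)) r.divX := by
    conv_lhs => rw [hr]
    simp only [map_add, map_mul, scl_C, scl_X]
    simp
  refine ⟨C t * X * scl (s0 * s1 * t) p.divX, ?_⟩
  rw [e]
  simp only [Polynomial.map_mul, Polynomial.map_C, Polynomial.map_X, map_scl, ← h4]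
  simp only [map_mul, scl_C]
  ring

theorem dil2 (hn : 3 ≤ n) (φ : P →+* Q) (M : Submonoid P) (hden : ∀ q : Q, ∃ s ∈ M, ∃ p, φ s * q = φ p)
    {h : SL n (Polynomial Q)} (hh : h ∈ E n (Polynomial Q)) :
    ∀ s0 ∈ M, ∃ s ∈ M, ∀ t, mp (scl (φ (s * t))) h * (mp (C.comp (evalRingHom 0)) h)⁻¹ ∈ DD n (Wset φ s0) := by
  refine E_induction (p := fun h => ∀ s0 ∈ M, ∃ s ∈ M, ∀ t, mp (scl (φ (s * t))) h * (mp (C.comp (evalRingHom 0)) h)⁻¹ ∈ DD n (Wset φ s0)) ?_ ?_ hh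
  · intro s0 hs0
    exact ⟨1, one_mem _, by simp [one_mem]⟩
  · intro k l hkl r e _ ih s0 hs0
    obtain ⟨u, hu, p, hp⟩ := hden (r.coeff 0)
    obtain ⟨s, hs, hst⟩ := ih ((s0 * u) * (s0 * u)) (mul_mem (mul_mem hs0 hu) (mul_mem hs0 hu))
    obtain ⟨s1, hs1, f, hf⟩ := poly_den φ M hden r
    refine ⟨s * (s0 * s1), mul_mem hs (mul_mem hs0 hs1), fun t => ?_⟩
    have h1 := hst ((s0 * s1) * t)
    have h2 := scl_sub φ s0 s1 (s * t) r f hf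
    rw [show s * (s0 * s1) * t = s * (s0 * s1 * t) by ring]
    rw [show s0 * s1 * (s * t) = s * (s0 * s1 * t) by ring] at h2
    generalize s * (s0 * s1 * t) = σ at *
    rw [map_mul, map_mul, mp_tv, mp_tv, mul_inv_rev]
    have e0 : (C.comp (evalRingHom 0)) r = C (r.coeff 0) := by simp [coeff_zero_eq_eval_zero]
    rw [e0]
    have h3 := DD_conj hn (C (r.coeff 0)) (Wset φ s0) (Wset φ (s0 * u)) (Wset φ ((s0 * u)*(s0*u))) ?_ ?_ ?_ ?_ hkl h1
    · have h4 := mul_mem (DD_mem (i := k) (j := l) h2) h3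
      convert h4 using 1
      have : scl (φ σ) r = (scl (φ σ) r - C (r.coeff 0)) + C (r.coeff 0) := by ring
      conv_lhs => rw [this, tv_add]
      group
    · rintro w ⟨q, rfl⟩
      exact ⟨C u * q, by simp; ring⟩
    · rintro w ⟨q, rfl⟩
      refine ⟨C p * q, ?_⟩
      simp only [Polynomial.map_mul, Polynomial.map_C, map_mul, ← hp]; ring
    · rintro w ⟨q, rfl⟩
      exact ⟨C (s0 * u) * q, by simp; ring⟩
    · rintro w ⟨q, rfl⟩
      exact ⟨_, ⟨1, rfl⟩, _, ⟨q, rfl⟩, by simp; ring⟩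

theorem dil (hn : 3 ≤ n) (φ : P →+* Q) (hφ : Function.Injective φ) (M : Submonoid P) (hden : ∀ q : Q, ∃ s ∈ M, ∃ p, φ s * q = φ p)
    {h : SL n (Polynomial P)} (h0 : mp (evalRingHom 0) h = 1) (hh : mp (mapRingHom φ) h ∈ E n (Polynomial Q)) :
    ∃ s ∈ M, mp (scl s) h ∈ E n (Polynomial P) := by
  obtain ⟨s, hs, hst⟩ := dil2 hn φ M hden hh 1 (one_mem _)
  refine ⟨s, hs, ?_⟩
  have h1 := hst 1
  have h2 : mp (C.comp (evalRingHom 0)) (mp (mapRingHom φ) h) = 1 := by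
    have : (C.comp (evalRingHom 0)).comp (mapRingHom φ) = (C.comp φ).comp (evalRingHom 0) := by
      ext <;> simp
    rw [mp_comp, this, ← mp_comp, h0, map_one]
  have h3 : mp (scl (φ (s * 1))) (mp (mapRingHom φ) h) = mp (mapRingHom φ) (mp (scl s) h) := by
    rw [mp_comp, mp_comp]; congr 2
    ext1
    · ext1 x; simp [scl_C]
    · simp [scl_X]
  rw [h2, h3, inv_one, mul_one] at h1
  have h4 : ∀ g ∈ DD n (Wset φ 1), ∃ e ∈ E n (Polynomial P), mp (mapRingHom φ) e = g := by
    intro g hg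
    induction hg using Subgroup.closure_induction with
    | mem x hx =>
      obtain ⟨i, j, hij, w, ⟨q, rfl⟩, rfl⟩ := hx
      exact ⟨tv i j (C 1 * q), tv_mem _ _ _, by rw [mp_tv]; rfl⟩
    | one => exact ⟨1, one_mem _, map_one _⟩
    | mul x y _ _ hx hy =>
      obtain ⟨a, ha, rfl⟩ := hx
      obtain ⟨b, hb, rfl⟩ := hy
      exact ⟨a * b, mul_mem ha hb, map_mul _ _ _⟩
    | inv x _ hx =>
      obtain ⟨a, ha, rfl⟩ := hx
      exact ⟨a⁻¹, inv_mem ha, map_inv _ _⟩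
  obtain ⟨e, he, hee⟩ := h4 _ h1
  rw [← mp_inj _ (map_injective φ hφ) hee]
  exact he

end dil
end BG

namespace BG
section lg
open Polynomial
variable {n : ℕ} {P : Type*} [CommRing P]

/-- `X ↦ X + s Y` as a hom `P[X] → P[X][Y]` -/
noncomputable def tau (s : P) : Polynomial P →+* Polynomial (Polynomial P) :=
  eval₂RingHom ((C : Polynomial P →+* _).comp C) (C X + C (C s) * X)

theorem tau_C (s a : P) : tau s (C a) = C (C a) := by simp [tau]
theorem tau_X (s : P) : tau s X = C X + C (C s) * X := by simp [tau]

/-- `X ↦ X + sY`, `Y ↦ c Y` -/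
noncomputable def tau2 (s c : P) : Polynomial (Polynomial P) →+* Polynomial (Polynomial P) :=
  eval₂RingHom (tau s) (C (C c) * X)

theorem tau2_C (s c : P) (a : Polynomial P) : tau2 s c (C a) = tau s a := by simp [tau2]
theorem tau2_X (s c : P) : tau2 s c X = C (C c) * X := by simp [tau2]

theorem tau2_tau (s c t : P) : (tau2 s c).comp (tau t) = tau (s + t * c) := by
  ext1
  · ext1 x; simp [tau_C, tau2_C]
  · simp [tau_X, tau2_C, tau2_X, tau_C]; ring

theorem tau2_Chom (s c : P) : (tau2 s c).comp C = tau s := by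
  ext1
  · ext1 x; simp [tau_C, tau2_C]
  · simp [tau_X, tau2_C]

theorem tau_zero : tau (0 : P) = C := by
  ext1
  · ext1 x; simp [tau_C]
  · simp [tau_X]

def Jmem (g : SL n (Polynomial P)) (s : P) : Prop := mp (tau s) g * (mp C g)⁻¹ ∈ E n (Polynomial (Polynomial P))

theorem Jmem_zero (g : SL n (Polynomial P)) : Jmem g 0 := by
  simp [Jmem, tau_zero, one_mem]

theorem Jmem_add {g : SL n (Polynomial P)} {s t : P} (hs : Jmem g s) (ht : Jmem g t) : Jmem g (s + t) := by
  have := mul_mem (mp_mem (tau2 s 1) ht) hs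
  unfold Jmem
  convert this using 1
  rw [map_mul, map_inv, mp_comp, mp_comp, tau2_tau, tau2_Chom, mul_one]
  group

theorem Jmem_mul {g : SL n (Polynomial P)} {s : P} (c : P) (hs : Jmem g s) : Jmem g (c * s) := by
  have := (mp_mem (tau2 0 c) hs)
  unfold Jmem
  convert this using 1
  rw [map_mul, map_inv, mp_comp, mp_comp, tau2_tau, tau2_Chom, tau_zero, zero_add, mul_comm]

theorem Jmem_one {g : SL n (Polynomial P)} (h : Jmem g 1) :
    g * (mp (C.comp (evalRingHom 0)) g)⁻¹ ∈ E n (Polynomial P) := by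
  have := mp_mem (eval₂RingHom ((C : P →+* _).comp (evalRingHom 0)) X) h
  rw [map_mul, map_inv, mp_comp, mp_comp] at this
  convert this using 2
  · symm; convert mp_id g
    ext1
    · ext1 x; simp [tau_C]
    · simp [tau_X]
  · congr 2
    ext1
    · ext1 x; simp

theorem localGlobal {A P : Type} [CommRing A] [CommRing P] [Algebra A P] (hn : 3 ≤ n) (g : SL n (Polynomial P))
    (H : ∀ m : Ideal A, m.IsMaximal → ∃ (Q : Type) (_ : CommRing Q) (φ : P →+* Q), Function.Injective φ ∧
      (∀ q : Q, ∃ s ∉ m, ∃ p, φ (algebraMap A P s) * q = φ p) ∧ mp (mapRingHom φ) g ∈ E n (Polynomial Q)) :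
    g * (mp (C.comp (evalRingHom 0)) g)⁻¹ ∈ E n (Polynomial P) := by
  apply Jmem_one
  let I : Ideal A :=
    { carrier := {s | Jmem g (algebraMap A P s)}
      zero_mem' := by simpa using Jmem_zero g
      add_mem' := by intro a b ha hb; simpa using Jmem_add ha hb
      smul_mem' := by intro c a ha; simpa using Jmem_mul _ ha }
  have hI : I = ⊤ := by
    by_contra hI
    obtain ⟨m, hm, hIm⟩ := Ideal.exists_le_maximal I hI
    obtain ⟨Q, _, φ, hφ, hden, hg⟩ := H m hm
    let M : Submonoid P := m.primeCompl.map (algebraMap A P)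
    let M' : Submonoid (Polynomial P) := M.map C
    have hden0 : ∀ q : Q, ∃ s ∈ M, ∃ p, φ s * q = φ p := by
      intro q
      obtain ⟨s, hs, hp⟩ := hden q
      exact ⟨_, ⟨s, hs, rfl⟩, hp⟩
    have hden' : ∀ q : Polynomial Q, ∃ s ∈ M', ∃ p, mapRingHom φ s * q = mapRingHom φ p := by
      intro q
      obtain ⟨s, hs, p, hp⟩ := poly_den φ M hden0 q
      exact ⟨C s, ⟨s, hs, rfl⟩, p, by simpa using hp⟩
    have hk := dil hn (mapRingHom φ) (map_injective φ hφ) M' hden' (h := mp (tau 1) g * (mp C g)⁻¹) ?_ ?_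
    · obtain ⟨s, hs, hss⟩ := hk
      obtain ⟨_, ⟨s, hs, rfl⟩, rfl⟩ := hs
      apply hs
      apply hIm
      change Jmem g (algebraMap A P s)
      have : ∀ s : P, scl (C s) = tau2 0 s := by
        intro s
        ext1
        · ext1
          · ext1 x; simp [scl_C, tau2_C, tau_zero]
          · simp [scl_C, tau2_C, tau_zero]
        · simp [scl_X, tau2_X]
      change mp (scl (C (algebraMap A P s))) _ ∈ _ at hss
      rw [this, map_mul, map_inv, mp_comp, mp_comp, tau2_tau, tau2_Chom, tau_zero, zero_add, one_mul] at hss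
      exact hss
    · have e0 : (evalRingHom 0).comp (tau (1 : P)) = (evalRingHom 0).comp C := by
        ext1
        · ext1 x; simp [tau_C]
        · simp [tau_X]
      rw [map_mul, map_inv, mp_comp, mp_comp, mul_inv_eq_one, e0]
    · have e1 : (mapRingHom (mapRingHom φ)).comp (tau 1) = (tau 1).comp (mapRingHom φ) := by
        ext1
        · ext1 x; simp [tau_C]
        · simp [tau_X]
      have e2 : (mapRingHom (mapRingHom φ)).comp C = C.comp (mapRingHom φ) := by
        ext1
        · ext1 x; simp 
        · simp 
      rw [map_mul, map_inv, mp_comp, mp_comp, e1, e2, ← mp_comp, ← mp_comp]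
      exact mul_mem (mp_mem _ hg) (inv_mem (mp_mem _ hg))
  have : (1 : A) ∈ I := by rw [hI]; trivial
  have : Jmem g (algebraMap A P 1) := this
  simpa using this

theorem mv_den {A B : Type*} [CommRing A] [CommRing B] (φ : A →+* B) (M : Submonoid A) {k : ℕ}
    (hden : ∀ q : B, ∃ s ∈ M, ∃ p, φ s * q = φ p) (f : MvPolynomial (Fin k) B) :
    ∃ s ∈ M, ∃ p, MvPolynomial.C (φ s) * f = MvPolynomial.map φ p := by
  induction f using MvPolynomial.induction_on' with
  | add p q hp hq =>
    obtain ⟨s, hs, a, ha⟩ := hp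
    obtain ⟨t, ht, b, hb⟩ := hq
    refine ⟨s * t, mul_mem hs ht, MvPolynomial.C t * a + MvPolynomial.C s * b, ?_⟩
    simp only [map_add, map_mul, MvPolynomial.map_C, ← ha, ← hb]
    ring
  | monomial k a =>
    obtain ⟨s, hs, p, hp⟩ := hden a
    exact ⟨s, hs, MvPolynomial.monomial k p, by rw [MvPolynomial.C_mul_monomial, hp, MvPolynomial.map_monomial]⟩

theorem lg_mv {A : Type} [CommRing A] [IsDomain A] (hn : 3 ≤ n) (k : ℕ) (hA : Full n A)
    (H : ∀ m : Ideal A, (hm : m.IsMaximal) → Full n (MvPolynomial (Fin k) (Localization.AtPrime m))) :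
    Full n (MvPolynomial (Fin k) A) := by
  intro g
  let θ (B : Type) [CommRing B] : MvPolynomial (Fin k) B →+* Polynomial (MvPolynomial (Fin k) B) :=
    MvPolynomial.eval₂Hom (C.comp MvPolynomial.C) (fun i => C (MvPolynomial.X i) * X)
  have key := localGlobal (A := A) hn (mp (θ A) g) ?_
  · have h1 := mp_mem (evalRingHom 1) key
    rw [map_mul, map_inv, mp_comp, mp_comp, mp_comp] at h1
    have e1 : (evalRingHom 1).comp (θ A) = RingHom.id _ := by
      refine MvPolynomial.ringHom_ext (fun r => ?_) (fun i => ?_) <;> simp [θ]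
    have e2 : ((evalRingHom 1).comp (C.comp (evalRingHom 0))).comp (θ A) = MvPolynomial.C.comp (MvPolynomial.eval₂Hom (RingHom.id A) 0) := by
      refine MvPolynomial.ringHom_ext (fun r => ?_) (fun i => ?_) <;> simp [θ]
    rw [e1, e2, mp_id, ← mp_comp] at h1
    have h2 := mul_mem h1 (mp_mem MvPolynomial.C (hA (mp (MvPolynomial.eval₂Hom (RingHom.id A) 0) g)))
    simpa using h2
  · intro m hm
    let ι := algebraMap A (Localization.AtPrime m)
    refine ⟨MvPolynomial (Fin k) (Localization.AtPrime m), inferInstance, MvPolynomial.map ι, 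
      MvPolynomial.map_injective _ ?_, ?_, ?_⟩
    · exact IsLocalization.injective _ m.primeCompl_le_nonZeroDivisors
    · intro q
      obtain ⟨s, hs, p, hp⟩ := mv_den ι m.primeCompl (by
        intro q
        obtain ⟨⟨p, s⟩, h⟩ := IsLocalization.surj m.primeCompl q
        exact ⟨s, s.2, p, by rw [← h, mul_comm]⟩) q
      refine ⟨s, hs, p, ?_⟩
      rw [← hp]; congr 1
      simp [MvPolynomial.algebraMap_eq]
    · have : (mapRingHom (MvPolynomial.map ι)).comp (θ A) = (θ _).comp (MvPolynomial.map ι) := by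
        refine MvPolynomial.ringHom_ext (fun r => ?_) (fun i => ?_) <;> simp [θ]
      rw [mp_comp, this, ← mp_comp]
      exact mp_mem _ (H m hm _)

end lg
end BG

namespace BG
namespace StSys
variable {n : ℕ} {A : Type*} [CommRing A] {Γ : Type*} [Group Γ] (S : StSys n A Γ)

theorem x_zero {i j : Fin n} (h : i ≠ j) : S.x i j 0 = 1 := by
  have := S.add i j h 0 0
  rw [add_zero] at this
  exact left_eq_mul.mp this

theorem x_neg {i j : Fin n} (h : i ≠ j) (a : A) : S.x i j (-a) = (S.x i j a)⁻¹ := by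
  rw [eq_inv_iff_mul_eq_one, ← S.add i j h, neg_add_cancel, S.x_zero h]

theorem x_sub {i j : Fin n} (h : i ≠ j) (a b : A) : S.x i j (a - b) = S.x i j a * (S.x i j b)⁻¹ := by
  rw [sub_eq_add_neg, S.add i j h, S.x_neg h]

/-- `x_ij(a) x_jk(b) x_ij(a)⁻¹ = x_ik(ab) x_jk(b)` -/
theorem conj1 {i j k : Fin n} (hij : i ≠ j) (hjk : j ≠ k) (hik : i ≠ k) (a b : A) :
    S.x i j a * S.x j k b * (S.x i j a)⁻¹ = S.x i k (a * b) * S.x j k b := by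
  rw [S.c1 i j k hij hjk hik]; group

/-- `x_jk(b) x_ij(a) x_jk(b)⁻¹ = x_ik(-ab) x_ij(a)` -/
theorem conj2 {i j k : Fin n} (hij : i ≠ j) (hjk : j ≠ k) (hik : i ≠ k) (a b : A) :
    S.x j k b * S.x i j a * (S.x j k b)⁻¹ = S.x i k (-(a * b)) * S.x i j a := by
  rw [S.x_neg hik, eq_inv_mul_iff_mul_eq, ← mul_assoc, ← mul_assoc, ← S.c1 i j k hij hjk hik]; group

theorem comm_eq {i j k : Fin n} (hij : i ≠ j) (hjk : j ≠ k) (hik : i ≠ k) (a b : A) :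
    S.x i k (a * b) = S.x i j a * S.x j k b * (S.x i j a)⁻¹ * (S.x j k b)⁻¹ := by
  rw [S.c1 i j k hij hjk hik]; group

theorem conj0 {i j k l : Fin n} (hij : i ≠ j) (hkl : k ≠ l) (hjk : j ≠ k) (hil : i ≠ l) (a b : A) :
    S.x i j a * S.x k l b * (S.x i j a)⁻¹ = S.x k l b := by
  rw [S.c2 i j k l hij hkl hjk hil]; group

def map {Γ' : Type*} [Group Γ'] (ψ : Γ →* Γ') : StSys n A Γ' where
  x i j a := ψ (S.x i j a)
  add i j h a b := by rw [S.add i j h, map_mul]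
  c1 i j k h1 h2 h3 a b := by simp only [← map_mul]; rw [S.c1 i j k h1 h2 h3]
  c2 i j k l h1 h2 h3 h4 a b := by simp only [← map_mul]; rw [S.c2 i j k l h1 h2 h3 h4]

theorem map_x {Γ' : Type*} [Group Γ'] (ψ : Γ →* Γ') (i j : Fin n) (a : A) : (S.map ψ).x i j a = ψ (S.x i j a) := rfl

theorem exists_desc {A' : Type*} [CommRing A'] (f : A →+* A') (hf : Function.Surjective f)
    (hk : ∀ i j, i ≠ j → ∀ a, f a = 0 → S.x i j a = 1) :
    ∃ S' : StSys n A' Γ, ∀ i j, i ≠ j → ∀ a, S'.x i j (f a) = S.x i j a := by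
  have key : ∀ i j, i ≠ j → ∀ a b, f a = f b → S.x i j a = S.x i j b := by
    intro i j h a b hab
    have h1 := hk i j h (a - b) (by rw [map_sub, hab, sub_self])
    rwa [S.x_sub h, mul_inv_eq_one] at h1
  let r := Function.surjInv hf
  have hr : ∀ a, f (r a) = a := Function.surjInv_eq hf
  refine ⟨⟨fun i j a => S.x i j (r a), ?_, ?_, ?_⟩, ?_⟩
  · intro i j h a b
    rw [← S.add i j h]; apply key i j h; simp [hr]
  · intro i j k h1 h2 h3 a b
    rw [S.c1 i j k h1 h2 h3]; congr 2
    apply key i k h3; simp [hr]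
  · intro i j k l h1 h2 h3 h4 a b
    exact S.c2 i j k l h1 h2 h3 h4 _ _
  · intro i j h a
    apply key i j h; simp [hr]

/-- subgroup generated by a set of root subgroups -/
def XG (I : Set (Fin n × Fin n)) : Subgroup Γ :=
  Subgroup.closure {g | ∃ i j, i ≠ j ∧ (i, j) ∈ I ∧ ∃ a, g = S.x i j a}

theorem x_mem_XG {I : Set (Fin n × Fin n)} {i j : Fin n} (h : i ≠ j) (hI : (i, j) ∈ I) (a : A) : S.x i j a ∈ S.XG I :=
  Subgroup.subset_closure ⟨i, j, h, hI, a, rfl⟩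

theorem XG_mono {I I' : Set (Fin n × Fin n)} (h : I ⊆ I') : S.XG I ≤ S.XG I' :=
  Subgroup.closure_mono (by rintro g ⟨i, j, h1, h2, a, rfl⟩; exact ⟨i, j, h1, h h2, a, rfl⟩)

theorem XG_induction {I : Set (Fin n × Fin n)} {p : Γ → Prop} (one : p 1)
    (step : ∀ i j, i ≠ j → (i, j) ∈ I → ∀ a g, g ∈ S.XG I → p g → p (S.x i j a * g)) {g : Γ} (hg : g ∈ S.XG I) : p g := by
  induction hg using Subgroup.closure_induction_left with
  | one => exact one
  | mul_left x hx y hy ih =>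
    obtain ⟨i, j, h1, h2, a, rfl⟩ := hx
    exact step i j h1 h2 a y hy ih
  | inv_mul_cancel x hx y hy ih =>
    obtain ⟨i, j, h1, h2, a, rfl⟩ := hx
    rw [← S.x_neg h1]
    exact step i j h1 h2 _ y hy ih

end StSys

/-- conjugating a closure -/
theorem conj_closure {Γ : Type*} [Group Γ] {T : Set Γ} {K : Subgroup Γ} {z : Γ} (h : ∀ t ∈ T, z * t * z⁻¹ ∈ K) {u : Γ}
    (hu : u ∈ Subgroup.closure T) : z * u * z⁻¹ ∈ K := by
  induction hu using Subgroup.closure_induction with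
  | mem x hx => exact h x hx
  | one => simp [one_mem]
  | mul x y _ _ hx hy => convert mul_mem hx hy using 1; group
  | inv x _ hx => convert inv_mem hx using 1; group

namespace StSys
variable {n : ℕ} {A : Type*} [CommRing A] {Γ : Type*} [Group Γ] (S : StSys n A Γ)

theorem XG_norm {I K : Set (Fin n × Fin n)} (h1 : ∀ i j l, (i, j) ∈ I → (j, l) ∈ K → i ≠ l ∧ (i, l) ∈ K)
    (h2 : ∀ i j k, (i, j) ∈ I → (k, i) ∈ K → k ≠ j ∧ (k, j) ∈ K) {g u : Γ} (hg : g ∈ S.XG I) (hu : u ∈ S.XG K) :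
    g * u * g⁻¹ ∈ S.XG K := by
  revert u
  refine S.XG_induction (p := fun g => ∀ {u}, u ∈ S.XG K → g * u * g⁻¹ ∈ S.XG K) ?_ ?_ hg
  · intro u hu; simpa using hu
  · intro i j hij hI a g _ ih u hu
    have e : S.x i j a * g * u * (S.x i j a * g)⁻¹ = S.x i j a * (g * u * g⁻¹) * (S.x i j a)⁻¹ := by group
    rw [e]
    refine conj_closure ?_ (ih hu)
    rintro t ⟨k, l, hkl, hK, b, rfl⟩
    by_cases hjk : j = k
    · subst hjk
      obtain ⟨hil, hm⟩ := h1 i j l hI hK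
      rw [S.conj1 hij hkl hil]
      exact mul_mem (S.x_mem_XG hil hm _) (S.x_mem_XG hkl hK _)
    · by_cases hil : i = l
      · subst hil
        obtain ⟨hkj, hm⟩ := h2 i j k hI hK
        rw [S.conj2 hkl hij hkj]
        exact mul_mem (S.x_mem_XG hkj hm _) (S.x_mem_XG hkl hK _)
      · rw [S.conj0 hij hkl hjk hil]
        exact S.x_mem_XG hkl hK _

/-- `z` acts on the off-`{i,j}` roots like the matrix `(α β; γ δ)` in coordinates `i,j`. -/
structure Acts (z : Γ) (i j : Fin n) (α β γ δ : A) : Prop where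
  det : α * δ - β * γ = 1
  col : ∀ k, k ≠ i → k ≠ j → ∀ p q, z * (S.x i k p * S.x j k q) * z⁻¹ = S.x i k (α * p + β * q) * S.x j k (γ * p + δ * q)
  row : ∀ k, k ≠ i → k ≠ j → ∀ p q, z * (S.x k i p * S.x k j q) * z⁻¹ = S.x k i (p * δ - q * γ) * S.x k j (q * α - p * β)
  com : ∀ k l, k ≠ l → k ≠ i → k ≠ j → l ≠ i → l ≠ j → ∀ p, z * S.x k l p * z⁻¹ = S.x k l p

variable {S}

theorem Acts.mul {z z' : Γ} {i j : Fin n} {α β γ δ α' β' γ' δ' : A} (h : S.Acts z i j α β γ δ) (h' : S.Acts z' i j α' β' γ' δ') :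
    S.Acts (z * z') i j (α * α' + β * γ') (α * β' + β * δ') (γ * α' + δ * γ') (γ * β' + δ * δ') := by
  have e : ∀ u, z * z' * u * (z * z')⁻¹ = z * (z' * u * z'⁻¹) * z⁻¹ := by intro u; group
  refine ⟨?_, ?_, ?_, ?_⟩
  · linear_combination (α' * δ' - β' * γ') * h.det + h'.det
  · intro k h1 h2 p q
    rw [e, h'.col k h1 h2, h.col k h1 h2]; congr 2 <;> ring
  · intro k h1 h2 p q
    rw [e, h'.row k h1 h2, h.row k h1 h2]; congr 2 <;> ring
  · intro k l h1 h2 h3 h4 h5 p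
    rw [e, h'.com k l h1 h2 h3 h4 h5, h.com k l h1 h2 h3 h4 h5]

theorem Acts.congr {z : Γ} {i j : Fin n} {α β γ δ α' β' γ' δ' : A} (h : S.Acts z i j α β γ δ)
    (h1 : α = α') (h2 : β = β') (h3 : γ = γ') (h4 : δ = δ') : S.Acts z i j α' β' γ' δ' := by
  subst h1 h2 h3 h4; exact h

theorem Acts.symm {z : Γ} {i j : Fin n} {α β γ δ : A} (hij : i ≠ j) (h : S.Acts z i j α β γ δ) : S.Acts z j i δ γ β α := by
  refine ⟨by linear_combination h.det, ?_, ?_, ?_⟩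
  · intro k h1 h2 p q
    rw [S.c2 j k i k h1.symm h2.symm h2 h1.symm, h.col k h2 h1,
      S.c2 i k j k h2.symm h1.symm h1 h2.symm]; congr 2 <;> ring
  · intro k h1 h2 p q
    rw [S.c2 k j k i h1 h2 h1.symm h2, h.row k h2 h1, S.c2 k i k j h2 h1 h2.symm h1]
  · intro k l h1 h2 h3 h4 h5 p
    exact h.com k l h1 h3 h2 h5 h4 p

theorem Acts.x {i j : Fin n} (hij : i ≠ j) (b : A) : S.Acts (S.x i j b) i j 1 b 0 1 := by
  refine ⟨by ring, ?_, ?_, ?_⟩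
  · intro k h1 h2 p q
    have e : S.x i j b * (S.x i k p * S.x j k q) * (S.x i j b)⁻¹ =
      (S.x i j b * S.x i k p * (S.x i j b)⁻¹) * (S.x i j b * S.x j k q * (S.x i j b)⁻¹) := by group
    rw [e, S.conj0 hij h1.symm hij.symm h1.symm, S.conj1 hij h2.symm h1.symm, ← mul_assoc, ← S.add i k h1.symm]
    congr 2 <;> ring
  · intro k h1 h2 p q
    have e : S.x i j b * (S.x k i p * S.x k j q) * (S.x i j b)⁻¹ =
      (S.x i j b * S.x k i p * (S.x i j b)⁻¹) * (S.x i j b * S.x k j q * (S.x i j b)⁻¹) := by group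
    rw [e, S.conj2 h1 hij h2, S.conj0 hij h2 h2.symm hij, S.c2 k j k i h2 h1 h2.symm h1, mul_assoc, ← S.add k j h2]
    congr 2 <;> ring
  · intro k l h1 h2 h3 h4 h5 p
    exact S.conj0 hij h1 h3.symm h4.symm _ _

theorem Acts.x' {i j : Fin n} (hij : i ≠ j) (b : A) : S.Acts (S.x j i b) i j 1 0 b 1 :=
  (Acts.x hij.symm b).symm hij.symm

variable (S)
/-- `z` acts on all roots as a monomial matrix -/
def MonAct (z : Γ) (σ : Equiv.Perm (Fin n)) (m : Fin n → Aˣ) : Prop :=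
  ∀ k l, k ≠ l → ∀ a, z * S.x k l a * z⁻¹ = S.x (σ k) (σ l) (m k * a * ↑(m l)⁻¹)
variable {S}

theorem MonAct.mul {z z' : Γ} {σ σ' : Equiv.Perm (Fin n)} {m m' : Fin n → Aˣ} (h : S.MonAct z σ m) (h' : S.MonAct z' σ' m') :
    S.MonAct (z * z') (σ * σ') (fun k => m (σ' k) * m' k) := by
  intro k l hkl a
  have e : z * z' * S.x k l a * (z * z')⁻¹ = z * (z' * S.x k l a * z'⁻¹) * z⁻¹ := by group
  rw [e, h' k l hkl, h _ _ (σ'.injective.ne hkl)]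
  simp only [Equiv.Perm.mul_apply, mul_inv, Units.val_mul]
  congr 1; ring

theorem MonAct.congr {z : Γ} {σ σ' : Equiv.Perm (Fin n)} {m m' : Fin n → Aˣ} (h : S.MonAct z σ m) (h1 : σ = σ') (h2 : m = m') :
    S.MonAct z σ' m' := by subst h1 h2; exact h

theorem MonAct.XG {z : Γ} {σ : Equiv.Perm (Fin n)} {m : Fin n → Aˣ} (h : S.MonAct z σ m) {I K : Set (Fin n × Fin n)}
    (hI : ∀ i j, i ≠ j → (i, j) ∈ I → (σ i, σ j) ∈ K) {u : Γ} (hu : u ∈ S.XG I) : z * u * z⁻¹ ∈ S.XG K := by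
  refine conj_closure ?_ hu
  rintro t ⟨k, l, hkl, hK, b, rfl⟩
  rw [h k l hkl]
  exact S.x_mem_XG (σ.injective.ne hkl) (hI k l hkl hK) _

theorem MonAct.inv {z : Γ} {σ : Equiv.Perm (Fin n)} {m : Fin n → Aˣ} (h : S.MonAct z σ m) :
    S.MonAct z⁻¹ σ⁻¹ (fun k => (m (σ⁻¹ k))⁻¹) := by
  intro k l hkl a
  have := h (σ⁻¹ k) (σ⁻¹ l) (σ⁻¹.injective.ne hkl) (↑(m (σ⁻¹ k))⁻¹ * a * ↑(m (σ⁻¹ l)))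
  have e : (m (σ⁻¹ k) : A) * (↑(m (σ⁻¹ k))⁻¹ * a * ↑(m (σ⁻¹ l))) * ↑(m (σ⁻¹ l))⁻¹ = a := by
    simp [← mul_assoc]
  rw [e] at this
  have e2 : ∀ k, σ (σ⁻¹ k) = k := fun k => σ.apply_symm_apply k
  rw [e2, e2] at this
  rw [← this, inv_inv, inv_inv]; group

theorem exists_third (hn : 3 ≤ n) (i j : Fin n) : ∃ k : Fin n, k ≠ i ∧ k ≠ j := by
  by_contra! h
  have h1 : (Finset.univ : Finset (Fin n)) ⊆ {i, j} := fun x _ => by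
    simp only [Finset.mem_insert, Finset.mem_singleton]
    by_cases hx : x = i
    · exact Or.inl hx
    · exact Or.inr (h x hx)
  have := Finset.card_le_card h1
  have := Finset.card_le_two (a := i) (b := j)
  simp at *; omega

def dg (i j : Fin n) (u : Aˣ) : Fin n → Aˣ := fun k => if k = i then u else if k = j then u⁻¹ else 1

theorem Acts.colL {z : Γ} {i j : Fin n} {α β γ δ : A} (h : S.Acts z i j α β γ δ) (hij : i ≠ j) {k : Fin n} (hi : k ≠ i) (hj : k ≠ j) (a : A) :
    z * S.x i k a * z⁻¹ = S.x i k (α * a) * S.x j k (γ * a) := by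
  have := h.col k hi hj a 0
  simpa [S.x_zero hj.symm] using this

theorem Acts.colR {z : Γ} {i j : Fin n} {α β γ δ : A} (h : S.Acts z i j α β γ δ) (hij : i ≠ j) {k : Fin n} (hi : k ≠ i) (hj : k ≠ j) (a : A) :
    z * S.x j k a * z⁻¹ = S.x i k (β * a) * S.x j k (δ * a) := by
  have := h.col k hi hj 0 a
  simpa [S.x_zero hi.symm] using this

theorem Acts.rowL {z : Γ} {i j : Fin n} {α β γ δ : A} (h : S.Acts z i j α β γ δ) (hij : i ≠ j) {k : Fin n} (hi : k ≠ i) (hj : k ≠ j) (a : A) :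
    z * S.x k i a * z⁻¹ = S.x k i (a * δ) * S.x k j (-(a * β)) := by
  have := h.row k hi hj a 0
  simpa [S.x_zero hj] using this

theorem Acts.rowR {z : Γ} {i j : Fin n} {α β γ δ : A} (h : S.Acts z i j α β γ δ) (hij : i ≠ j) {k : Fin n} (hi : k ≠ i) (hj : k ≠ j) (a : A) :
    z * S.x k j a * z⁻¹ = S.x k i (-(a * γ)) * S.x k j (a * α) := by
  have := h.row k hi hj 0 a
  simpa [S.x_zero hi] using this

theorem conj_comm (z a b : Γ) : z * (a * b * a⁻¹ * b⁻¹) * z⁻¹ = (z*a*z⁻¹) * (z*b*z⁻¹) * (z*a*z⁻¹)⁻¹ * (z*b*z⁻¹)⁻¹ := by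
  group

/-- conjugation on `x_ij`, diagonal case -/
theorem Acts.diag_ij (hn : 3 ≤ n) {z : Γ} {i j : Fin n} (hij : i ≠ j) {α δ : A} (h : S.Acts z i j α 0 0 δ) (a : A) :
    z * S.x i j a * z⁻¹ = S.x i j (α * α * a) := by
  obtain ⟨k, hi, hj⟩ := exists_third hn i j
  rw [← mul_one a, S.comm_eq hi.symm hj hij, conj_comm, h.colL hij hi hj, h.rowR hij hi hj]
  simp only [zero_mul, mul_zero, neg_zero, S.x_zero hi, S.x_zero hj.symm, one_mul, mul_one]
  rw [← S.comm_eq hi.symm hj hij]; congr 1; ring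

theorem Acts.anti_ij (hn : 3 ≤ n) {z : Γ} {i j : Fin n} (hij : i ≠ j) {β γ : A} (h : S.Acts z i j 0 β γ 0) (a : A) :
    z * S.x i j a * z⁻¹ = S.x j i (-(γ * γ * a)) := by
  obtain ⟨k, hi, hj⟩ := exists_third hn i j
  rw [← mul_one a, S.comm_eq hi.symm hj hij, conj_comm, h.colL hij hi hj, h.rowR hij hi hj]
  simp only [zero_mul, mul_zero, S.x_zero hj, S.x_zero hi.symm, one_mul, mul_one]
  rw [← S.comm_eq hj.symm hi hij.symm]; congr 1; ring

theorem Acts.monDiag (hn : 3 ≤ n) {z : Γ} {i j : Fin n} (hij : i ≠ j) {u : Aˣ} (h : S.Acts z i j u 0 0 ↑u⁻¹) :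
    S.MonAct z 1 (dg i j u) := by
  intro k l hkl a
  simp only [Equiv.Perm.one_apply, dg]
  by_cases hki : k = i
  · subst hki
    by_cases hlj : l = j
    · subst hlj
      rw [h.diag_ij hn hkl]; simp [hkl.symm]; congr 1; ring
    · rw [h.colL hij hkl.symm hlj]
      simp [hkl.symm, hlj, S.x_zero (Ne.symm hlj)]
  · by_cases hkj : k = j
    · subst hkj
      by_cases hli : l = i
      · subst hli
        rw [(h.symm hij).diag_ij hn hkl]; simp [hkl]; congr 1; ring
      · rw [h.colR hij hli hkl.symm]
        simp [hki, hli, hkl.symm, S.x_zero (Ne.symm hli)]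
    · by_cases hli : l = i
      · subst hli
        rw [h.rowL hij hki hkj]; simp [hki, hkj, S.x_zero hkj]
      · by_cases hlj : l = j
        · subst hlj
          rw [h.rowR hij hki hkj]; simp [hki, hkj, hli, S.x_zero hki]
        · rw [h.com k l hkl hki hkj hli hlj]; simp [*]

/-- multiplier of `w_ij(u)` -/
def wg (i j : Fin n) (u : Aˣ) : Fin n → Aˣ := fun k => if k = i then -u⁻¹ else if k = j then u else 1

theorem Acts.monAnti (hn : 3 ≤ n) {z : Γ} {i j : Fin n} (hij : i ≠ j) {u : Aˣ} (h : S.Acts z i j 0 u (-↑u⁻¹) 0) :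
    S.MonAct z (Equiv.swap i j) (wg i j u) := by
  intro k l hkl a
  simp only [wg]
  by_cases hki : k = i
  · subst hki
    by_cases hlj : l = j
    · subst hlj
      rw [h.anti_ij hn hkl]; simp [hkl.symm]; congr 1; ring
    · rw [h.colL hij hkl.symm hlj]
      simp [hkl.symm, hlj, S.x_zero hkl, Equiv.swap_apply_of_ne_of_ne]
  · by_cases hkj : k = j
    · subst hkj
      by_cases hli : l = i
      · subst hli
        rw [(h.symm hij).anti_ij hn hkl]; simp [hkl]; congr 1; ring
      · rw [h.colR hij hli hkl.symm]
        simp [hki, hli, hkl.symm, S.x_zero hkl, Equiv.swap_apply_of_ne_of_ne]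
    · by_cases hli : l = i
      · subst hli
        rw [h.rowL hij hki hkj]; simp [hki, hkj, S.x_zero hki, Equiv.swap_apply_of_ne_of_ne]
      · by_cases hlj : l = j
        · subst hlj
          rw [h.rowR hij hki hkj]; simp [hki, hkj, hli, S.x_zero hkj, Equiv.swap_apply_of_ne_of_ne]
        · rw [h.com k l hkl hki hkj hli hlj]; simp [*, Equiv.swap_apply_of_ne_of_ne]

end StSys
end BG

namespace BG
namespace StSys
variable {n : ℕ} {A : Type*} [CommRing A] {Γ : Type*} [Group Γ] (S : StSys n A Γ)

def w (i j : Fin n) (u : Aˣ) : Γ := S.x i j u * S.x j i (-↑u⁻¹) * S.x i j u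
def h (i j : Fin n) (u : Aˣ) : Γ := S.w i j u * S.w i j (-1)

theorem w_acts {i j : Fin n} (hij : i ≠ j) (u : Aˣ) : S.Acts (S.w i j u) i j 0 u (-↑u⁻¹) 0 := by
  have := ((Acts.x (S := S) hij (u:A)).mul (Acts.x' (S := S) hij (-↑u⁻¹))).mul (Acts.x (S := S) hij (u:A))
  refine this.congr ?_ ?_ ?_ ?_ <;> simp

theorem w_mon (hn : 3 ≤ n) {i j : Fin n} (hij : i ≠ j) (u : Aˣ) : S.MonAct (S.w i j u) (Equiv.swap i j) (wg i j u) :=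
  (S.w_acts hij u).monAnti hn hij

theorem w_neg {i j : Fin n} (hij : i ≠ j) (u : Aˣ) : S.w i j (-u) = (S.w i j u)⁻¹ := by
  have : (((-u)⁻¹ : Aˣ) : A) = - ↑u⁻¹ := by simp
  simp only [w, mul_inv_rev, this, Units.val_neg, neg_neg]
  rw [← S.x_neg hij, ← S.x_neg hij.symm, neg_neg, mul_assoc]

theorem w_conj_mon {z : Γ} {σ : Equiv.Perm (Fin n)} {m : Fin n → Aˣ} (h : S.MonAct z σ m) {k l : Fin n} (hkl : k ≠ l) (v : Aˣ) :
    z * S.w k l v * z⁻¹ = S.w (σ k) (σ l) (m k * v * (m l)⁻¹) := by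
  have e : z * S.w k l v * z⁻¹ = (z * S.x k l v * z⁻¹) * (z * S.x l k (-↑v⁻¹) * z⁻¹) * (z * S.x k l v * z⁻¹) := by
    simp only [w]; group
  rw [e, h k l hkl, h l k hkl.symm, w]
  congr 2
  · congr 2
    simp; ring

theorem w_symm (hn : 3 ≤ n) {i j : Fin n} (hij : i ≠ j) (u : Aˣ) : S.w i j u = S.w j i (-u⁻¹) := by
  have := S.w_conj_mon (S.w_mon hn hij u) hij u
  rw [mul_inv_cancel_right] at this
  rw [this]
  simp [wg, hij.symm]

theorem h_one {i j : Fin n} (hij : i ≠ j) : S.h i j 1 = 1 := by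
  rw [h, S.w_neg hij, mul_inv_cancel]

theorem w_eq_h {i j : Fin n} (hij : i ≠ j) (u : Aˣ) : S.w i j u = S.h i j u * S.w i j 1 := by
  rw [h, S.w_neg hij]; group

theorem h_mon (hn : 3 ≤ n) {i j : Fin n} (hij : i ≠ j) (u : Aˣ) : S.MonAct (S.h i j u) 1 (dg i j u) := by
  refine ((S.w_mon hn hij u).mul (S.w_mon hn hij (-1))).congr (Equiv.swap_mul_self _ _) ?_
  funext k
  simp only [wg, dg]
  by_cases hi : k = i
  · subst hi; simp [hij.symm]
  · by_cases hj : k = j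
    · subst hj; simp [hij.symm]
    · simp [hi, hj, Equiv.swap_apply_of_ne_of_ne]

/-- `w(u) w(v) = h(u) h(-v)⁻¹` -/
theorem w_mul_w {i j : Fin n} (hij : i ≠ j) (u v : Aˣ) : S.w i j u * S.w i j v = S.h i j u * (S.h i j (-v))⁻¹ := by
  rw [h, h, S.w_neg hij, S.w_neg hij]; group

theorem h_conj_mon {z : Γ} {σ : Equiv.Perm (Fin n)} {m : Fin n → Aˣ} (h : S.MonAct z σ m) {k l : Fin n} (hkl : k ≠ l) (v : Aˣ) :
    z * S.h k l v * z⁻¹ = S.h (σ k) (σ l) (m k * v * (m l)⁻¹) * (S.h (σ k) (σ l) (m k * (m l)⁻¹))⁻¹ := by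
  have e : z * S.h k l v * z⁻¹ = (z * S.w k l v * z⁻¹) * (z * S.w k l (-1) * z⁻¹) := by
    simp only [StSys.h]; group
  rw [e, S.w_conj_mon h hkl, S.w_conj_mon h hkl, S.w_mul_w (σ.injective.ne hkl)]
  simp

theorem x_eq_w (hn : 3 ≤ n) {i j : Fin n} (hij : i ≠ j) (u : Aˣ) :
    S.x i j u = S.x j i ↑u⁻¹ * S.w i j u * S.x j i ↑u⁻¹ := by
  rw [S.w_symm hn hij, w]
  have : (-((-u⁻¹)⁻¹ : Aˣ) : A) = u := by simp
  rw [this, Units.val_neg, S.x_neg hij.symm]; group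

theorem map_w {Γ' : Type*} [Group Γ'] (ψ : Γ →* Γ') (i j : Fin n) (u : Aˣ) : (S.map ψ).w i j u = ψ (S.w i j u) := by
  simp [w, map_x]
theorem map_h {Γ' : Type*} [Group Γ'] (ψ : Γ →* Γ') (i j : Fin n) (u : Aˣ) : (S.map ψ).h i j u = ψ (S.h i j u) := by
  simp [h, map_w]

/-- root subgroup homomorphism -/
def xhom (i j : Fin n) (h : i ≠ j) : Multiplicative A →* Γ where
  toFun a := S.x i j a.toAdd
  map_one' := S.x_zero h
  map_mul' a b := S.add i j h _ _

end StSys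

section absub
variable {ι : Type*} [Fintype ι] [DecidableEq ι] {A : Type*} [AddCommGroup A] {Γ : Type*} [Group Γ]

/-- Every element of the group generated by commuting images of additive homs is `Φ c`. -/
theorem exists_param (ϕ : ι → Multiplicative A →* Γ) (hc : ∀ i j, i ≠ j → ∀ a b, Commute (ϕ i a) (ϕ j b)) :
    ∃ Φ : (ι → A) → Γ, Φ 0 = 1 ∧ ∀ i a c, ϕ i (Multiplicative.ofAdd a) * Φ c = Φ (Pi.single i a + c) := by
  let F := MonoidHom.noncommPiCoprod ϕ (fun i j h => hc i j h)
  refine ⟨fun c => F (fun i => Multiplicative.ofAdd (c i)), ?_, ?_⟩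
  · exact map_one F
  · intro i a c
    have : ϕ i (Multiplicative.ofAdd a) = F (Pi.mulSingle i (Multiplicative.ofAdd a)) := by
      exact (MonoidHom.noncommPiCoprod_mulSingle ϕ (hcomm := fun i j h => hc i j h) i _).symm
    rw [this, ← map_mul]
    congr 1
end absub

namespace StSys
section field
variable {n : ℕ} {F : Type*} [Field F] {Γ : Type*} [Group Γ] (S : StSys n F Γ) (a b : Fin n)

def sL : Set (Fin n × Fin n) := {p | a < p.1 ∧ a < p.2}
def sM : Set (Fin n × Fin n) := {p | a < p.1 ∧ p.2 = a}
def sP : Set (Fin n × Fin n) := {p | p.1 = a ∧ a < p.2}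

def PP (g : Γ) : Prop := ∃ u ∈ S.XG (sP a), ∃ t, ∃ l ∈ S.XG (sL a), g = u * S.h a b t * l
def YY (g : Γ) : Prop := (∃ u ∈ S.XG (sM a), ∃ p, PP S a b p ∧ g = u * p) ∨
  (∃ l ∈ S.XG (sL a), ∃ p, PP S a b p ∧ g = l * S.w a b 1 * p)

variable {a b}

theorem xL {i j : Fin n} (h : i ≠ j) (h1 : a < i) (h2 : a < j) (c : F) : S.x i j c ∈ S.XG (sL a) := S.x_mem_XG h (show _ ∧ _ from ⟨h1, h2⟩) c
theorem xM {i : Fin n} (h1 : a < i) (c : F) : S.x i a c ∈ S.XG (sM a) := S.x_mem_XG h1.ne' (show _ ∧ _ from ⟨h1, rfl⟩) c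
theorem xP {i : Fin n} (h1 : a < i) (c : F) : S.x a i c ∈ S.XG (sP a) := S.x_mem_XG h1.ne (show _ ∧ _ from ⟨rfl, h1⟩) c

theorem L_norm_P {l u : Γ} (hl : l ∈ S.XG (sL a)) (hu : u ∈ S.XG (sP a)) : l * u * l⁻¹ ∈ S.XG (sP a) := by
  refine S.XG_norm ?_ ?_ hl hu
  · rintro i j l ⟨h1, h2⟩ ⟨h3, h4⟩
    exact absurd h3 (ne_of_gt h2)
  · rintro i j k ⟨h1, h2⟩ ⟨h3, h4⟩
    have h3 : k = a := h3
    subst h3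
    exact ⟨ne_of_lt h2, rfl, h2⟩

theorem L_norm_M {l u : Γ} (hl : l ∈ S.XG (sL a)) (hu : u ∈ S.XG (sM a)) : l * u * l⁻¹ ∈ S.XG (sM a) := by
  refine S.XG_norm ?_ ?_ hl hu
  · rintro i j l ⟨h1, h2⟩ ⟨h3, h4⟩
    have h4 : l = a := h4
    subst h4
    exact ⟨ne_of_gt h1, h1, rfl⟩
  · rintro i j k ⟨h1, h2⟩ ⟨h3, h4⟩
    exact absurd h4 (ne_of_gt h1)


theorem PP_L (hn : 3 ≤ n) (hab : a < b) {l p : Γ} (hl : l ∈ S.XG (sL a)) (hp : PP S a b p) : PP S a b (l * p) := by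
  obtain ⟨u, hu, t, l', hl', rfl⟩ := hp
  refine ⟨_, L_norm_P S hl hu, t, (S.h a b t)⁻¹ * l * (S.h a b t)⁻¹⁻¹ * l', mul_mem ?_ hl', by group⟩
  exact (S.h_mon hn hab.ne t).inv.XG (by intro i j _ h; simpa using h) hl

theorem PP_P {u p : Γ} (hl : u ∈ S.XG (sP a)) (hp : PP S a b p) : PP S a b (u * p) := by
  obtain ⟨u', hu, t, l', hl', rfl⟩ := hp
  exact ⟨_, mul_mem hl hu, t, l', hl', by group⟩


theorem PP_T (hn : 3 ≤ n) (hab : a < b) (hT : ∀ i j, i ≠ j → ∀ u v, S.h i j u * S.h i j v = S.h i j (u * v)) (t : Fˣ) {p : Γ} (hp : PP S a b p) : PP S a b (S.h a b t * p) := by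
  obtain ⟨u, hu, t', l', hl', rfl⟩ := hp
  refine ⟨S.h a b t * u * (S.h a b t)⁻¹, ?_, t * t', l', hl', ?_⟩
  · exact (S.h_mon hn hab.ne t).XG (by intro i j _ h; simpa using h) hu
  · rw [← hT a b hab.ne]; group

theorem h_inv (hab : a < b) (hT : ∀ i j, i ≠ j → ∀ u v, S.h i j u * S.h i j v = S.h i j (u * v)) (t : Fˣ) : (S.h a b t)⁻¹ = S.h a b t⁻¹ := by
  rw [inv_eq_iff_mul_eq_one, hT a b hab.ne, mul_inv_cancel, S.h_one hab.ne]

theorem PP_w (hn : 3 ≤ n) (hab : a < b) (hT : ∀ i j, i ≠ j → ∀ u v, S.h i j u * S.h i j v = S.h i j (u * v)) (u v : Fˣ) {p : Γ} (hp : PP S a b p) : PP S a b (S.w a b u * (S.w a b v * p)) := by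
  rw [← mul_assoc, S.w_mul_w hab.ne, h_inv S hab hT, mul_assoc]
  exact PP_T S hn hab hT _ (PP_T S hn hab hT _ hp)

theorem YY_L (hn : 3 ≤ n) (hab : a < b) (hT : ∀ i j, i ≠ j → ∀ u v, S.h i j u * S.h i j v = S.h i j (u * v)) {l g : Γ} (hl : l ∈ S.XG (sL a)) (hg : YY S a b g) : YY S a b (l * g) := by
  rcases hg with ⟨u, hu, p, hp, rfl⟩ | ⟨l', hl', p, hp, rfl⟩
  · exact Or.inl ⟨_, L_norm_M S hl hu, _, PP_L S hn hab hl hp, by group⟩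
  · exact Or.inr ⟨_, mul_mem hl hl', p, hp, by group⟩

theorem w_PM (hn : 3 ≤ n) (hab : a < b) (hT : ∀ i j, i ≠ j → ∀ u v, S.h i j u * S.h i j v = S.h i j (u * v)) {u p : Γ} (hu : u ∈ S.XG (sM a)) (hp : PP S a b p) : ∃ q, PP S a b q ∧ u * S.w a b 1 * p = S.w a b 1 * q := by
  refine ⟨(S.w a b 1)⁻¹ * u * (S.w a b 1)⁻¹⁻¹ * p, ?_, by group⟩
  revert hp; generalize p = p; revert p
  have h1 := S.w_mon hn hab.ne 1
  refine S.XG_induction (p := fun u => ∀ p, PP S a b p → PP S a b ((S.w a b 1)⁻¹ * u * (S.w a b 1)⁻¹⁻¹ * p)) ?_ ?_ hu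
  · intro p hp; simpa using hp
  · intro i j hij hI c g _ ih p hp
    have e : (S.w a b 1)⁻¹ * (S.x i j c * g) * (S.w a b 1)⁻¹⁻¹ * p =
      ((S.w a b 1)⁻¹ * S.x i j c * (S.w a b 1)⁻¹⁻¹) * ((S.w a b 1)⁻¹ * g * (S.w a b 1)⁻¹⁻¹ * p) := by group
    rw [e, h1.inv i j hij, Equiv.swap_inv]
    obtain ⟨hi, hj⟩ := hI
    have hj : j = a := hj
    have hi : a < i := hi
    subst hj
    rw [Equiv.swap_apply_left]
    by_cases hib : i = b
    · subst hib
      rw [Equiv.swap_apply_right]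
      exact PP_P S (S.xP hab _) (ih _ hp)
    · rw [Equiv.swap_apply_of_ne_of_ne hij hib]
      exact PP_L S hn hab (S.xL hib hi hab _) (ih _ hp)

theorem YY_M (hn : 3 ≤ n) (hab : a < b) (hT : ∀ i j, i ≠ j → ∀ u v, S.h i j u * S.h i j v = S.h i j (u * v)) {u g : Γ} (hu : u ∈ S.XG (sM a)) (hg : YY S a b g) : YY S a b (u * g) := by
  rcases hg with ⟨u', hu', p, hp, rfl⟩ | ⟨l, hl, p, hp, rfl⟩
  · exact Or.inl ⟨_, mul_mem hu hu', p, hp, by group⟩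
  · obtain ⟨q, hq, e⟩ := w_PM S hn hab hT (L_norm_M S (inv_mem hl) hu) hp
    refine Or.inr ⟨l, hl, q, hq, ?_⟩
    have e2 : u * (l * S.w a b 1 * p) = l * (l⁻¹ * u * l⁻¹⁻¹ * S.w a b 1 * p) := by group
    rw [e2, e]; group

theorem YY_x_w (hn : 3 ≤ n) (hab : a < b) (hT : ∀ i j, i ≠ j → ∀ u v, S.h i j u * S.h i j v = S.h i j (u * v)) (r : F) {p : Γ} (hp : PP S a b p) : YY S a b (S.x a b r * S.w a b 1 * p) := by
  by_cases hr : r = 0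
  · subst hr
    rw [S.x_zero hab.ne, one_mul]
    exact Or.inr ⟨1, one_mem _, p, hp, by group⟩
  · lift r to Fˣ using isUnit_iff_ne_zero.mpr hr
    rw [S.x_eq_w hn hab.ne]
    have h2 : S.x b a ↑r⁻¹ ∈ S.XG (sM a) := S.xM hab _
    obtain ⟨q, hq, e⟩ := w_PM S hn hab hT h2 hp
    refine Or.inl ⟨_, h2, _, PP_w S hn hab hT r 1 hq, ?_⟩
    rw [← e]; group

theorem YY_x_wU (hn : 3 ≤ n) (hab : a < b) (hT : ∀ i j, i ≠ j → ∀ u v, S.h i j u * S.h i j v = S.h i j (u * v)) {u p : Γ} (hu : u ∈ S.XG (sP a)) (hp : PP S a b p) : ∃ r q, PP S a b q ∧ u * S.w a b 1 * p = S.x a b r * S.w a b 1 * q := by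
  revert hp; generalize p = p; revert p
  refine S.XG_induction (p := fun u => ∀ p, PP S a b p → ∃ r q, PP S a b q ∧ u * S.w a b 1 * p = S.x a b r * S.w a b 1 * q) ?_ ?_ hu
  · intro p hp
    exact ⟨0, p, hp, by rw [S.x_zero hab.ne]⟩
  · intro i j hij hI c g _ ih p hp
    obtain ⟨r, q, hq, e⟩ := ih _ hp
    obtain ⟨hi, hj⟩ := hI
    have hi : i = a := hi
    have hj : a < j := hj
    subst hi
    have e2 : S.x i j c * g * S.w i b 1 * p = S.x i j c * (g * S.w i b 1 * p) := by group
    by_cases hjb : j = b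
    · subst hjb
      refine ⟨c + r, q, hq, ?_⟩
      rw [S.add _ _ hij, e2, e]; group
    · have h1 := (S.w_mon hn hab.ne 1).inv i j hij c
      simp only [Equiv.swap_inv, Equiv.swap_apply_left, Equiv.swap_apply_of_ne_of_ne hij.symm hjb] at h1
      obtain ⟨c', h1⟩ : ∃ c', (S.w i b 1)⁻¹ * S.x i j c * (S.w i b 1)⁻¹⁻¹ = S.x b j c' := ⟨_, h1⟩
      refine ⟨r, _, PP_L S hn hab (S.xL (Ne.symm hjb) hab hj c') hq, ?_⟩
      rw [e2, e, ← h1]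
      have := S.c2 i j i b hij hab.ne hij.symm hab.ne c r
      simp only [mul_assoc, inv_inv, mul_inv_cancel_left]
      rw [← mul_assoc, ← mul_assoc (S.x i b r), this]

theorem YY_P_w (hn : 3 ≤ n) (hab : a < b) (hT : ∀ i j, i ≠ j → ∀ u v, S.h i j u * S.h i j v = S.h i j (u * v)) {u l p : Γ} (hu : u ∈ S.XG (sP a)) (hl : l ∈ S.XG (sL a)) (hp : PP S a b p) : YY S a b (u * (l * S.w a b 1 * p)) := by
  obtain ⟨r, q, hq, e⟩ := YY_x_wU S hn hab hT (L_norm_P S (inv_mem hl) hu) hp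
  have h1 := YY_L S hn hab hT hl (YY_x_w S hn hab hT r hq)
  rw [← e] at h1
  convert h1 using 1; group

theorem wP (hn : 3 ≤ n) (hab : a < b) (hT : ∀ i j, i ≠ j → ∀ u v, S.h i j u * S.h i j v = S.h i j (u * v)) (t : Fˣ) {p : Γ} (hp : PP S a b p) : YY S a b (S.w a b t * p) := by
  refine Or.inr ⟨1, one_mem _, S.w a b (-1) * (S.w a b t * p), PP_w S hn hab hT _ _ hp, ?_⟩
  rw [S.w_neg hab.ne]; group

theorem YY_xx (hn : 3 ≤ n) (hab : a < b) (hT : ∀ i j, i ≠ j → ∀ u v, S.h i j u * S.h i j v = S.h i j (u * v)) (r c : F) {p : Γ} (hp : PP S a b p) : YY S a b (S.x a b r * S.x b a c * p) := by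
  have P1 : ∀ {p}, PP S a b p → YY S a b p := fun {p} hp => Or.inl ⟨1, one_mem _, p, hp, by group⟩
  have hPx : ∀ r, S.x a b r ∈ S.XG (sP a) := fun r => S.xP hab _
  have hMx : ∀ r, S.x b a r ∈ S.XG (sM a) := fun r => S.xM hab _
  by_cases hc : c = 0
  · subst hc
    rw [S.x_zero hab.ne', mul_one]
    exact P1 (PP_P S (hPx r) hp)
  lift c to Fˣ using isUnit_iff_ne_zero.mpr hc
  have e1 : S.x a b r * S.x b a c * p = S.x a b (r + ↑c⁻¹) * (S.w a b (-c⁻¹) * (S.x a b ↑c⁻¹ * p)) := by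
    rw [S.x_eq_w hn hab.ne', S.w_symm hn hab.ne', S.add _ _ hab.ne]; group
  rw [e1]
  have hq := PP_P S (hPx ↑c⁻¹) hp
  set q := S.x a b ↑c⁻¹ * p
  by_cases ht : r + ↑c⁻¹ = 0
  · rw [ht, S.x_zero hab.ne, one_mul]
    exact wP S hn hab hT _ hq
  · obtain ⟨t, ht'⟩ := isUnit_iff_ne_zero.mpr ht
    rw [← ht', S.x_eq_w hn hab.ne]
    have h1 : PP S a b ((S.w a b (-c⁻¹))⁻¹ * S.x b a ↑t⁻¹ * (S.w a b (-c⁻¹))⁻¹⁻¹ * q) := by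
      rw [(S.w_mon hn hab.ne (-c⁻¹)).inv b a hab.ne', Equiv.swap_inv, Equiv.swap_apply_left, Equiv.swap_apply_right]
      exact PP_P S (hPx _) hq
    have h2 := PP_w S hn hab hT t (-c⁻¹) h1
    refine Or.inl ⟨_, hMx ↑t⁻¹, _, h2, ?_⟩
    group

theorem YY_P_M (hn : 3 ≤ n) (hab : a < b) (hT : ∀ i j, i ≠ j → ∀ u v, S.h i j u * S.h i j v = S.h i j (u * v)) (r : F) {u : Γ} (hu : u ∈ S.XG (sM a)) : ∃ c, ∃ l ∈ S.XG (sL a), ∃ u' ∈ S.XG (sM a), S.x a b r * u = l * u' * S.x a b r * S.x b a c := by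
  refine S.XG_induction (p := fun u => ∃ c, ∃ l ∈ S.XG (sL a), ∃ u' ∈ S.XG (sM a), S.x a b r * u = l * u' * S.x a b r * S.x b a c) ?_ ?_ hu
  · exact ⟨0, 1, one_mem _, 1, one_mem _, by rw [S.x_zero hab.ne']; group⟩
  · intro i j hij hI d g hg ih
    obtain ⟨c, l, hl, u', hu', e⟩ := ih
    obtain ⟨hi, hj⟩ := hI
    have hj : j = a := hj
    have hi : a < i := hi
    subst hj
    have hcm : S.x i j d * g = g * S.x i j d := by
      refine S.XG_induction (p := fun g => S.x i j d * g = g * S.x i j d) (by simp) ?_ hg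
      intro k l hkl hI f g _ ih
      obtain ⟨hk, hl⟩ := hI
      have hl : l = j := hl
      subst hl
      rw [← mul_assoc, S.c2 i l k l hij hkl hkl.symm hij, mul_assoc, ih, mul_assoc]
    by_cases hib : i = b
    · subst hib
      refine ⟨c + d, l, hl, u', hu', ?_⟩
      rw [hcm, ← mul_assoc, e, S.add _ _ hij]; group
    · have h1 := S.c1 i j b hij hab.ne hib d r
      have h2 : S.x j b r * S.x i j d = S.x i b (-(d * r)) * S.x i j d * S.x j b r := by
        rw [S.x_neg hib, mul_assoc, h1]; group
      refine ⟨c, S.x i b (-(d * r)) * l, mul_mem (S.xL hib hi hab _) hl, l⁻¹ * S.x i j d * l⁻¹⁻¹ * u',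
        mul_mem (L_norm_M S (inv_mem hl) (S.xM hi _)) hu', ?_⟩
      rw [← mul_assoc, h2, mul_assoc, e]; group

theorem YY_x (hn : 3 ≤ n) (hab : a < b) (hT : ∀ i j, i ≠ j → ∀ u v, S.h i j u * S.h i j v = S.h i j (u * v)) (r : F) {g : Γ} (hg : YY S a b g) : YY S a b (S.x a b r * g) := by
  rcases hg with ⟨u, hu, p, hp, rfl⟩ | ⟨l, hl, p, hp, rfl⟩
  · obtain ⟨c, l, hl, u', hu', e⟩ := YY_P_M S hn hab hT r hu
    have := YY_L S hn hab hT hl (YY_M S hn hab hT hu' (YY_xx S hn hab hT r c hp))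
    convert this using 1
    rw [← mul_assoc, e]; group
  · exact YY_P_w S hn hab hT (S.xP hab _) hl hp

theorem YY_P (hn : 3 ≤ n) (hab : a < b) (hT : ∀ i j, i ≠ j → ∀ u v, S.h i j u * S.h i j v = S.h i j (u * v)) {u g : Γ} (hu : u ∈ S.XG (sP a)) (hg : YY S a b g) : YY S a b (u * g) := by
  revert hg; generalize g = g; revert g
  refine S.XG_induction (p := fun u => ∀ g, YY S a b g → YY S a b (u * g)) ?_ ?_ hu
  · intro g hg; simpa using hg
  · intro i j hij hI c v _ ih g hg
    obtain ⟨hi, hj⟩ := hI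
    have hi : i = a := hi
    have hj : a < j := hj
    subst hi
    rw [mul_assoc]
    have hg := ih _ hg
    by_cases hjb : j = b
    · subst hjb; exact YY_x S hn hab hT _ hg
    · have h1 := S.comm_eq hab.ne (Ne.symm hjb) hij c 1
      rw [mul_one] at h1
      rw [h1, ← S.x_neg hab.ne, ← S.x_neg (Ne.symm hjb)]
      simp only [mul_assoc]
      have hL : ∀ d, S.x b j d ∈ S.XG (sL i) := fun d => S.xL (Ne.symm hjb) hab hj _
      exact YY_x S hn hab hT _ (YY_L S hn hab hT (hL _) (YY_x S hn hab hT _ (YY_L S hn hab hT (hL _) hg)))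

theorem YY_all (hn : 3 ≤ n) (hab : a < b) (hT : ∀ i j, i ≠ j → ∀ u v, S.h i j u * S.h i j v = S.h i j (u * v)) {g : Γ} (hg : g ∈ S.XG {p | a ≤ p.1 ∧ a ≤ p.2}) : YY S a b g := by
  refine S.XG_induction (p := fun g => YY S a b g) ?_ ?_ hg
  · refine Or.inl ⟨1, one_mem _, 1, ⟨1, one_mem _, 1, 1, one_mem _, ?_⟩, by simp⟩
    rw [S.h_one hab.ne]; simp
  · rintro i j hij ⟨hi, hj⟩ c g _ ih
    rcases eq_or_lt_of_le hi with hi | hi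
    · have hi : a = i := hi
      subst hi
      rcases eq_or_lt_of_le hj with hj | hj
      · exact absurd hj hij
      · exact YY_P S hn hab hT (S.xP hj _) ih
    · rcases eq_or_lt_of_le hj with hj | hj
      · have hj : a = j := hj
        subst hj
        exact YY_M S hn hab hT (S.xM hi _) ih
      · exact YY_L S hn hab hT (S.xL hij hi hj _) ih

end field
end StSys
end BG

namespace BG
namespace StSys
section field
variable {n : ℕ} {F : Type} [Field F] {Γ : Type*} [Group Γ] (S : StSys n F Γ)
  (π : Γ →* SL n F)

theorem ker_L (hπ : ∀ i j, i ≠ j → ∀ a, π (S.x i j a) = tv i j a) {a : Fin n} {l : Γ} (hl : l ∈ S.XG (sL a)) :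
    (∀ q, mat (π l) a q = if a = q then 1 else 0) ∧ (∀ q, mat (π l) q a = if q = a then 1 else 0) := by
  refine S.XG_induction (p := fun l => (∀ q, mat (π l) a q = if a = q then 1 else 0) ∧ (∀ q, mat (π l) q a = if q = a then 1 else 0)) ?_ ?_ hl
  · simp [mat_one_apply]
  · rintro i j hij ⟨hi, hj⟩ c g _ ⟨h1, h2⟩
    have hi : a < i := hi
    have hj : a < j := hj
    rw [map_mul, hπ i j hij]
    constructor
    · intro q; rw [tv_mul_apply hij, if_neg hi.ne, add_zero, h1]
    · intro q; rw [tv_mul_apply hij, h2, h2, if_neg hj.ne']; simp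

theorem ker_w (hπ : ∀ i j, i ≠ j → ∀ a, π (S.x i j a) = tv i j a) {a b : Fin n} (hab : a ≠ b) (u : Fˣ) (g : SL n F) (q : Fin n) :
    mat (π (S.w a b u) * g) a q = u * mat g b q ∧ mat (π (S.w a b u) * g) b q = - ↑u⁻¹ * mat g a q ∧
     ∀ p, p ≠ a → p ≠ b → mat (π (S.w a b u) * g) p q = mat g p q := by
  simp only [w, map_mul, hπ a b hab, hπ b a hab.symm, mul_assoc]
  refine ⟨?_, ?_, ?_⟩
  · simp [tv_mul_apply hab, tv_mul_apply hab.symm, hab, hab.symm]; field_simp; ring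
  · simp [tv_mul_apply hab, tv_mul_apply hab.symm, hab, hab.symm]; field_simp; ring
  · intro p h1 h2
    simp [tv_mul_apply hab, tv_mul_apply hab.symm, h1, h2]

theorem ker_h (hπ : ∀ i j, i ≠ j → ∀ a, π (S.x i j a) = tv i j a) {a b : Fin n} (hab : a ≠ b) (u : Fˣ) (g : SL n F) (q : Fin n) :
    mat (π (S.h a b u) * g) a q = u * mat g a q ∧ mat (π (S.h a b u) * g) b q = ↑u⁻¹ * mat g b q ∧
     ∀ p, p ≠ a → p ≠ b → mat (π (S.h a b u) * g) p q = mat g p q := by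
  obtain ⟨h1, h2, h3⟩ := ker_w S π hπ hab (-1) g q
  simp only [h, map_mul, mul_assoc]
  obtain ⟨h1', h2', h3'⟩ := ker_w S π hπ hab u (π (S.w a b (-1)) * g) q
  refine ⟨?_, ?_, ?_⟩
  · rw [h1', h2]; simp
  · rw [h2', h1]; simp
  · intro p hp1 hp2; rw [h3' p hp1 hp2, h3 p hp1 hp2]

theorem param_P (hπ : ∀ i j, i ≠ j → ∀ a, π (S.x i j a) = tv i j a) (a : Fin n) : ∃ Φ : (Fin n → F) → Γ, Φ 0 = 1 ∧ ∀ u ∈ S.XG (sP a), ∃ c, u = Φ c ∧ c a = 0 ∧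
    ∀ p q, mat (π u) p q = (if p = q then 1 else 0) + if p = a then c q else 0 := by
  classical
  obtain ⟨Φ, h0, hΦ⟩ := exists_param (ι := Fin n) (fun j => if h : a ≠ j then S.xhom a j h else 1) (by
    intro i j hij r s
    by_cases hi : a = i
    · simp [hi]
    by_cases hj : a = j
    · simp [hj]
    simp only [hi, hj, ne_eq, not_false_eq_true, dite_true]
    exact S.c2 a i a j hi hj (Ne.symm hi) hj _ _)
  refine ⟨Φ, h0, fun u hu => ?_⟩
  refine S.XG_induction (p := fun u => ∃ c, u = Φ c ∧ c a = 0 ∧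
    ∀ p q, mat (π u) p q = (if p = q then 1 else 0) + if p = a then c q else 0) ?_ ?_ hu
  · exact ⟨0, h0.symm, rfl, by simp [mat_one_apply]⟩
  · rintro i j hij ⟨hi, hj⟩ r g _ ⟨c, rfl, hc, hm⟩
    have hi : i = a := hi
    subst hi
    have h2 := hΦ j r c
    simp only [ne_eq, hij, not_false_eq_true, dite_true] at h2
    refine ⟨_, h2, by simp [hc, hij], ?_⟩
    intro p q
    rw [map_mul, hπ i j hij, tv_mul_apply hij, hm, hm, if_neg hij.symm]
    by_cases hp : p = i
    · by_cases hq : j = q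
      · subst hq; simp [hp]; ring
      · simp [hp, hq, Ne.symm hq]
    · simp [hp]

theorem param_M (hπ : ∀ i j, i ≠ j → ∀ a, π (S.x i j a) = tv i j a) (a : Fin n) : ∃ Φ : (Fin n → F) → Γ, Φ 0 = 1 ∧ ∀ u ∈ S.XG (sM a), ∃ c, u = Φ c ∧ c a = 0 ∧
    ∀ p q, mat (π u) p q = (if p = q then 1 else 0) + if q = a then c p else 0 := by
  classical
  obtain ⟨Φ, h0, hΦ⟩ := exists_param (ι := Fin n) (fun j => if h : j ≠ a then S.xhom j a h else 1) (by
    intro i j hij r s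
    by_cases hi : i = a
    · simp [hi]
    by_cases hj : j = a
    · simp [hj]
    simp only [hi, hj, ne_eq, not_false_eq_true, dite_true]
    exact S.c2 i a j a hi hj (Ne.symm hj) hi _ _)
  refine ⟨Φ, h0, fun u hu => ?_⟩
  refine S.XG_induction (p := fun u => ∃ c, u = Φ c ∧ c a = 0 ∧
    ∀ p q, mat (π u) p q = (if p = q then 1 else 0) + if q = a then c p else 0) ?_ ?_ hu
  · exact ⟨0, h0.symm, rfl, by simp [mat_one_apply]⟩
  · rintro i j hij ⟨hi, hj⟩ r g _ ⟨c, rfl, hc, hm⟩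
    have hj : j = a := hj
    subst hj
    have h2 := hΦ i r c
    simp only [ne_eq, hij, not_false_eq_true, dite_true] at h2
    refine ⟨_, h2, by simp [hc, hij.symm], ?_⟩
    intro p q
    rw [map_mul, hπ i j hij, tv_mul_apply hij, hm, hm, hc]
    by_cases hp : p = i
    · by_cases hq : q = j
      · subst hq; simp [hp]; ring
      · simp [hp, hq, Ne.symm hq]
    · simp [hp]

theorem field_step (hπ : ∀ i j, i ≠ j → ∀ a, π (S.x i j a) = tv i j a) (hn : 3 ≤ n) {a b : Fin n} (hab : a < b) (hT : ∀ i j, i ≠ j → ∀ u v, S.h i j u * S.h i j v = S.h i j (u * v))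
    {g : Γ} (hg : g ∈ S.XG {p | a ≤ p.1 ∧ a ≤ p.2}) (h1 : π g = 1) : g ∈ S.XG (sL a) := by
  have key : ∀ p, PP S a b p → ∃ t : Fˣ, ∀ q, mat (π p) q a = if q = a then (t : F) else 0 := by
    rintro p ⟨u, hu, t, l, hl, rfl⟩
    refine ⟨t, fun q => ?_⟩
    obtain ⟨_, h2⟩ := ker_L S π hπ hl
    have h3 : ∀ q, mat (π (S.h a b t * l)) q a = if q = a then (t : F) else 0 := by
      intro q
      obtain ⟨k1, k2, k3⟩ := ker_h S π hπ hab.ne t (π l) a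
      rw [map_mul]
      by_cases hq : q = a
      · subst hq; simp [k1, h2]
      by_cases hq' : q = b
      · subst hq'; simp [k2, h2, hq]
      · simp [k3 q hq hq', h2, hq]
    obtain ⟨Φ, _, hΦ⟩ := param_P S π hπ a
    obtain ⟨c, _, hc, hm⟩ := hΦ u hu
    rw [mul_assoc, map_mul, mat_mul_apply]
    simp only [h3, mul_ite, mul_zero, Finset.sum_ite_eq', Finset.mem_univ, if_true, hm, hc]
    by_cases hq : q = a <;> simp [hq]
  rcases YY_all S hn hab hT hg with ⟨u, hu, p, hp, rfl⟩ | ⟨l, hl, p, hp, rfl⟩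
  · obtain ⟨Φ, hΦ0, hΦ⟩ := param_M S π hπ a
    obtain ⟨c, rfl, hc, hm⟩ := hΦ u hu
    obtain ⟨t0, ht0⟩ := key p hp
    have h4 : ∀ q, (if q = a then (1:F) else 0) = ((if q = a then 1 else 0) + c q) * t0 := by
      intro q
      have h5 := mat_one_apply (R := F) q a
      rw [← h1, map_mul, mat_mul_apply] at h5
      refine h5.symm.trans ?_
      simp only [ht0, mul_ite, mul_zero, Finset.sum_ite_eq', Finset.mem_univ, if_true, hm]
    have ht : (t0 : F) = 1 := by have := h4 a; simpa [hc] using this.symm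
    have hc0 : c = 0 := by
      funext q
      have := h4 q
      rw [ht, mul_one] at this
      simpa using this
    rw [hc0, hΦ0, one_mul] at h1 ⊢
    obtain ⟨v, hv, t, l, hl, rfl⟩ := hp
    have ht1 : t = 1 := by
      have h5 : mat (π (v * S.h a b t * l)) a a = t := by
        obtain ⟨_, h2⟩ := ker_L S π hπ hl
        have h3 : ∀ q, mat (π (S.h a b t * l)) q a = if q = a then (t : F) else 0 := by
          intro q
          obtain ⟨k1, k2, k3⟩ := ker_h S π hπ hab.ne t (π l) a
          rw [map_mul]
          by_cases hq : q = a
          · subst hq; simp [k1, h2]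
          by_cases hq' : q = b
          · subst hq'; simp [k2, h2, hq]
          · simp [k3 q hq hq', h2, hq]
        obtain ⟨Φ, _, hΦ⟩ := param_P S π hπ a
        obtain ⟨c, _, hc, hm⟩ := hΦ v hv
        rw [mul_assoc, map_mul, mat_mul_apply]
        simp only [h3, mul_ite, mul_zero, Finset.sum_ite_eq', Finset.mem_univ, if_true, hm, hc]
        simp
      rw [h1] at h5
      simp only [mat_one_apply, if_true] at h5
      exact Units.ext h5.symm
    subst ht1
    rw [S.h_one hab.ne, mul_one] at h1 ⊢
    obtain ⟨Φ, hΦ0, hΦ⟩ := param_P S π hπ a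
    obtain ⟨c, rfl, hc, hm⟩ := hΦ v hv
    have h6 : π (Φ c) = π l⁻¹ := by
      rw [map_mul] at h1
      rw [map_inv]; exact eq_inv_of_mul_eq_one_left h1
    obtain ⟨h7, _⟩ := ker_L S π hπ (inv_mem hl)
    have hc0 : c = 0 := by
      funext q
      have := hm a q
      rw [h6, h7] at this
      simpa using this
    rw [hc0, hΦ0, one_mul]; exact hl
  · exfalso
    obtain ⟨t0, ht0⟩ := key p hp
    obtain ⟨h2, _⟩ := ker_L S π hπ hl
    have h3 : mat (π (l * S.w a b 1 * p)) a a = 0 := by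
      rw [mul_assoc, map_mul, mat_mul_apply]
      simp only [h2, ite_mul, one_mul, zero_mul, Finset.sum_ite_eq, Finset.mem_univ, if_true]
      rw [map_mul, (ker_w S π hπ hab.ne 1 (π p) a).1, ht0]
      simp [hab.ne']
    rw [h1, mat_one_apply] at h3
    simp at h3

theorem field_pres (hπ : ∀ i j, i ≠ j → ∀ a, π (S.x i j a) = tv i j a) (hn : 3 ≤ n) (hT : ∀ i j, i ≠ j → ∀ u v, S.h i j u * S.h i j v = S.h i j (u * v))
    {g : Γ} (hg : g ∈ S.XG Set.univ) (h1 : π g = 1) : g = 1 := by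
  have key : ∀ k m : ℕ, n ≤ m + k → ∀ g ∈ S.XG {p | m ≤ p.1.1 ∧ m ≤ p.2.1}, π g = 1 → g = 1 := by
    intro k
    induction k with
    | zero =>
      intro m hm g hg _
      refine S.XG_induction (p := fun g => g = 1) rfl ?_ hg
      rintro i j hij ⟨hi, hj⟩
      have hi : m ≤ i.1 := hi
      omega
    | succ k ih =>
      intro m hm g hg h1
      by_cases hm2 : m + 1 < n
      · have := field_step S π hπ hn (a := ⟨m, by omega⟩) (b := ⟨m+1, hm2⟩) (Fin.mk_lt_mk.mpr (by omega)) hT (g := g) hg h1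
        exact ih (m+1) (by omega) g this h1
      · refine S.XG_induction (p := fun g => g = 1) rfl ?_ hg
        rintro i j hij ⟨hi, hj⟩
        have hi : m ≤ i.1 := hi
        have hj : m ≤ j.1 := hj
        exact absurd (Fin.ext (by omega)) hij
  exact key n 0 (by omega) g (by simpa using hg) h1

end field
end StSys
end BG

namespace BG
section trans
variable {n : ℕ} {R : Type*} [CommRing R]

theorem rowE (l : Fin n) (u : Fin n → R) (hu : u l = 0) :
    ∃ P ∈ E n R, mat P = 1 + Matrix.vecMulVec (Pi.single l 1) u := by
  have key : ∀ s : Finset (Fin n), l ∉ s → ∃ P ∈ E n R, ∀ a b, mat P a b = (if a = b then 1 else 0) + if a = l ∧ b ∈ s then u b else 0 := by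
    intro s
    induction s using Finset.induction_on with
    | empty => intro _; exact ⟨1, one_mem _, by simp [mat_one_apply]⟩
    | insert j s hj ih =>
      intro hl
      simp only [Finset.mem_insert, not_or] at hl
      obtain ⟨P, hP, hm⟩ := ih hl.2
      refine ⟨tv l j (u j) * P, mul_mem (tv_mem _ _ _) hP, fun a b => ?_⟩
      rw [tv_mul_apply hl.1, hm, hm]
      by_cases ha : a = l
      · subst ha
        by_cases hb : j = b
        · subst hb; simp [hj, Ne.symm hl.1]
        · simp [hb, Ne.symm hb, Ne.symm hl.1]
      · simp [ha]
  obtain ⟨P, hP, hm⟩ := key (Finset.univ.erase l) (by simp)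
  refine ⟨P, hP, ?_⟩
  ext a b
  rw [hm, Matrix.add_apply, Matrix.one_apply, Matrix.vecMulVec_apply]
  by_cases ha : a = l
  · by_cases hb : b = l
    · subst hb; simp [hu]
    · simp [ha, hb]
  · simp [ha]

theorem colE (l : Fin n) (u : Fin n → R) (hu : u l = 0) :
    ∃ P ∈ E n R, mat P = 1 + Matrix.vecMulVec u (Pi.single l 1) := by
  obtain ⟨P, hP, hm⟩ := rowE l u hu
  refine ⟨P.transpose, transpose_mem hP, ?_⟩
  rw [mat_transpose, hm]; simp [Matrix.transpose_vecMulVec]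

theorem comm_nil {M : Type*} [Ring M] {a b : M} (ha : a * a = 0) (hb : b * b = 0) (hba : b * a = 0) :
    (1 + a) * (1 + b) * ((1 - a) * (1 - b)) = 1 + a * b := by
  have h1 : ∀ x, a * (a * x) = 0 := fun x => by rw [← mul_assoc, ha, zero_mul]
  have h2 : ∀ x, b * (b * x) = 0 := fun x => by rw [← mul_assoc, hb, zero_mul]
  have h3 : ∀ x, b * (a * x) = 0 := fun x => by rw [← mul_assoc, hba, zero_mul]
  simp only [mul_add, add_mul, mul_sub, sub_mul, mul_assoc, mul_one, one_mul, ha, hb, hba, h1, h2, h3, mul_zero]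
  abel

/-- transvection `1 + v wᵀ` with a zero coordinate of `w` -/
theorem trv_mem0 {v w : Fin n → R} (h0 : dotProduct w v = 0) {l : Fin n} (hl : w l = 0) (hv : v l = 0) :
    ∃ P ∈ E n R, mat P = 1 + Matrix.vecMulVec v w := by
  obtain ⟨P1, hP1, e1⟩ := colE l v hv
  obtain ⟨P2, hP2, e2⟩ := rowE l w hl
  obtain ⟨P3, hP3, e3⟩ := colE l (-v) (by simp [hv])
  obtain ⟨P4, hP4, e4⟩ := rowE l (-w) (by simp [hl])
  refine ⟨P1 * P2 * (P3 * P4), mul_mem (mul_mem hP1 hP2) (mul_mem hP3 hP4), ?_⟩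
  simp only [mat_mul, e1, e2, e3, e4, Matrix.neg_vecMulVec, Matrix.vecMulVec_neg, ← sub_eq_add_neg]
  rw [comm_nil]
  · rw [Matrix.vecMulVec_mul_vecMulVec]; simp
  · rw [Matrix.vecMulVec_mul_vecMulVec]; simp [hv]
  · rw [Matrix.vecMulVec_mul_vecMulVec]; simp [hl]
  · rw [Matrix.vecMulVec_mul_vecMulVec]; simp [h0]

theorem trv_mem1 {v w : Fin n → R} (h0 : dotProduct w v = 0) {l : Fin n} (hl : w l = 0) :
    ∃ P ∈ E n R, mat P = 1 + Matrix.vecMulVec v w := by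
  obtain ⟨P1, hP1, e1⟩ := trv_mem0 (v := v - Pi.single l (v l)) (w := w) (l := l) (by simp [dotProduct_sub, h0, hl]) hl (by simp)
  obtain ⟨P2, hP2, e2⟩ := rowE l (v l • w) (by simp [hl])
  refine ⟨P1 * P2, mul_mem hP1 hP2, ?_⟩
  have e3 : Matrix.vecMulVec (Pi.single l 1) (v l • w) = Matrix.vecMulVec (Pi.single l (v l)) w := by
    ext a b
    simp only [Matrix.vecMulVec_apply, Pi.smul_apply, smul_eq_mul]
    by_cases h : a = l
    · subst h; simp
    · simp [h]
  rw [mat_mul, e1, e2, e3, mul_add, add_mul, add_mul, Matrix.vecMulVec_mul_vecMulVec, Matrix.sub_vecMulVec]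
  simp [hl]
  abel

theorem trv_mem {v w : Fin n → R} (h0 : dotProduct w v = 0) {i l : Fin n} (hil : i ≠ l) {c : R} (hl : w l = c * w i)
    : ∃ P ∈ E n R, mat P = 1 + Matrix.vecMulVec v w := by
  -- conjugate by `tv i l c`
  have ht : mat (tv i l c) * mat (tv i l (-c)) = 1 := by
    rw [← mat_mul, ← tv_add, add_neg_cancel, tv_zero, mat_one]
  have ht' : mat (tv i l (-c)) * mat (tv i l c) = 1 := by
    rw [← mat_mul, ← tv_add, neg_add_cancel, tv_zero, mat_one]
  obtain ⟨P, hP, e⟩ := trv_mem1 (v := Matrix.mulVec (mat (tv i l c)) v) (w := Matrix.vecMul w (mat (tv i l (-c)))) (l := l) (by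
      rw [← Matrix.dotProduct_mulVec, Matrix.mulVec_mulVec, ht', Matrix.one_mulVec, h0]) (by
      rw [Matrix.vecMul, dotProduct]
      simp only [tv_apply hil, mul_add, Finset.sum_add_distrib]
      simp [hl, mul_comm]
      )
  refine ⟨tv i l (-c) * P * tv i l c, mul_mem (mul_mem (tv_mem _ _ _) hP) (tv_mem _ _ _), ?_⟩
  rw [mat_mul, mat_mul, e, mul_add, add_mul, mul_one, ht', Matrix.mul_vecMulVec, Matrix.vecMulVec_mul, Matrix.mulVec_mulVec,
      Matrix.vecMul_vecMul, ht', Matrix.one_mulVec, Matrix.vecMul_one]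

theorem trv_mem' {v w : Fin n → R} (h0 : dotProduct w v = 0) {i l : Fin n} (hil : i ≠ l) {c : R} (hl : v l = c * v i)
    : ∃ P ∈ E n R, mat P = 1 + Matrix.vecMulVec v w := by
  obtain ⟨P, hP, e⟩ := trv_mem (v := w) (w := v) (by rw [dotProduct_comm, h0]) hil hl
  refine ⟨P.transpose, transpose_mem hP, ?_⟩
  rw [mat_transpose, e]; simp [Matrix.transpose_vecMulVec]
end trans

section delta
open Polynomial
variable {n : ℕ} {C : Type*} [CommRing C]

def KX (n : ℕ) (C : Type*) [CommRing C] : Set (SL n C[X]) :=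
  {q : SL n C[X] | ∃ e : SL n C, ∃ i j, i ≠ j ∧ ∃ f, q = mp Polynomial.C e * tv i j (X * f) * (mp Polynomial.C e)⁻¹}

/-- every elementary polynomial matrix is (product of conjugates of `tv i j (X f)`) times its value at `0` -/
theorem E_poly_decomp {h : SL n C[X]} (hh : h ∈ E n C[X]) :
    ∃ q ∈ Subgroup.closure (KX n C),
      h = q * mp Polynomial.C (mp (evalRingHom 0) h) := by
  refine E_induction (n := n) (R := C[X]) (p := fun h : SL n C[X] => ∃ q ∈ Subgroup.closure (KX n C),
      h = q * mp Polynomial.C (mp (evalRingHom 0) h)) ?_ ?_ hh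
  · exact ⟨1, one_mem _, by simp only [map_one, mul_one]⟩
  · rintro i j hij r h _ ⟨q, hq, e⟩
    obtain ⟨f, hf⟩ : ∃ f, r = X * f + Polynomial.C (r.eval 0) := by
      obtain ⟨f, hf⟩ := Polynomial.X_dvd_sub_C (p := r)
      exact ⟨f, by rw [← hf, Polynomial.coeff_zero_eq_eval_zero]; ring⟩
    refine ⟨tv i j (X * f) * (mp Polynomial.C (tv i j (r.eval 0)) * q * (mp Polynomial.C (tv i j (r.eval 0)))⁻¹), mul_mem ?_ ?_, ?_⟩
    · refine Subgroup.subset_closure ⟨1, i, j, hij, f, by simp only [map_one, one_mul, inv_one, mul_one]⟩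
    · refine conj_closure ?_ hq
      rintro t ⟨e, i', j', hij', f', rfl⟩
      refine Subgroup.subset_closure ⟨tv i j (r.eval 0) * e, i', j', hij', f', ?_⟩
      simp only [map_mul]; group
    · have e1 : tv i j r = tv i j (X * f) * mp Polynomial.C (tv i j (r.eval 0)) := by
        rw [mp_tv, ← tv_add, ← hf]
      have e2 : mp (evalRingHom 0) (tv i j r) = tv i j (r.eval 0) := by rw [mp_tv]; rfl
      have e3 : mp (evalRingHom 0) (tv i j r * h) = tv i j (r.eval 0) * mp (evalRingHom 0) h := by rw [← e2]; exact map_mul _ _ _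
      rw [e3, map_mul (mp (Polynomial.C : C →+* C[X]))]
      generalize hA : mp Polynomial.C (tv i j (eval 0 r)) = A at *
      generalize hB : mp Polynomial.C (mp (evalRingHom 0) h) = B at *
      rw [e1, e]; group

noncomputable def dX (k : Fin n) : Fin n → C[X] := fun a => if a = k then X else 1

theorem dX_cancel (k : Fin n) {M M' : Matrix (Fin n) (Fin n) C[X]} (h : M * Matrix.diagonal (dX k) = M' * Matrix.diagonal (dX k)) : M = M' := by
  ext1 a b
  have := congrFun (congrFun h a) b
  rw [Matrix.mul_diagonal, Matrix.mul_diagonal, dX] at this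
  split_ifs at this with hb
  · exact Polynomial.isRegular_X.right this
  · simpa using this

theorem delta_gen (hn : 3 ≤ n) [IsLocalRing C] (k : Fin n) (e : SL n C) (i j : Fin n) (hij : i ≠ j) (f : C[X]) :
    ∃ q' ∈ E n C[X], Matrix.diagonal (dX k) * mat (mp Polynomial.C e * tv i j (X * f) * (mp Polynomial.C e)⁻¹) =
      mat q' * Matrix.diagonal (dX k) := by
  set v : Fin n → C := fun a => mat e a i with hv
  set w : Fin n → C := fun b => mat e⁻¹ j b with hw
  have hwv : ∑ a, w a * v a = 0 := by
    have := mat_mul_apply e⁻¹ e j i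
    rw [inv_mul_cancel, mat_one_apply, if_neg hij.symm] at this
    exact this.symm
  have hvu : ∃ a, IsUnit (v a) := by
    by_contra hc
    push Not at hc
    have h1 : mat (e⁻¹ * e) i i = 1 := by rw [inv_mul_cancel, mat_one_apply, if_pos rfl]
    rw [mat_mul_apply] at h1
    have : (1 : C) ∈ IsLocalRing.maximalIdeal C := by
      rw [← h1]
      exact Ideal.sum_mem _ fun a _ => Ideal.mul_mem_left _ _ (hc a)
    exact this isUnit_one
  have hwu : ∃ a, IsUnit (w a) := by
    by_contra hc
    push Not at hc
    have h1 : mat (e⁻¹ * e) j j = 1 := by rw [inv_mul_cancel, mat_one_apply, if_pos rfl]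
    rw [mat_mul_apply] at h1
    have : (1 : C) ∈ IsLocalRing.maximalIdeal C := by
      rw [← h1]
      exact Ideal.sum_mem _ fun a _ => Ideal.mul_mem_right _ _ (hc a)
    exact this isUnit_one
  let v' : Fin n → C[X] := fun a => f * (dX k a * Polynomial.C (v a))
  let w' : Fin n → C[X] := fun b => (if b = k then 1 else X) * Polynomial.C (w b)
  have hq : ∀ q' : SL n C[X], mat q' = 1 + Matrix.vecMulVec v' w' → Matrix.diagonal (dX k) * mat (mp Polynomial.C e * tv i j (X * f) * (mp Polynomial.C e)⁻¹) =
      mat q' * Matrix.diagonal (dX k) := by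
    intro q' hq'
    ext1 a b
    rw [Matrix.diagonal_mul, Matrix.mul_diagonal, hq', Matrix.add_apply, Matrix.one_apply, Matrix.vecMulVec_apply]
    have e1 : mat (mp Polynomial.C e * tv i j (X * f) * (mp Polynomial.C e)⁻¹) a b = (if a = b then 1 else 0) + X * f * Polynomial.C (v a) * Polynomial.C (w b) := by
      have h2 : mat (mp Polynomial.C e * (mp Polynomial.C e)⁻¹) a b = if a = b then 1 else 0 := by
        rw [mul_inv_cancel, mat_one_apply]
      rw [mat_mul_apply] at h2 ⊢
      rw [← h2, ← map_inv]
      simp only [mul_tv_apply hij, add_mul, Finset.sum_add_distrib, mp_apply]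
      simp [hv, hw]
    rw [e1]
    simp only [v', w', dX]
    by_cases ha : a = k <;> by_cases hb : b = k
    · simp [ha, hb]; ring
    · have : k ≠ b := Ne.symm hb
      simp [ha, hb, this]; ring
    · simp [ha, hb]; ring
    · by_cases hab : a = b
      · subst hab; simp [ha]; ring
      · simp [ha, hb, hab]; ring
  have h0 : dotProduct w' v' = 0 := by
    have : dotProduct w' v' = X * f * Polynomial.C (∑ a, w a * v a) := by
      rw [dotProduct, map_sum, Finset.mul_sum]
      refine Finset.sum_congr rfl fun a _ => ?_
      simp only [v', w', dX]
      by_cases ha : a = k <;> simp [ha] <;> ring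
    rw [this, hwv]; simp
  by_cases hA : ∃ i₀, i₀ ≠ k ∧ IsUnit (v i₀)
  · obtain ⟨i₀, hi, u, hu⟩ := hA
    obtain ⟨l, hl1, _⟩ := StSys.exists_third hn i₀ i₀
    obtain ⟨q', hq', e'⟩ := trv_mem' h0 (Ne.symm hl1) (c := dX k l * Polynomial.C (v l * ↑u⁻¹)) (by
      have : (Polynomial.C (↑u⁻¹ : C)) * Polynomial.C (v i₀) = 1 := by rw [← hu, ← map_mul]; simp
      simp only [v', dX, if_neg hi, map_mul, one_mul]
      linear_combination -(f * (if l = k then X else 1) * Polynomial.C (v l)) * this)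
    exact ⟨q', hq', hq q' e'⟩
  · push Not at hA
    obtain ⟨a, ha⟩ := hvu
    have hak : a = k := by by_contra h; exact hA a h ha
    subst hak
    have hwa : ¬ IsUnit (w a) := by
      intro hwa
      have h1 : w a * v a = - ∑ b ∈ Finset.univ.erase a, w b * v b := by
        rw [← Finset.add_sum_erase _ _ (Finset.mem_univ a)] at hwv
        linear_combination hwv
      have h2 : w a * v a ∈ IsLocalRing.maximalIdeal C := by
        rw [h1]
        refine neg_mem (Ideal.sum_mem _ fun b hb => Ideal.mul_mem_left _ _ (hA b (Finset.ne_of_mem_erase hb)))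
      exact h2 (hwa.mul ha)
    obtain ⟨b, u, hu⟩ := hwu
    have hba : b ≠ a := by rintro rfl; exact hwa ⟨u, hu⟩
    obtain ⟨l, hl1, hl2⟩ := StSys.exists_third hn b a
    obtain ⟨q', hq', e'⟩ := trv_mem h0 (Ne.symm hl1) (c := Polynomial.C (w l * ↑u⁻¹)) (by
      have : (Polynomial.C (↑u⁻¹ : C)) * Polynomial.C (w b) = 1 := by rw [← hu, ← map_mul]; simp
      simp only [w', if_neg hba, if_neg hl2, map_mul]
      linear_combination -(X * Polynomial.C (w l)) * this)
    exact ⟨q', hq', hq q' e'⟩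

theorem delta_mem (hn : 3 ≤ n) [IsLocalRing C] (k : Fin n) {p p' : SL n C[X]} (hp : p ∈ E n C[X]) (h0 : mp (evalRingHom 0) p = 1)
    (hD : Matrix.diagonal (dX k) * mat p = mat p' * Matrix.diagonal (dX k)) : p' ∈ E n C[X] := by
  obtain ⟨q, hq, e⟩ := E_poly_decomp hp
  rw [h0, map_one, mul_one] at e
  subst e
  have key : ∃ q' ∈ E n C[X], Matrix.diagonal (dX k) * mat p = mat q' * Matrix.diagonal (dX k) := by
    clear hp h0 hD
    induction hq using Subgroup.closure_induction with
    | mem x hx =>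
      obtain ⟨e, i, j, hij, f, rfl⟩ := hx
      exact delta_gen hn k e i j hij f
    | one => exact ⟨1, one_mem _, by simp⟩
    | mul x y _ _ hx hy =>
      obtain ⟨a, ha, ea⟩ := hx
      obtain ⟨b, hb, eb⟩ := hy
      exact ⟨a * b, mul_mem ha hb, by rw [mat_mul, mat_mul, ← mul_assoc, ea, mul_assoc, eb, mul_assoc]⟩
    | inv x _ hx =>
      obtain ⟨a, ha, ea⟩ := hx
      refine ⟨a⁻¹, inv_mem ha, ?_⟩
      have h1 : mat a⁻¹ * mat a = 1 := by rw [← mat_mul, inv_mul_cancel, mat_one]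
      have h2 : mat x * mat x⁻¹ = 1 := by rw [← mat_mul, mul_inv_cancel, mat_one]
      calc Matrix.diagonal (dX k) * mat x⁻¹ = mat a⁻¹ * (mat a * Matrix.diagonal (dX k)) * mat x⁻¹ := by
            rw [← mul_assoc, h1, one_mul]
        _ = mat a⁻¹ * Matrix.diagonal (dX k) := by rw [← ea, mul_assoc, mul_assoc, h2, mul_one]
  obtain ⟨q', hq', e⟩ := key
  have : p' = q' := mat_inj (dX_cancel k (hD.symm.trans e))
  rw [this]; exact hq'
end delta
end BG

namespace BG
open Polynomial

structure LSys (C : Type*) [CommRing C] [IsLocalRing C] (L K : Type*) [CommRing L] [Field K] where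
  φ : C[X] →+* L
  ω : PowerSeries C →+* L
  ψ : L →+* K
  x : Lˣ
  φX : φ X = x
  ωX : ω PowerSeries.X = (x⁻¹ : Lˣ)
  φC : ∀ c, φ (Polynomial.C c) = ω (PowerSeries.C c)
  φinj : Function.Injective φ
  ωinj : Function.Injective ω
  φω : ∀ q s, φ q = ω s → ∃ c, q = Polynomial.C c
  ψφ : ∀ q, ψ (φ q) = 0 → ∀ i, q.coeff i ∈ IsLocalRing.maximalIdeal C
  ψω : ∀ s, ψ (ω s) = 0 → ∀ i, PowerSeries.coeff i s ∈ IsLocalRing.maximalIdeal C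
  ψC : ∀ c ∈ IsLocalRing.maximalIdeal C, ψ (φ (Polynomial.C c)) = 0
  split : ∀ b (N : ℕ), ∃ (s : Finset ℤ) (c : ℤ → C) (τ : PowerSeries C),
    b = ∑ l ∈ s, φ (Polynomial.C (c l)) * (x ^ l : Lˣ) + ω (PowerSeries.X ^ N * τ) ∧
    (ψ b = 0 → (∀ l, c l ∈ IsLocalRing.maximalIdeal C) ∧ ψ (ω τ) = 0)
  lift : ∀ u : Kˣ, ∃ v : Lˣ, ψ v = u
  surj : Function.Surjective ψ

section laurent
variable (C : Type*) [CommRing C]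

noncomputable def lx : (LaurentSeries C)ˣ where
  val := HahnSeries.single (-1 : ℤ) 1
  inv := HahnSeries.single (1 : ℤ) 1
  val_inv := by rw [HahnSeries.single_mul_single]; simp
  inv_val := by rw [HahnSeries.single_mul_single]; simp

theorem lx_zpow (l : ℤ) : ((lx C ^ l : (LaurentSeries C)ˣ) : LaurentSeries C) = HahnSeries.single (-l) 1 := by
  have h1 : ∀ k : ℕ, ((lx C ^ k : (LaurentSeries C)ˣ) : LaurentSeries C) = HahnSeries.single (-(k:ℤ)) 1 := by
    intro k
    induction k with
    | zero => simp
    | succ k ih =>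
      rw [pow_succ, Units.val_mul, ih]
      change _ * HahnSeries.single (-1 : ℤ) 1 = _
      rw [HahnSeries.single_mul_single, mul_one, show -(k:ℤ) + -1 = -((k+1 : ℕ) : ℤ) by push_cast; ring]
  have h2 : ∀ k : ℕ, (((lx C)⁻¹ ^ k : (LaurentSeries C)ˣ) : LaurentSeries C) = HahnSeries.single (k:ℤ) 1 := by
    intro k
    induction k with
    | zero => simp
    | succ k ih =>
      rw [pow_succ, Units.val_mul, ih]
      change _ * HahnSeries.single (1 : ℤ) 1 = _
      rw [HahnSeries.single_mul_single]; congr 1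
      simp
  obtain ⟨k, rfl | rfl⟩ := l.eq_nat_or_neg
  · rw [zpow_natCast, h1]
  · rw [zpow_neg, zpow_natCast, ← inv_pow, h2, neg_neg]

noncomputable def lφ : C[X] →+* LaurentSeries C := Polynomial.eval₂RingHom HahnSeries.C (lx C)

theorem lφ_C (c : C) : lφ C (Polynomial.C c) = HahnSeries.C c := by simp [lφ]
theorem lφ_X : lφ C X = lx C := by simp [lφ]

theorem lφ_coeff (q : C[X]) (t : ℤ) : (lφ C q).coeff t = if t ≤ 0 then q.coeff (-t).toNat else 0 := by
  induction q using Polynomial.induction_on' with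
  | add p q hp hq =>
    rw [map_add, HahnSeries.coeff_add, hp, hq]; split_ifs <;> simp
  | monomial k c =>
    rw [← Polynomial.C_mul_X_pow_eq_monomial, map_mul, map_pow, lφ_C, lφ_X, ← Units.val_pow_eq_pow_val, ← zpow_natCast, lx_zpow,
      HahnSeries.C_apply, HahnSeries.single_mul_single, Polynomial.coeff_C_mul_X_pow, HahnSeries.coeff_single]
    simp only [zero_add, mul_one]
    by_cases h : t = -(k:ℤ)
    · subst h; simp
    · rw [if_neg h]
      split_ifs with h1 h2
      · omega
      · rfl
      · rfl

theorem lω_coeff (s : PowerSeries C) (t : ℤ) : (HahnSeries.ofPowerSeries ℤ C s).coeff t = if t < 0 then 0 else PowerSeries.coeff t.natAbs s :=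
  PowerSeries.coeff_coe _ _

variable {C} {κ : Type*} [CommRing κ] 
def lmap (f : C →+* κ) : LaurentSeries C →+* LaurentSeries κ where
  toFun s := HahnSeries.map s f
  map_one' := HahnSeries.map_one f.toMonoidWithZeroHom
  map_zero' := HahnSeries.map_zero f.toMonoidWithZeroHom.toZeroHom
  map_mul' a b := HahnSeries.map_mul f.toNonUnitalRingHom
  map_add' a b := by ext t; simp

theorem lmap_coeff (f : C →+* κ) (s : LaurentSeries C) (t : ℤ) : (lmap f s).coeff t = f (s.coeff t) := rfl
end laurent

noncomputable def laurentSys (C : Type*) [CommRing C] [IsLocalRing C] : LSys C (LaurentSeries C) (LaurentSeries (IsLocalRing.ResidueField C)) where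
  φ := lφ C
  ω := HahnSeries.ofPowerSeries ℤ C
  ψ := lmap (IsLocalRing.residue C)
  x := lx C
  φX := lφ_X C
  ωX := HahnSeries.ofPowerSeries_X
  φC c := by rw [lφ_C, HahnSeries.ofPowerSeries_C]
  φinj := by
    intro p q h
    ext i
    have := congrArg (fun s : LaurentSeries C => s.coeff (-(i:ℤ))) h
    simpa [lφ_coeff] using this
  ωinj := HahnSeries.ofPowerSeries_injective
  φω := by
    intro q s h
    refine ⟨q.coeff 0, ?_⟩
    ext i
    rw [Polynomial.coeff_C]
    split_ifs with hi
    · rw [hi]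
    · have := congrArg (fun s : LaurentSeries C => s.coeff (-(i:ℤ))) h
      simp only [lφ_coeff, lω_coeff] at this
      rw [if_pos (by omega), if_pos (by omega)] at this
      simpa using this
  ψφ := by
    intro q h i
    have := congrArg (fun s : LaurentSeries _ => s.coeff (-(i:ℤ))) h
    simp only [lmap_coeff, lφ_coeff] at this
    rw [if_pos (by omega)] at this
    exact (IsLocalRing.residue_eq_zero_iff _).mp (by simpa using this)
  ψω := by
    intro q h i
    have := congrArg (fun s : LaurentSeries _ => s.coeff (i:ℤ)) h
    simp only [lmap_coeff, lω_coeff] at this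
    rw [if_neg (by omega)] at this
    exact (IsLocalRing.residue_eq_zero_iff _).mp (by simpa using this)
  ψC := by
    intro c hc
    ext t
    rw [lmap_coeff, lφ_coeff]
    split_ifs
    · rw [Polynomial.coeff_C]; split_ifs
      · simpa using (IsLocalRing.residue_eq_zero_iff _).mpr hc
      · simp
    · simp
  split := by
    intro b N
    obtain ⟨M, hM⟩ : ∃ M : ℕ, ∀ t : ℤ, t < -M → b.coeff t = 0 := by
      refine ⟨(-b.order).toNat, fun t ht => HahnSeries.coeff_eq_zero_of_lt_order ?_⟩
      omega
    refine ⟨Finset.Ioc (-N:ℤ) M, fun l => b.coeff (-l), PowerSeries.mk fun i => b.coeff (i + N), ?_, ?_⟩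
    · ext t
      rw [HahnSeries.coeff_add, HahnSeries.coeff_sum, lω_coeff]
      simp only [lφ_C, lx_zpow, HahnSeries.C_apply, HahnSeries.single_mul_single, zero_add, mul_one, HahnSeries.coeff_single]
      have e1 : ∑ l ∈ Finset.Ioc (-N:ℤ) M, (if t = -l then b.coeff (-l) else 0) = if t < N then b.coeff t else 0 := by
        have : ∀ l : ℤ, (if t = -l then b.coeff (-l) else 0) = if -t = l then b.coeff t else 0 := by
          intro l
          by_cases h : t = -l
          · subst h; simp
          · rw [if_neg h, if_neg (by omega)]
        simp only [this, Finset.sum_ite_eq, Finset.mem_Ioc]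
        by_cases h1 : t < N
        · rw [if_pos h1]
          split_ifs with h2
          · rfl
          · exact (hM t (by omega)).symm
        · rw [if_neg h1, if_neg (by omega)]
      refine Eq.trans ?_ (congrArg₂ (· + ·) (e1.symm.trans (Finset.sum_congr rfl fun l _ => by congr)) rfl)
      rw [PowerSeries.coeff_X_pow_mul']
      by_cases h1 : t < N
      · rw [if_pos h1]
        split_ifs with h2 h3
        · simp
        · omega
        · simp
      · rw [if_neg h1, if_neg (by omega), if_pos (by omega), PowerSeries.coeff_mk, zero_add]
        congr 1; omega
    · intro h
      have h' : ∀ t, b.coeff t ∈ IsLocalRing.maximalIdeal C := by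
        intro t
        have := congrArg (fun s : LaurentSeries _ => s.coeff t) h
        exact (IsLocalRing.residue_eq_zero_iff _).mp (by simpa [lmap_coeff] using this)
      refine ⟨fun l => h' _, ?_⟩
      ext t
      rw [lmap_coeff, lω_coeff]
      split_ifs
      · simp
      · simpa using (IsLocalRing.residue_eq_zero_iff _).mpr (h' _)
  surj := by
    classical
    intro f
    refine ⟨⟨fun t => Function.surjInv IsLocalRing.residue_surjective (f.coeff t) * if f.coeff t = 0 then 0 else 1, ?_⟩, ?_⟩
    · refine f.isPWO_support.mono ?_
      intro t ht
      simp only [Function.mem_support] at ht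
      rw [HahnSeries.mem_support]
      intro h0
      simp [h0] at ht
    · ext t
      rw [lmap_coeff]
      simp only [map_mul, Function.surjInv_eq]
      split_ifs with h
      · simp [h]
      · simp
  lift := by
    classical
    intro u
    have hf : (u : LaurentSeries (IsLocalRing.ResidueField C)) ≠ 0 := u.ne_zero
    generalize (u : LaurentSeries (IsLocalRing.ResidueField C)) = f at hf ⊢
    set b : LaurentSeries C := ⟨fun t => Function.surjInv IsLocalRing.residue_surjective (f.coeff t) * if f.coeff t = 0 then 0 else 1, by
      refine f.isPWO_support.mono ?_
      intro t ht
      simp only [Function.mem_support] at ht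
      rw [HahnSeries.mem_support]
      intro h0
      simp [h0] at ht⟩ with hb
    have hbc : ∀ t, b.coeff t = Function.surjInv IsLocalRing.residue_surjective (f.coeff t) * if f.coeff t = 0 then 0 else 1 := fun t => rfl
    have hbf : lmap (IsLocalRing.residue C) b = f := by
      ext t
      rw [lmap_coeff, hbc]
      simp only [map_mul, Function.surjInv_eq]
      split_ifs with h
      · simp [h]
      · simp
    have h1 : b.coeff f.order ≠ 0 := by
      intro h0
      have := lmap_coeff (IsLocalRing.residue C) b f.order
      rw [hbf, h0, map_zero] at this
      exact hf (HahnSeries.coeff_order_eq_zero.mp this)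
    have hb0 : b ≠ 0 := by
      intro h; rw [h] at h1; simp at h1
    have h2 : b.order = f.order := by
      apply le_antisymm (HahnSeries.order_le_of_coeff_ne_zero h1)
      by_contra hlt
      push Not at hlt
      have := mt HahnSeries.coeff_order_eq_zero.mp hb0
      rw [hbc, HahnSeries.coeff_eq_zero_of_lt_order hlt] at this
      simp at this
    have h3 : IsUnit b := by
      refine HahnSeries.isUnit_of_isUnit_leadingCoeff_AddUnitOrder ?_ (AddGroup.isAddUnit _)
      rw [HahnSeries.leadingCoeff_eq, h2]
      rw [← IsLocalRing.residue_ne_zero_iff_isUnit, ← lmap_coeff, hbf]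
      exact mt HahnSeries.coeff_order_eq_zero.mp hf
    exact ⟨h3.unit, hbf⟩
end BG

namespace BG
open Polynomial

section gen
variable {n : ℕ} {R L : Type*} [CommRing R] [CommRing L]

def ofMat (M : Matrix (Fin n) (Fin n) R) (h : M.det = 1) : SL n R := ⟨M, h⟩
theorem mat_ofMat (M : Matrix (Fin n) (Fin n) R) (h : M.det = 1) : mat (ofMat M h) = M := rfl

theorem lift_SL (f : R →+* L) (hf : Function.Injective f) (g : SL n L) (h : ∀ a b, ∃ m, f m = mat g a b) :
    ∃ g' : SL n R, mp f g' = g := by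
  choose M hM using h
  have hd : (Matrix.of M).det = 1 := by
    apply hf
    rw [RingHom.map_det, map_one, ← mat_det g]
    congr 1
    ext a b
    exact hM a b
  refine ⟨ofMat (Matrix.of M) hd, mat_ext fun a b => ?_⟩
  rw [mp_apply, mat_ofMat]
  exact hM a b

noncomputable def Dc (e : Fin n → Lˣ) : SL n L →* SL n L where
  toFun g := ofMat (Matrix.diagonal (fun a => (e a : L)) * mat g * Matrix.diagonal (fun a => ((e a)⁻¹ : Lˣ) : Fin n → L)) (by
    rw [Matrix.det_mul, Matrix.det_mul, Matrix.det_diagonal, Matrix.det_diagonal, mat_det, mul_one, ← Finset.prod_mul_distrib]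
    simp)
  map_one' := by
    apply mat_inj
    rw [mat_ofMat, mat_one, mul_one, Matrix.diagonal_mul_diagonal]
    simp
  map_mul' g h := by
    apply mat_inj
    rw [mat_ofMat, mat_mul, mat_mul, mat_ofMat, mat_ofMat]
    have : Matrix.diagonal (fun a => ((e a)⁻¹ : Lˣ) : Fin n → L) * Matrix.diagonal (fun a => (e a : L)) = 1 := by
      rw [Matrix.diagonal_mul_diagonal]; simp
    calc _ = Matrix.diagonal (fun a => (e a : L)) * mat g * 1 * (mat h * Matrix.diagonal (fun a => ((e a)⁻¹ : Lˣ) : Fin n → L)) := by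
          simp only [mul_one, mul_assoc]
      _ = _ := by rw [← this]; simp only [mul_assoc]

theorem Dc_apply (e : Fin n → Lˣ) (g : SL n L) (a b : Fin n) : mat (Dc e g) a b = e a * mat g a b * ((e b)⁻¹ : Lˣ) := by
  change (Matrix.diagonal (fun a => (e a : L)) * mat g * Matrix.diagonal (fun a => ((e a)⁻¹ : Lˣ) : Fin n → L)) a b = _
  rw [Matrix.mul_diagonal, Matrix.diagonal_mul]

theorem Dc_mul (e e' : Fin n → Lˣ) (g : SL n L) : Dc (e * e') g = Dc e (Dc e' g) := by
  apply mat_ext; intro a b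
  simp only [Dc_apply, Pi.mul_apply, mul_inv_rev, Units.val_mul]; ring

theorem Dc_const (u : Lˣ) (g : SL n L) : Dc (fun _ => u) g = g := by
  apply mat_ext; intro a b
  rw [Dc_apply, mul_comm, ← mul_assoc]; simp

theorem Dc_one (g : SL n L) : Dc 1 g = g := Dc_const 1 g

theorem Dc_tv (e : Fin n → Lˣ) {i j : Fin n} (h : i ≠ j) (r : L) :
    Dc e (tv i j r) = tv i j (e i * r * ((e j)⁻¹ : Lˣ)) := by
  apply mat_ext; intro a b
  rw [Dc_apply, tv_apply h, tv_apply h]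
  by_cases hab : a = b
  · subst hab
    have : ¬ (i = a ∧ j = a) := by rintro ⟨rfl, rfl⟩; exact h rfl
    simp [this]
  · by_cases h2 : i = a ∧ j = b
    · obtain ⟨rfl, rfl⟩ := h2; simp [h]
    · simp [hab, h2]

theorem Dc_map {K : Type*} [CommRing K] (ψ : L →+* K) (e : Fin n → Lˣ) (g : SL n L) (h : mp ψ g = 1) : mp ψ (Dc e g) = 1 := by
  apply mat_ext; intro a b
  have := congrArg (fun g => mat g a b) h
  simp only [mp_apply, mat_one_apply] at this
  rw [mp_apply, Dc_apply, map_mul, map_mul, this, mat_one_apply]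
  split_ifs with hab
  · subst hab
    rw [mul_one, ← map_mul]; simp
  · simp

theorem tor_w {a b : Fin n} (hab : a ≠ b) (u : Lˣ) (g : SL n L) (q : Fin n) :
    mat ((tvSys n L).w a b u * g) a q = u * mat g b q ∧ mat ((tvSys n L).w a b u * g) b q = - ↑u⁻¹ * mat g a q ∧
     ∀ p, p ≠ a → p ≠ b → mat ((tvSys n L).w a b u * g) p q = mat g p q := by
  simp only [StSys.w, tvSys, mul_assoc]
  have hu : (u:L) * ((u⁻¹ : Lˣ) : L) = 1 := by simp
  refine ⟨?_, ?_, ?_⟩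
  · simp only [tv_mul_apply hab, tv_mul_apply hab.symm, hab, hab.symm, if_true, if_false, add_zero]
    linear_combination (- mat g a q - u * mat g b q) * hu
  · simp only [tv_mul_apply hab, tv_mul_apply hab.symm, hab, hab.symm, if_true, if_false, add_zero]
    linear_combination (- mat g b q) * hu
  · intro p h1 h2
    simp [tv_mul_apply hab, tv_mul_apply hab.symm, h1, h2]

theorem tor_h {a b : Fin n} (hab : a ≠ b) (u : Lˣ) (g : SL n L) (q : Fin n) :
    mat ((tvSys n L).h a b u * g) a q = u * mat g a q ∧ mat ((tvSys n L).h a b u * g) b q = ↑u⁻¹ * mat g b q ∧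
     ∀ p, p ≠ a → p ≠ b → mat ((tvSys n L).h a b u * g) p q = mat g p q := by
  obtain ⟨h1, h2, h3⟩ := tor_w hab (-1) g q
  simp only [StSys.h, mul_assoc]
  obtain ⟨h1', h2', h3'⟩ := tor_w hab u ((tvSys n L).w a b (-1) * g) q
  refine ⟨?_, ?_, ?_⟩
  · rw [h1', h2]; simp
  · rw [h2', h1]; simp
  · intro p hp1 hp2; rw [h3' p hp1 hp2, h3 p hp1 hp2]

theorem tor_mul {a b : Fin n} (hab : a ≠ b) (u v : Lˣ) :
    (tvSys n L).h a b u * (tvSys n L).h a b v = (tvSys n L).h a b (u * v) := by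
  apply mat_ext; intro p q
  rw [← mul_one ((tvSys n L).h a b (u * v)), ← mul_one ((tvSys n L).h a b v)]
  obtain ⟨a1, a2, a3⟩ := tor_h hab u ((tvSys n L).h a b v * 1) q
  obtain ⟨b1, b2, b3⟩ := tor_h hab v 1 q
  obtain ⟨c1, c2, c3⟩ := tor_h hab (u * v) 1 q
  by_cases h1 : p = a
  · subst h1; rw [a1, b1, c1, Units.val_mul, mul_assoc]
  by_cases h2 : p = b
  · subst h2; rw [a2, b2, c2, mul_inv_rev, Units.val_mul]; ring
  rw [a3 p h1 h2, b3 p h1 h2, c3 p h1 h2]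

theorem StSys.desc_w {Γ : Type*} [Group Γ] {S : StSys n L Γ} {S' : StSys n R Γ} {f : L →+* R}
    (hS : ∀ i j, i ≠ j → ∀ a, S'.x i j (f a) = S.x i j a) {i j : Fin n} (hij : i ≠ j) (u : Lˣ) (v : Rˣ) (hv : (v:R) = f u) :
    S'.w i j v = S.w i j u := by
  have : v = Units.map (f : L →* R) u := by ext; simpa using hv
  subst this
  simp only [StSys.w]
  rw [← hS i j hij, ← hS j i hij.symm, ← map_inv]
  simp

theorem StSys.desc_h {Γ : Type*} [Group Γ] {S : StSys n L Γ} {S' : StSys n R Γ} {f : L →+* R}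
    (hS : ∀ i j, i ≠ j → ∀ a, S'.x i j (f a) = S.x i j a) {i j : Fin n} (hij : i ≠ j) (u : Lˣ) (v : Rˣ) (hv : (v:R) = f u) :
    S'.h i j v = S.h i j u := by
  rw [StSys.h, StSys.h, StSys.desc_w hS hij u v hv, StSys.desc_w hS hij (-1) (-1) (by simp)]

def EtvSys (n : ℕ) (A : Type*) [CommRing A] : StSys n A (E n A) where
  x i j a := ⟨tv i j a, tv_mem i j a⟩
  add i j _ a b := Subtype.ext (tv_add i j a b)
  c1 _ _ _ h1 h2 h3 a b := Subtype.ext (tv_c1 h1 h2 h3 a b)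
  c2 _ _ _ _ h1 h2 h3 h4 a b := Subtype.ext (tv_c2 h1 h2 h3 h4 a b)

theorem Etor_mul {a b : Fin n} (hab : a ≠ b) (u v : Lˣ) :
    (EtvSys n L).h a b u * (EtvSys n L).h a b v = (EtvSys n L).h a b (u * v) :=
  Subtype.ext (tor_mul hab u v)

end gen
end BG

namespace BG
open Polynomial

namespace LSys
variable {n : ℕ} {C L K : Type} [CommRing C] [IsLocalRing C] [CommRing L] [Field K] (T : LSys C L K)

/-- the set of factorisable elements -/
def Z (n : ℕ) : Set (SL n L) := {z | ∃ p ∈ E n C[X], ∃ v : SL n (PowerSeries C), mp T.ψ (mp T.φ p) = 1 ∧ mp T.ψ (mp T.ω v) = 1 ∧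
  z = mp T.φ p * mp T.ω v}

theorem one_mem_Z : (1 : SL n L) ∈ T.Z n := ⟨1, one_mem _, 1, by simp, by simp, by simp⟩

theorem const_eq (α : SL n C) : mp T.φ (mp (Polynomial.C : C →+* C[X]) α) = mp T.ω (mp (PowerSeries.C : C →+* PowerSeries C) α) := by
  apply mat_ext; intro a b
  simp only [mp_apply, T.φC]

theorem res_entry {R : Type} [CommRing R] (f : L →+* R) {g : SL n L} (h : mp f g = 1) (a b : Fin n) : f (mat g a b - (if a = b then 1 else 0)) = 0 := by
  have := congrArg (fun g => mat g a b) h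
  simp only [mp_apply, mat_one_apply] at this
  rw [map_sub, this]; split_ifs <;> simp

theorem res_one_iff {R S : Type} [CommRing R] [CommRing S] (f : R →+* S) {g : SL n R} (h : ∀ a b, f (mat g a b - (if a = b then 1 else 0)) = 0) : mp f g = 1 := by
  apply mat_ext; intro a b
  have := h a b
  rw [map_sub, sub_eq_zero] at this
  rw [mp_apply, this, mat_one_apply]; split_ifs <;> simp

theorem res1 {p : SL n C[X]} (h : mp T.ψ (mp T.φ p) = 1) : mp (IsLocalRing.residue C) (mp (evalRingHom 0) p) = 1 := by
  rw [mp_comp] at h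
  apply res_one_iff
  intro a b
  have h1 := congrArg (fun g => mat g a b) h
  simp only [mp_apply, mat_one_apply, RingHom.comp_apply] at h1
  have := T.ψφ (mat p a b - (if a = b then 1 else 0)) (by
    rw [map_sub, map_sub, h1]; split_ifs <;> simp) 0
  rw [IsLocalRing.residue_eq_zero_iff]
  convert this using 1
  rw [mp_apply, coe_evalRingHom, coeff_sub, coeff_zero_eq_eval_zero]
  split_ifs <;> simp

theorem res2 {v : SL n (PowerSeries C)} (h : mp T.ψ (mp T.ω v) = 1) :
    mp (IsLocalRing.residue C) (mp (PowerSeries.constantCoeff : PowerSeries C →+* C) v) = 1 := by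
  rw [mp_comp] at h
  apply res_one_iff
  intro a b
  have h1 := congrArg (fun g => mat g a b) h
  simp only [mp_apply, mat_one_apply, RingHom.comp_apply] at h1
  have := T.ψω (mat v a b - (if a = b then 1 else 0)) (by
    rw [map_sub, map_sub, h1]; split_ifs <;> simp) 0
  rw [IsLocalRing.residue_eq_zero_iff]
  convert this using 1
  rw [mp_apply, PowerSeries.coeff_zero_eq_constantCoeff_apply, map_sub]
  split_ifs <;> simp

theorem res3 {α : SL n C} (h : mp (IsLocalRing.residue C) α = 1) : mp T.ψ (mp T.φ (mp (Polynomial.C : C →+* C[X]) α)) = 1 := by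
  rw [mp_comp]
  apply res_one_iff
  intro a b
  have h1 := congrArg (fun g => mat g a b) h
  simp only [mp_apply, mat_one_apply] at h1
  have := T.ψC (mat α a b - (if a = b then 1 else 0)) (by
    rw [← IsLocalRing.residue_eq_zero_iff, map_sub, h1]; split_ifs <;> simp)
  rw [← this, mp_apply, RingHom.comp_apply]
  simp only [map_sub]
  split_ifs <;> simp

theorem delta_P (hn : 3 ≤ n) (k : Fin n) {p : SL n C[X]} (hp : p ∈ E n C[X]) (h0 : mp (evalRingHom 0) p = 1) :
    ∃ p' ∈ E n C[X], mp T.φ p' = Dc (Pi.mulSingle k T.x) (mp T.φ p) := by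
  have hφd : ∀ a, T.φ (dX k a) = ((Pi.mulSingle k T.x : Fin n → Lˣ) a : L) := by
    intro a
    by_cases h : a = k
    · subst h; simp [dX, T.φX]
    · simp [dX, h]
  have hX : ∀ a b, ∃ m, dX k a * mat p a b = m * dX k b := by
    intro a b
    by_cases hb : b = k
    · subst hb
      by_cases ha : a = b
      · subst ha; exact ⟨_, mul_comm _ _⟩
      · have : (X : C[X]) ∣ mat p a b := by
          rw [X_dvd_iff, coeff_zero_eq_eval_zero]
          have h1 := congrArg (fun g => mat g a b) h0
          simpa only [mp_apply, mat_one_apply, if_neg ha, coe_evalRingHom] using h1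
        obtain ⟨m, hm⟩ := this
        exact ⟨m, by simp [dX, ha, hm, mul_comm]⟩
    · exact ⟨dX k a * mat p a b, by simp [dX, hb]⟩
  have key : ∀ a b m, dX k a * mat p a b = m * dX k b ↔ T.φ m = mat (Dc (Pi.mulSingle k T.x) (mp T.φ p)) a b := by
    intro a b m
    rw [Dc_apply, mp_apply, Units.eq_mul_inv_iff_mul_eq, ← hφd, ← hφd, ← map_mul, ← map_mul]
    exact ⟨fun h => by rw [h], fun h => (T.φinj h).symm⟩
  obtain ⟨p', hp'⟩ := lift_SL T.φ T.φinj (Dc (Pi.mulSingle k T.x) (mp T.φ p)) (fun a b => by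
    obtain ⟨m, hm⟩ := hX a b
    exact ⟨m, (key a b m).mp hm⟩)
  refine ⟨p', delta_mem hn k hp h0 ?_, hp'⟩
  ext1 a b
  rw [Matrix.diagonal_mul, Matrix.mul_diagonal]
  apply (key a b _).mpr
  rw [← hp', mp_apply]

theorem delta_V (k : Fin n) {v : SL n (PowerSeries C)} (h0 : ∀ b, b ≠ k → PowerSeries.constantCoeff (mat v k b) = 0) :
    ∃ v' : SL n (PowerSeries C), mp T.ω v' = Dc (Pi.mulSingle k T.x) (mp T.ω v) := by
  refine lift_SL T.ω T.ωinj _ (fun a b => ?_)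
  rw [Dc_apply, mp_apply]
  by_cases ha : a = k
  · subst ha
    by_cases hb : b = a
    · subst hb
      refine ⟨mat v b b, ?_⟩
      rw [mul_comm, ← mul_assoc]; simp
    · obtain ⟨m, hm⟩ := PowerSeries.X_dvd_iff.mpr (h0 b hb)
      refine ⟨m, ?_⟩
      rw [hm, map_mul, T.ωX]
      simp [hb]
  · by_cases hb : b = k
    · subst hb
      refine ⟨mat v a b * PowerSeries.X, ?_⟩
      rw [map_mul, T.ωX]
      simp [ha]
    · exact ⟨mat v a b, by simp [ha, hb]⟩

/-- stability of `Z` under conjugation by `diag(1,…,x,…,1)` -/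
theorem delta_Z (hn : 3 ≤ n) (k : Fin n) {z : SL n L} (hz : z ∈ T.Z n) : Dc (Pi.mulSingle k T.x) z ∈ T.Z n := by
  obtain ⟨p, hp, v, hp1, hv1, rfl⟩ := hz
  set α : SL n C := mp (evalRingHom 0) p with hα
  have hαE : α ∈ E n C := mp_mem _ hp
  have hα1 := T.res1 hp1
  rw [← hα] at hα1
  have hα2 := T.res3 hα1
  set p₁ : SL n C[X] := p * (mp (Polynomial.C : C →+* C[X]) α)⁻¹ with hp₁
  have hp₁E : p₁ ∈ E n C[X] := mul_mem hp (inv_mem (mp_mem _ hαE))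
  have hp₁0 : mp (evalRingHom 0) p₁ = 1 := by
    have e1 : mp (evalRingHom (0:C)) p₁ = mp (evalRingHom 0) p * (mp (evalRingHom 0) (mp (Polynomial.C : C →+* C[X]) α))⁻¹ := by
      rw [hp₁]; exact (map_mul _ _ _).trans (congrArg _ (map_inv _ _))
    have e2 : mp (evalRingHom 0) (mp (Polynomial.C : C →+* C[X]) α) = α := by
      apply mat_ext; intro a b; simp [mp_apply]
    rw [e1, e2, ← hα, mul_inv_cancel]
  have hp₁1 : mp T.ψ (mp T.φ p₁) = 1 := by
    rw [hp₁, map_mul, map_mul, hp1, map_inv, map_inv, hα2]; simp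
  set v₁ : SL n (PowerSeries C) := mp (PowerSeries.C : C →+* PowerSeries C) α * v with hv₁
  have hv₁1 : mp T.ψ (mp T.ω v₁) = 1 := by
    rw [hv₁, map_mul, map_mul, hv1, ← T.const_eq, hα2, one_mul]
  have ez : mp T.φ p * mp T.ω v = mp T.φ p₁ * mp T.ω v₁ := by
    rw [hp₁, hv₁, map_mul, map_mul, ← T.const_eq, map_inv]; group
  have hb := T.res2 hv₁1
  set b : SL n C := mp (PowerSeries.constantCoeff : PowerSeries C →+* C) v₁ with hbdef
  have hb' : mp (IsLocalRing.residue C) b⁻¹ = 1 := by rw [map_inv, hb, inv_one]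
  have hbe : ∀ j, IsLocalRing.residue C (mat b⁻¹ k j) = if k = j then 1 else 0 := by
    intro j
    rw [← mp_apply, hb', mat_one_apply]
  obtain ⟨t, ht⟩ : IsUnit (mat b⁻¹ k k) := by
    rw [← IsLocalRing.residue_ne_zero_iff_isUnit, hbe]; simp
  set m : Fin n → C := fun j => if j = k then 0 else ((t⁻¹ : Cˣ) : C) * mat b⁻¹ k j with hm
  have hmk : m k = 0 := by simp [hm]
  have hmm : ∀ j, IsLocalRing.residue C (m j) = 0 := by
    intro j
    simp only [hm]
    split_ifs with h
    · simp
    · rw [map_mul, hbe, if_neg (Ne.symm h), mul_zero]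
  obtain ⟨c, hc, hcm⟩ := rowE k m hmk
  obtain ⟨c', hc', hcm'⟩ := rowE (R := C[X]) k (fun j => X * Polynomial.C (m j)) (by simp [hmk])
  have hca : ∀ a b, mat c a b = (if a = b then 1 else 0) + if a = k then m b else 0 := by
    intro a b
    rw [hcm, Matrix.add_apply, Matrix.one_apply, Matrix.vecMulVec_apply, Pi.single_apply]
    simp
  have hca' : ∀ a b, mat c' a b = (if a = b then 1 else 0) + if a = k then X * Polynomial.C (m b) else 0 := by
    intro a b
    rw [hcm', Matrix.add_apply, Matrix.one_apply, Matrix.vecMulVec_apply, Pi.single_apply]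
    simp
  have hcr : mp (IsLocalRing.residue C) c = 1 := by
    apply res_one_iff; intro a b
    rw [hca, add_sub_cancel_left]; split_ifs <;> simp [hmm]
  have hcr2 := T.res3 hcr
  have hDc : Dc (Pi.mulSingle k T.x) (mp T.φ (mp (Polynomial.C : C →+* C[X]) c)) = mp T.φ c' := by
    apply mat_ext; intro a b
    rw [Dc_apply, mp_apply, mp_apply, mp_apply, hca, hca']
    by_cases ha : a = k
    · subst ha
      by_cases hb : b = a
      · subst hb
        simp [hmk]
      · simp [hb, Ne.symm hb, T.φX]; exact mul_comm _ _
    · by_cases hb : b = k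
      · subst hb
        simp [ha]
      · simp only [if_neg ha, Pi.mulSingle_eq_of_ne ha, Pi.mulSingle_eq_of_ne hb]
        split_ifs <;> simp
  obtain ⟨q, hqE, hq⟩ := T.delta_P hn k hp₁E hp₁0
  obtain ⟨v', hv'⟩ := T.delta_V k (v := mp (PowerSeries.C : C →+* PowerSeries C) c * v₁) (by
    intro j hj
    have e1 : PowerSeries.constantCoeff (mat (mp (PowerSeries.C : C →+* PowerSeries C) c * v₁) k j) = mat (c * b) k j := by
      rw [mat_mul_apply, mat_mul_apply, map_sum]
      refine Finset.sum_congr rfl fun l _ => ?_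
      rw [map_mul, mp_apply, hbdef, mp_apply]; simp
    have e2 : ∀ l, mat c k l = ((t⁻¹ : Cˣ) : C) * mat b⁻¹ k l := by
      intro l
      rw [hca]
      by_cases hl : l = k
      · subst hl; simp [hmk, ← ht]
      · simp [hm, hl, Ne.symm hl]
    rw [e1, mat_mul_apply]
    simp only [e2, mul_assoc]
    rw [← Finset.mul_sum, ← mat_mul_apply, inv_mul_cancel, mat_one_apply, if_neg (Ne.symm hj), mul_zero])
  have e3 : Dc (Pi.mulSingle k T.x) (mp T.φ p * mp T.ω v) = mp T.φ (q * c'⁻¹) * mp T.ω v' := by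
    clear_value p₁ v₁
    rw [ez, map_mul (mp T.φ) q, map_inv, hq, hv', ← hDc, ← map_inv (Dc _), ← map_mul, ← map_mul]
    congr 1
    rw [map_mul (mp T.ω), ← T.const_eq]; group
  refine ⟨q * c'⁻¹, mul_mem hqE (inv_mem hc'), v', ?_, ?_, e3⟩
  · rw [map_mul (mp T.φ), map_inv, hq, ← hDc, ← map_inv (Dc _), ← map_mul]
    apply Dc_map
    rw [map_mul, hp₁1, map_inv, hcr2]; simp
  · rw [hv']
    apply Dc_map
    rw [map_mul, map_mul, ← T.const_eq, hcr2, hv₁1, one_mul]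

end LSys
end BG

namespace BG
open Polynomial

namespace LSys
variable {n : ℕ} {C L K : Type} [CommRing C] [IsLocalRing C] [CommRing L] [Field K] (T : LSys C L K)

/-- diagonal units preserving `Z` -/
def ZS (n : ℕ) : Submonoid (Fin n → Lˣ) where
  carrier := {e | ∀ z ∈ T.Z n, Dc e z ∈ T.Z n}
  one_mem' := fun z hz => by rw [Dc_one]; exact hz
  mul_mem' := fun {e e'} h h' z hz => by rw [Dc_mul]; exact h _ (h' _ hz)

theorem ZS_inv (hn : 3 ≤ n) (k : Fin n) : Pi.mulSingle k T.x⁻¹ ∈ T.ZS n := by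
  have h1 : ∀ j, Pi.mulSingle j T.x ∈ T.ZS n := fun j z hz => T.delta_Z hn j hz
  have h2 : (fun _ => T.x⁻¹ : Fin n → Lˣ) ∈ T.ZS n := fun z hz => by rw [Dc_const]; exact hz
  have h3 : (∏ j ∈ Finset.univ.erase k, Pi.mulSingle j T.x : Fin n → Lˣ) ∈ T.ZS n := prod_mem fun j _ => h1 j
  have := mul_mem h2 h3
  convert this using 1
  funext a
  have e : (∏ j : Fin n, (Pi.mulSingle j T.x : Fin n → Lˣ)) a = T.x := by
    rw [Finset.prod_apply]
    rw [Finset.prod_eq_single a]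
    · simp
    · intro b _ hb; exact Pi.mulSingle_eq_of_ne (Ne.symm hb) _
    · simp
  rw [← Finset.mul_prod_erase Finset.univ _ (Finset.mem_univ k), Pi.mul_apply] at e
  rw [Pi.mul_apply]
  by_cases ha : a = k
  · subst ha
    rw [Pi.mulSingle_eq_same] at e ⊢
    rw [mul_eq_left.mp e, mul_one]
  · rw [Pi.mulSingle_eq_of_ne ha, one_mul] at e
    rw [Pi.mulSingle_eq_of_ne ha, e, inv_mul_cancel]

theorem ZS_zpow (hn : 3 ≤ n) (k : Fin n) (l : ℤ) : Pi.mulSingle k (T.x ^ l) ∈ T.ZS n := by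
  obtain ⟨m, rfl | rfl⟩ := l.eq_nat_or_neg
  · rw [zpow_natCast, Pi.mulSingle_pow]
    exact pow_mem (show Pi.mulSingle k T.x ∈ T.ZS n from fun z hz => T.delta_Z hn k hz) m
  · rw [zpow_neg, zpow_natCast, ← inv_pow, Pi.mulSingle_pow]
    exact pow_mem (T.ZS_inv hn k) m

/-- conjugation stabiliser -/
def CZ (n : ℕ) : Submonoid (SL n L) where
  carrier := {t | ∀ z ∈ T.Z n, t * z * t⁻¹ ∈ T.Z n}
  one_mem' := fun z hz => by simpa using hz
  mul_mem' := fun {t t'} h h' z hz => by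
    have := h _ (h' z hz)
    convert this using 1; group

/-- left multiplication stabiliser -/
def MZ (n : ℕ) : Submonoid (SL n L) where
  carrier := {t | ∀ z ∈ T.Z n, t * z ∈ T.Z n}
  one_mem' := fun z hz => by simpa using hz
  mul_mem' := fun {t t'} h h' z hz => by
    have := h _ (h' z hz)
    rwa [mul_assoc]

theorem CZ_const {e : SL n C} (he : e ∈ E n C) : mp T.φ (mp (Polynomial.C : C →+* C[X]) e) ∈ T.CZ n := by
  rintro z ⟨p, hp, v, h1, h2, rfl⟩
  set e1 := mp (Polynomial.C : C →+* C[X]) e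
  set e2 := mp (PowerSeries.C : C →+* PowerSeries C) e
  have he1 : e1 ∈ E n C[X] := mp_mem _ he
  refine ⟨e1 * p * e1⁻¹, mul_mem (mul_mem he1 hp) (inv_mem he1), e2 * v * e2⁻¹, ?_, ?_, ?_⟩
  · simp only [map_mul, h1, map_inv]; simp
  · simp only [map_mul, h2, map_inv]; simp
  · have : mp T.φ e1 = mp T.ω e2 := T.const_eq e
    simp only [map_mul, map_inv, this]; group

theorem Dc_inv_cancel (e : Fin n → Lˣ) (z : SL n L) : Dc e (Dc e⁻¹ z) = z := by
  rw [← Dc_mul, mul_inv_cancel, Dc_one]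

theorem CZ_Dc {e : Fin n → Lˣ} (h1 : e ∈ T.ZS n) (h2 : e⁻¹ ∈ T.ZS n) {t : SL n L} (ht : t ∈ T.CZ n) : Dc e t ∈ T.CZ n := by
  intro z hz
  have := h1 _ (ht _ (h2 z hz))
  rwa [map_mul, map_mul, Dc_inv_cancel, map_inv] at this

theorem MZ_Dc {e : Fin n → Lˣ} (h1 : e ∈ T.ZS n) (h2 : e⁻¹ ∈ T.ZS n) {t : SL n L} (ht : t ∈ T.MZ n) : Dc e t ∈ T.MZ n := by
  intro z hz
  have := h1 _ (ht _ (h2 z hz))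
  rwa [map_mul, Dc_inv_cancel] at this

theorem tv_xl {i j : Fin n} (hij : i ≠ j) (c : C) (l : ℤ) :
    tv i j (T.φ (Polynomial.C c) * (T.x ^ l : Lˣ)) = Dc (Pi.mulSingle i (T.x ^ l)) (mp T.φ (mp (Polynomial.C : C →+* C[X]) (tv i j c))) := by
  rw [mp_tv, mp_tv, Dc_tv _ hij, Pi.mulSingle_eq_same, Pi.mulSingle_eq_of_ne hij.symm]
  simp only [inv_one, Units.val_one, mul_one]
  rw [mul_comm]

theorem ZS_zpow_inv (hn : 3 ≤ n) (k : Fin n) (l : ℤ) : (Pi.mulSingle k (T.x ^ l) : Fin n → Lˣ)⁻¹ ∈ T.ZS n := by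
  rw [← Pi.mulSingle_inv, ← zpow_neg]; exact T.ZS_zpow hn k _

theorem CZ_xl (hn : 3 ≤ n) {i j : Fin n} (hij : i ≠ j) (c : C) (l : ℤ) : tv i j (T.φ (Polynomial.C c) * (T.x ^ l : Lˣ)) ∈ T.CZ n := by
  rw [T.tv_xl hij]
  exact T.CZ_Dc (T.ZS_zpow hn i l) (T.ZS_zpow_inv hn i l) (T.CZ_const (tv_mem _ _ _))

theorem MZ_xl (hn : 3 ≤ n) {i j : Fin n} (hij : i ≠ j) (c : C) (hc : c ∈ IsLocalRing.maximalIdeal C) (l : ℤ) :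
    tv i j (T.φ (Polynomial.C c) * (T.x ^ l : Lˣ)) ∈ T.MZ n := by
  rw [T.tv_xl hij]
  refine T.MZ_Dc (T.ZS_zpow hn i l) (T.ZS_zpow_inv hn i l) ?_
  rintro z ⟨p, hp, v, h1, h2, rfl⟩
  refine ⟨mp (Polynomial.C : C →+* C[X]) (tv i j c) * p, mul_mem (mp_mem _ (tv_mem _ _ _)) hp, v, ?_, h2, ?_⟩
  · rw [map_mul, map_mul, h1, mul_one, mp_tv, mp_tv, mp_tv, T.ψC c hc, tv_zero]
  · rw [map_mul, mul_assoc]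

theorem sum_mem (M : Submonoid (SL n L)) (i j : Fin n) (s : Finset ℤ) (f : ℤ → L) (h : ∀ l ∈ s, tv i j (f l) ∈ M) : tv i j (∑ l ∈ s, f l) ∈ M := by
  induction s using Finset.induction_on with
  | empty => simp
  | insert a s ha ih =>
    rw [Finset.sum_insert ha, tv_add]
    exact mul_mem (h a (by simp)) (ih fun l hl => h l (by simp [hl]))

theorem poly_ω (q : C[X]) (N : ℕ) (hN : q.natDegree ≤ N) (τ : PowerSeries C) : ∃ σ, T.ω σ = T.φ q * T.ω (PowerSeries.X ^ N * τ) := by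
  refine ⟨(∑ i ∈ Finset.range (q.natDegree + 1), PowerSeries.C (q.coeff i) * PowerSeries.X ^ (N - i)) * τ, ?_⟩
  rw [map_mul, map_mul, ← mul_assoc]
  congr 1
  conv_rhs => rw [q.as_sum_range_C_mul_X_pow]
  rw [map_sum, map_sum, Finset.sum_mul]
  refine Finset.sum_congr rfl fun i hi => ?_
  have hi' : i ≤ N := by
    have := Finset.mem_range.mp hi; omega
  rw [map_mul, map_mul, ← T.φC, mul_assoc]
  congr 1
  rw [map_pow, map_pow, map_pow, T.φX, T.ωX]
  have : ((T.x⁻¹ : Lˣ) : L) ^ N = ((T.x⁻¹ : Lˣ) : L) ^ i * ((T.x⁻¹ : Lˣ) : L) ^ (N - i) := by rw [← pow_add]; congr 1; omega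
  rw [this, ← mul_assoc, ← mul_pow]; simp

theorem conj_ω (p : SL n C[X]) {i j : Fin n} (hij : i ≠ j) : ∃ N, ∀ τ, ∃ w : SL n (PowerSeries C),
    mp T.ω w = (mp T.φ p)⁻¹ * tv i j (T.ω (PowerSeries.X ^ N * τ)) * mp T.φ p := by
  refine ⟨∑ a, ∑ b, (mat p⁻¹ a i * mat p j b).natDegree, fun τ => lift_SL T.ω T.ωinj _ fun a b => ?_⟩
  set N := ∑ a, ∑ b, (mat p⁻¹ a i * mat p j b).natDegree with hN
  have hle : (mat p⁻¹ a i * mat p j b).natDegree ≤ N := by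
    refine le_trans ?_ (Finset.single_le_sum (f := fun a => ∑ b, (mat p⁻¹ a i * mat p j b).natDegree) (fun _ _ => Nat.zero_le _) (Finset.mem_univ a))
    exact Finset.single_le_sum (f := fun b => (mat p⁻¹ a i * mat p j b).natDegree) (fun _ _ => Nat.zero_le _) (Finset.mem_univ b)
  obtain ⟨σ, hσ⟩ := T.poly_ω _ N hle τ
  refine ⟨(if a = b then 1 else 0) + σ, ?_⟩
  set s := T.ω (PowerSeries.X ^ N * τ)
  rw [map_add, hσ]
  have e1 : mat ((mp T.φ p)⁻¹ * tv i j s * mp T.φ p) a b = mat ((mp T.φ p)⁻¹ * mp T.φ p) a b + mat (mp T.φ p)⁻¹ a i * s * mat (mp T.φ p) j b := by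
    rw [mat_mul_apply, mat_mul_apply]
    simp only [mul_tv_apply hij, add_mul, Finset.sum_add_distrib]
    congr 1
    simp [ite_mul]
    ring
  rw [e1, inv_mul_cancel, mat_one_apply, ← map_inv, mp_apply, mp_apply, map_mul]
  split_ifs <;> simp <;> ring

theorem CZ_tv (hn : 3 ≤ n) {i j : Fin n} (hij : i ≠ j) (b : L) : tv i j b ∈ T.CZ n := by
  rintro z ⟨p, hp, v, h1, h2, rfl⟩
  obtain ⟨N, hN⟩ := T.conj_ω p hij
  obtain ⟨s, c, τ, hb, -⟩ := T.split b N
  obtain ⟨w, hw⟩ := hN τ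
  have key : tv i j (T.ω (PowerSeries.X ^ N * τ)) * (mp T.φ p * mp T.ω v) * (tv i j (T.ω (PowerSeries.X ^ N * τ)))⁻¹ ∈ T.Z n := by
    refine ⟨p, hp, w * v * (tv i j (PowerSeries.X ^ N * τ))⁻¹, h1, ?_, ?_⟩
    · simp only [map_mul (mp T.ω), hw, map_mul (mp T.ψ), h1, h2, map_inv, mp_tv]; simp
    · rw [map_mul (mp T.ω), map_mul (mp T.ω), hw, map_inv, mp_tv]; group
  have := sum_mem (T.CZ n) i j s _ (fun l _ => T.CZ_xl hn hij (c l) l) _ key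
  rw [hb, tv_add]
  convert this using 1
  group

theorem MZ_tv (hn : 3 ≤ n) {i j : Fin n} (hij : i ≠ j) (b : L) (hψ : T.ψ b = 0) : tv i j b ∈ T.MZ n := by
  rintro z ⟨p, hp, v, h1, h2, rfl⟩
  obtain ⟨N, hN⟩ := T.conj_ω p hij
  obtain ⟨s, c, τ, hb, h0⟩ := T.split b N
  obtain ⟨hc, hτ⟩ := h0 hψ
  obtain ⟨w, hw⟩ := hN τ
  have key : tv i j (T.ω (PowerSeries.X ^ N * τ)) * (mp T.φ p * mp T.ω v) ∈ T.Z n := by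
    refine ⟨p, hp, w * v, h1, ?_, ?_⟩
    · simp only [map_mul (mp T.ω), hw, map_mul (mp T.ψ), h1, h2, map_inv, mp_tv, map_mul, hτ]; simp
    · rw [map_mul (mp T.ω), hw]; group
  have := sum_mem (T.MZ n) i j s _ (fun l _ => T.MZ_xl hn hij (c l) (hc l) l) _ key
  rw [hb, tv_add]
  convert this using 1
  group

theorem E_le_CZ (hn : 3 ≤ n) {g : SL n L} (hg : g ∈ E n L) : g ∈ T.CZ n :=
  E_induction (p := fun g => g ∈ T.CZ n) (one_mem _) (fun i j hij r e _ he => mul_mem (T.CZ_tv hn hij r) he) hg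

theorem mem_Z (hn : 3 ≤ n) {g : SL n L} (hg : g ∈ E n L) (h1 : mp T.ψ g = 1) : g ∈ T.Z n := by
  set N : Subgroup (E n L) := Subgroup.normalClosure {t | ∃ i j s, i ≠ j ∧ T.ψ s = 0 ∧ t.1 = tv i j s} with hN
  have hNZ : ∀ t ∈ N, t.1 ∈ T.MZ n ∧ (t⁻¹).1 ∈ T.MZ n := by
    intro t ht
    have base : ∀ t ∈ Group.conjugatesOfSet {t : E n L | ∃ i j s, i ≠ j ∧ T.ψ s = 0 ∧ t.1 = tv i j s}, t.1 ∈ T.MZ n := by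
      intro t ht
      rw [Group.mem_conjugatesOfSet_iff] at ht
      obtain ⟨y, ⟨i, j, s, hij, hs, hy⟩, hc⟩ := ht
      obtain ⟨c, rfl⟩ := isConj_iff.mp hc
      intro z hz
      have a1 := T.E_le_CZ hn (inv_mem c.2) z hz
      have a2 := T.MZ_tv hn hij s hs _ a1
      have a3 := T.E_le_CZ hn c.2 _ a2
      rw [← hy] at a3
      convert a3 using 1
      simp only [Subgroup.coe_mul, Subgroup.coe_inv]
      group
    have binv : ∀ t ∈ Group.conjugatesOfSet {t : E n L | ∃ i j s, i ≠ j ∧ T.ψ s = 0 ∧ t.1 = tv i j s}, 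
        t⁻¹ ∈ Group.conjugatesOfSet {t : E n L | ∃ i j s, i ≠ j ∧ T.ψ s = 0 ∧ t.1 = tv i j s} := by
      intro t ht
      rw [Group.mem_conjugatesOfSet_iff] at ht ⊢
      obtain ⟨y, ⟨i, j, s, hij, hs, hy⟩, hc⟩ := ht
      obtain ⟨c, rfl⟩ := isConj_iff.mp hc
      refine ⟨y⁻¹, ⟨i, j, -s, hij, by simp [hs], by rw [tv_neg, ← hy]; rfl⟩, isConj_iff.mpr ⟨c, by group⟩⟩
    change t ∈ Subgroup.closure _ at ht
    induction ht using Subgroup.closure_induction with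
    | mem x hx => exact ⟨base x hx, base _ (binv x hx)⟩
    | one => simp [one_mem]
    | mul x y _ _ hx hy =>
      refine ⟨mul_mem hx.1 hy.1, ?_⟩
      rw [mul_inv_rev]; exact mul_mem hy.2 hx.2
    | inv x _ hx => exact ⟨hx.2, by rw [inv_inv]; exact hx.1⟩
  set S0 := (EtvSys n L).map (QuotientGroup.mk' N) with hS0
  obtain ⟨S, hS⟩ := S0.exists_desc T.ψ T.surj (by
    intro i j hij a ha
    rw [hS0, StSys.map_x, QuotientGroup.mk'_apply, QuotientGroup.eq_one_iff]
    exact Subgroup.subset_normalClosure ⟨i, j, a, hij, ha, rfl⟩)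
  have hker : ∀ t ∈ N, ((mp T.ψ).comp (E n L).subtype) t = 1 := by
    intro t ht
    have : N ≤ ((mp T.ψ).comp (E n L).subtype).ker := by
      apply Subgroup.normalClosure_le_normal
      rintro t ⟨i, j, s, hij, hs, ht⟩
      change mp T.ψ t.1 = 1
      rw [ht, mp_tv, hs, tv_zero]
    exact this ht
  set π : (E n L) ⧸ N →* SL n K := QuotientGroup.lift N ((mp T.ψ).comp (E n L).subtype) hker with hπ
  have hπx : ∀ i j, i ≠ j → ∀ a, π (S.x i j a) = tv i j a := by
    intro i j hij a
    obtain ⟨a, rfl⟩ := T.surj a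
    rw [hS i j hij]
    change mp T.ψ (tv i j a) = _
    rw [mp_tv]
  have hT : ∀ i j, i ≠ j → ∀ u v, S.h i j u * S.h i j v = S.h i j (u * v) := by
    intro i j hij u v
    obtain ⟨u', hu⟩ := T.lift u
    obtain ⟨v', hv⟩ := T.lift v
    rw [StSys.desc_h hS hij u' u hu.symm, StSys.desc_h hS hij v' v hv.symm, StSys.desc_h hS hij (u' * v') (u * v) (by simp [hu, hv]),
      hS0, StSys.map_h, StSys.map_h, StSys.map_h, ← map_mul, Etor_mul hij]
  have hgen : ∀ g : E n L, (QuotientGroup.mk' N g) ∈ S.XG Set.univ := by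
    rintro ⟨g, hg⟩
    refine E_induction (n := n) (R := L) (p := fun g => ∀ hg : g ∈ E n L, QuotientGroup.mk' N ⟨g, hg⟩ ∈ S.XG Set.univ) ?_ ?_ hg hg
    · intro h
      have : (⟨1, h⟩ : E n L) = 1 := rfl
      rw [this, map_one]; exact one_mem _
    · intro i j hij r e he ih h
      have : (⟨tv i j r * e, h⟩ : E n L) = (EtvSys n L).x i j r * ⟨e, he⟩ := rfl
      rw [this, map_mul]
      refine mul_mem ?_ (ih he)
      have := hS i j hij r
      rw [hS0, StSys.map_x] at this
      rw [← this]
      exact S.x_mem_XG hij (Set.mem_univ _) _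
  have hfin := S.field_pres π hπx hn hT (hgen ⟨g, hg⟩) h1
  rw [QuotientGroup.mk'_apply, QuotientGroup.eq_one_iff] at hfin
  have := (hNZ _ hfin).1 1 T.one_mem_Z
  simpa using this

theorem ψφ_zero (q : C[X]) (h : ∀ i, q.coeff i ∈ IsLocalRing.maximalIdeal C) : T.ψ (T.φ q) = 0 := by
  rw [q.as_sum_range_C_mul_X_pow, map_sum, map_sum]
  refine Finset.sum_eq_zero fun i _ => ?_
  rw [map_mul, map_mul, T.ψC _ (h i), zero_mul]

/-- monic inversion -/
theorem MI (hn : 3 ≤ n) (g : SL n C[X]) (h : mp T.φ g ∈ E n L) : g ∈ E n C[X] := by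
  obtain ⟨e, he, hee⟩ := mp_surj (mapRingHom (IsLocalRing.residue C)) (Polynomial.map_surjective _ IsLocalRing.residue_surjective)
    (full_polyField hn _ (mp (mapRingHom (IsLocalRing.residue C)) g))
  set g' := g * e⁻¹ with hg'
  have h1 : mp (mapRingHom (IsLocalRing.residue C)) g' = 1 := by
    have : mp (mapRingHom (IsLocalRing.residue C)) g' = mp (mapRingHom (IsLocalRing.residue C)) g * (mp (mapRingHom (IsLocalRing.residue C)) e)⁻¹ :=
      (map_mul _ _ _).trans (congrArg _ (map_inv _ _))
    rw [this, hee, mul_inv_cancel]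
  have h2 : mp T.ψ (mp T.φ g') = 1 := by
    rw [mp_comp]
    apply res_one_iff
    intro a b
    apply T.ψφ_zero
    intro i
    have := congrArg (fun g => mat g a b) h1
    simp only [mp_apply, mat_one_apply] at this
    rw [← IsLocalRing.residue_eq_zero_iff, ← Polynomial.coeff_map, ← coe_mapRingHom, map_sub, this]
    split_ifs <;> simp
  have h3 : mp T.φ g' ∈ E n L := by
    rw [hg', map_mul, map_inv]
    exact mul_mem h (inv_mem (mp_mem _ he))
  obtain ⟨p, hp, v, -, -, hz⟩ := T.mem_Z hn h3 h2
  have h4 : mp T.φ (p⁻¹ * g') = mp T.ω v := by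
    rw [map_mul, map_inv, hz]; group
  obtain ⟨c, hc⟩ := lift_SL (Polynomial.C : C →+* C[X]) Polynomial.C_injective (p⁻¹ * g') (by
    intro a b
    have := congrArg (fun g => mat g a b) h4
    simp only [mp_apply] at this
    obtain ⟨c, hc⟩ := T.φω _ _ this
    exact ⟨c, hc.symm⟩)
  have h5 : c ∈ E n C := sr1_Full (by omega) (sr1_local C) c
  have : g = p * (mp (Polynomial.C : C →+* C[X]) c) * e := by
    rw [hc, hg']; group
  rw [this]
  exact mul_mem (mul_mem hp (mp_mem _ h5)) he

end LSys
end BG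

namespace BG
open Polynomial

section sus
variable {A B : Type} [CommRing A] [IsDomain A] [IsLocalRing A] [IsPrincipalIdealRing A] [CommRing B]
  (f : A[X] →+* B)

/-- there is a unit coefficient -/
def UC (a : A[X]) : Prop := ∃ i, IsUnit (a.coeff i)

theorem UC.ne_zero {a : A[X]} (h : UC a) : a ≠ 0 := by
  rintro rfl
  obtain ⟨i, hi⟩ := h
  simp at hi

theorem unit_of_lead (hf : ∀ p : A[X], p.Monic → IsUnit (f p)) {a : A[X]} (h : IsUnit a.leadingCoeff) : IsUnit (f a) := by
  obtain ⟨u, hu⟩ := h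
  have h1 : (C ((u⁻¹ : Aˣ) : A) * a).Monic := monic_C_mul_of_mul_leadingCoeff_eq_one (by rw [← hu]; simp)
  have h2 := hf _ h1
  rw [map_mul] at h2
  exact isUnit_of_mul_isUnit_right h2

theorem prime_dvd {p : A} (hp : Prime p) {x : A} (hx : ¬ IsUnit x) : p ∣ x := by
  have h1 : (Ideal.span {p}).IsPrime := (Ideal.span_singleton_prime hp.ne_zero).mpr hp
  have h2 : (Ideal.span {p}).IsMaximal := IsPrime.to_maximal_ideal (by simpa using hp.ne_zero)
  have h3 := IsLocalRing.eq_maximalIdeal h2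
  have : x ∈ IsLocalRing.maximalIdeal A := hx
  rw [← h3, Ideal.mem_span_singleton] at this
  exact this

theorem trunc (hf : ∀ p : A[X], p.Monic → IsUnit (f p)) {p : A} (hp : Prime p) :
    ∀ (N : ℕ) (a : A[X]), a.support.card ≤ N → UC a → ∃ a₁ a₂, IsUnit (f a₁) ∧ a = a₁ + a₂ * C p := by
  intro N
  induction N with
  | zero =>
    intro a ha h
    exact absurd (by simpa using ha) h.ne_zero
  | succ N ih =>
    intro a ha h
    by_cases hl : IsUnit a.leadingCoeff
    · exact ⟨a, 0, unit_of_lead f hf hl, by simp⟩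
    · obtain ⟨q, hq⟩ := prime_dvd hp hl
      have h1 : UC a.eraseLead := by
        obtain ⟨i, hi⟩ := h
        refine ⟨i, ?_⟩
        rw [eraseLead_coeff_of_ne]
        · exact hi
        · rintro rfl; exact hl hi
      obtain ⟨a₁, a₂, h2, h3⟩ := ih a.eraseLead (by have := eraseLead_support_card_lt h.ne_zero; omega) h1
      refine ⟨a₁, a₂ + C q * X ^ a.natDegree, h2, ?_⟩
      conv_lhs => rw [← eraseLead_add_C_mul_X_pow a, h3, hq]
      simp only [map_mul]; ring

theorem claim1 (hf : ∀ p : A[X], p.Monic → IsUnit (f p)) {a : A[X]} (ha : UC a) (c : A) :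
    c ≠ 0 → IsCoprime (f a) (f (C c)) ∧ El (f a) (f (C c)) := by
  induction c using UniqueFactorizationMonoid.induction_on_prime with
  | h₁ => simp
  | h₂ x hx =>
    intro _
    have : IsUnit (f (C x)) := (hx.map C).map f
    exact ⟨IsCoprime.symm ⟨↑this.unit⁻¹, 0, by simp⟩, (El_unit this _).swap⟩
  | h₃ c p hc hp ih =>
    intro _
    obtain ⟨a₁, a₂, h1, h2⟩ := trunc f hf hp _ a le_rfl ha
    have h3 : f a = f a₁ + f a₂ * f (C p) := by rw [h2, map_add, map_mul]
    have h4 : IsCoprime (f a) (f (C p)) := by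
      rw [h3]
      obtain ⟨u, hu⟩ := h1
      rw [← hu]
      exact ⟨↑u⁻¹, -(↑u⁻¹ * f a₂), by linear_combination u.inv_mul⟩
    have h5 : El (f a) (f (C p)) := ((El_unit h1 (f (C p))).add_left (f a₂)).congr h3.symm rfl
    rw [map_mul, map_mul]
    exact ⟨h4.mul_right (ih hc).1, h5.mul (ih hc).2⟩

theorem claim2 {b : A[X]} (hb : b ≠ 0) : ∃ c b', c ≠ 0 ∧ UC b' ∧ b = C c * b' := by
  obtain ⟨c, hc⟩ := IsPrincipalIdealRing.principal (Ideal.span (Set.range b.coeff))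
  have hc' : Ideal.span (Set.range b.coeff) = Ideal.span {c} := hc
  have h1 : C c ∣ b := by
    rw [C_dvd_iff_dvd_coeff]
    intro i
    rw [← Ideal.mem_span_singleton, ← hc']
    exact Ideal.subset_span ⟨i, rfl⟩
  obtain ⟨b', rfl⟩ := h1
  have c0 : c ≠ 0 := by rintro rfl; simp at hb
  refine ⟨c, b', c0, ?_, rfl⟩
  by_contra h
  obtain ⟨q, hq⟩ := IsPrincipalIdealRing.principal (IsLocalRing.maximalIdeal A)
  have hq' : IsLocalRing.maximalIdeal A = Ideal.span {q} := hq
  have h2 : Ideal.span (Set.range (C c * b').coeff) ≤ Ideal.span {c * q} := by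
    rw [Ideal.span_le]
    rintro _ ⟨i, rfl⟩
    rw [SetLike.mem_coe, Ideal.mem_span_singleton, coeff_C_mul]
    apply mul_dvd_mul_left
    rw [← Ideal.mem_span_singleton, ← hq']
    exact fun hu => h ⟨i, hu⟩
  rw [hc', Ideal.span_singleton_le_span_singleton] at h2
  have h3 : q ∣ 1 := by
    rw [← mul_dvd_mul_iff_left c0]; simpa using h2
  have h4 : (1 : A) ∈ IsLocalRing.maximalIdeal A := by rw [hq', Ideal.mem_span_singleton]; exact h3
  exact h4 isUnit_one

/-- gcd presentation -/
def Good (x y : B) : Prop := ∃ d s t : B, x = d * s ∧ y = d * t ∧ IsCoprime s t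

theorem Good.symm {x y : B} (h : Good x y) : Good y x := by
  obtain ⟨d, s, t, h1, h2, h3⟩ := h
  exact ⟨d, t, s, h2, h1, h3.symm⟩

theorem cop_dvd {x y : B} (h : IsCoprime x y) (hd : x ∣ y) : IsUnit x := h.isUnit_of_dvd' dvd_rfl hd

variable [IsDomain B]

theorem claim3 (hf : ∀ p : A[X], p.Monic → IsUnit (f p)) (hi : Function.Injective f) :
    ∀ (N : ℕ) (a b : A[X]), a.natDegree + b.natDegree < N → UC a → UC b →
     (IsCoprime (f a) (f b) → El (f a) (f b)) ∧ Good (f a) (f b) := by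
  intro N
  induction N with
  | zero => intro a b h; omega
  | succ N ih =>
    have key : ∀ (a b : A[X]), a.natDegree + b.natDegree < N + 1 → a.natDegree ≤ b.natDegree → UC a → UC b →
     (IsCoprime (f a) (f b) → El (f a) (f b)) ∧ Good (f a) (f b) := by
      intro a b hN hab ha hb
      have la : a.leadingCoeff ≠ 0 := leadingCoeff_ne_zero.mpr ha.ne_zero
      have lb : b.leadingCoeff ≠ 0 := leadingCoeff_ne_zero.mpr hb.ne_zero
      obtain ⟨hc1, hE1⟩ := claim1 f hf ha _ la
      set l := a.leadingCoeff with hl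
      set q := C b.leadingCoeff * X ^ (b.natDegree - a.natDegree) with hq
      have hdeg : (C l * b - q * a).degree < b.degree := by
        have h0 : C l * b ≠ 0 := mul_ne_zero (by simpa using la) hb.ne_zero
        have := degree_sub_lt (p := C l * b) (q := q * a) ?_ h0 ?_
        · rwa [degree_C_mul la] at this
        · rw [degree_C_mul la, hq, degree_mul, degree_C_mul_X_pow _ lb, degree_eq_natDegree ha.ne_zero, degree_eq_natDegree hb.ne_zero]
          norm_cast
          omega
        · rw [hq, leadingCoeff_mul, leadingCoeff_mul, leadingCoeff_C, leadingCoeff_mul, leadingCoeff_C, leadingCoeff_X_pow, mul_one, ← hl, mul_comm]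
      have fa0 : f a ≠ 0 := by
        intro h; exact ha.ne_zero (hi (by simpa using h))
      by_cases hz : C l * b - q * a = 0
      · have h1 : f (C l) * f b = f q * f a := by
          rw [← map_mul, ← map_mul, sub_eq_zero.mp hz]
        have h2 : f a ∣ f b := hc1.dvd_of_dvd_mul_left ⟨f q, by rw [h1, mul_comm]⟩
        refine ⟨fun h => El_unit (cop_dvd h h2) _, ?_⟩
        obtain ⟨t, ht⟩ := h2
        exact ⟨f a, 1, t, by simp, ht, isCoprime_one_left⟩
      · obtain ⟨e, b', he, hb', hbe⟩ := claim2 hz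
        have hd : b'.natDegree < b.natDegree := by
          have : (C l * b - q * a).natDegree < b.natDegree := natDegree_lt_natDegree hz hdeg
          rwa [hbe, natDegree_C_mul he] at this
        obtain ⟨hE2, hG⟩ := ih a b' (by omega) ha hb'
        obtain ⟨hc3, hE3⟩ := claim1 f hf ha _ he
        have h1 : f (C l) * f b = f (C e) * f b' + f q * f a := by
          rw [← map_mul, ← map_mul, ← map_mul, ← map_add, ← hbe]; congr 1; ring
        constructor
        · intro h
          have h2 : IsCoprime (f a) (f (C e) * f b') := by
            have h3 : IsCoprime (f a) (f (C l) * f b) := hc1.mul_right h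
            rw [h1] at h3
            exact IsCoprime.of_add_mul_right_right h3
          have h4 := hE3.mul (hE2 h2.of_mul_right_right)
          exact hE1.div hc1 ((h4.add_right (f q)).congr rfl h1.symm)
        · obtain ⟨d, s, t, hs, ht, hst⟩ := hG
          have d0 : d ≠ 0 := by rintro rfl; simp [hs] at fa0
          have hda : d ∣ f a := ⟨s, hs⟩
          have hsa : s ∣ f a := ⟨d, by rw [hs, mul_comm]⟩
          have h2 : d ∣ f b := by
            have : IsCoprime d (f (C l)) := hc1.of_isCoprime_of_dvd_left hda
            apply this.dvd_of_dvd_mul_left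
            rw [h1, ht, hs]
            exact ⟨f (C e) * t + f q * s, by ring⟩
          obtain ⟨b2, hb2⟩ := h2
          refine ⟨d, s, b2, hs, hb2, ?_⟩
          have h3 : f (C l) * b2 = f (C e) * t + f q * s := by
            apply mul_left_cancel₀ d0
            rw [hb2, ht, hs] at h1
            linear_combination h1
          have h4 : IsCoprime s (f (C l) * b2) := by
            rw [h3]
            have := (hc3.of_isCoprime_of_dvd_left hsa).mul_right hst
            exact IsCoprime.add_mul_right_right this _
          exact h4.of_mul_right_right
    intro a b hN ha hb
    rcases le_total a.natDegree b.natDegree with h | h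
    · exact key a b hN h ha hb
    · obtain ⟨h1, h2⟩ := key b a (by omega) h hb ha
      exact ⟨fun h => (h1 h.symm).swap, h2.symm⟩

theorem claim4 (hf : ∀ p : A[X], p.Monic → IsUnit (f p)) (hi : Function.Injective f) (a b : A[X]) :
     (IsCoprime (f a) (f b) → El (f a) (f b)) ∧ Good (f a) (f b) := by
  by_cases ha0 : a = 0
  · subst ha0
    rw [map_zero]
    refine ⟨fun h => (El_unit (isCoprime_zero_left.mp h) _).swap, f b, 0, 1, by simp, by simp, isCoprime_one_right⟩
  by_cases hb0 : b = 0
  · subst hb0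
    rw [map_zero]
    refine ⟨fun h => (El_unit (isCoprime_zero_right.mp h) _), f a, 1, 0, by simp, by simp, isCoprime_one_left⟩
  obtain ⟨c, a', hc, ha', rfl⟩ := claim2 ha0
  obtain ⟨e, b', he, hb', rfl⟩ := claim2 hb0
  obtain ⟨h1, h2⟩ := claim3 f hf hi _ a' b' (Nat.lt_succ_self _) ha' hb'
  constructor
  · intro h
    rw [map_mul, map_mul] at h ⊢
    have h3 : El (f (C c)) (f (C e)) := by
      rcases ValuationRing.dvd_total c e with ⟨x, rfl⟩ | ⟨x, rfl⟩
      · apply El_unit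
        rw [map_mul, map_mul] at h
        exact h.isUnit_of_dvd' (dvd_mul_right _ _) (by rw [mul_assoc]; exact dvd_mul_right _ _)
      · apply El.swap
        apply El_unit
        rw [map_mul, map_mul] at h
        exact h.isUnit_of_dvd' (by rw [mul_assoc]; exact dvd_mul_right _ _) (dvd_mul_right _ _)
    have h4 := h1 h.of_mul_left_right.of_mul_right_right
    have h5 := (claim1 f hf ha' e he).2
    have h6 := (claim1 f hf hb' c hc).2
    exact ((h3.mul h6.swap).swap.mul (h5.mul h4).swap).swap
  · rw [map_mul, map_mul]
    have aux : ∀ (c e : A) (a' b' : A[X]), c ≠ 0 → e ≠ 0 → UC a' → Good (f a') (f b') → c ∣ e → Good (f (C c) * f a') (f (C e) * f b') := by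
      rintro c _ a' b' hc he ha' ⟨d, s, t, hs, ht, hst⟩ ⟨x, rfl⟩
      refine ⟨f (C c) * d, s, f (C x) * t, by rw [hs]; ring, by rw [ht, map_mul, map_mul]; ring, ?_⟩
      refine IsCoprime.mul_right ?_ hst
      exact (claim1 f hf ha' x (right_ne_zero_of_mul he)).1.of_isCoprime_of_dvd_left ⟨d, by rw [hs, mul_comm]⟩
    rcases ValuationRing.dvd_total c e with h | h
    · exact aux c e a' b' hc he ha' h2 h
    · exact (aux e c b' a' he hc hb' h2.symm h).symm

theorem claim5 (hf : ∀ p : A[X], p.Monic → IsUnit (f p)) (hi : Function.Injective f)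
    (hd : ∀ x : B, ∃ s : A[X], s.Monic ∧ ∃ p, f s * x = f p) (x y : B) :
     (IsCoprime x y → El x y) ∧ Good x y := by
  have aux : ∀ x : B, ∃ (u : Bˣ) (p : A[X]), x = u * f p := by
    intro x
    obtain ⟨s, hs, p, hp⟩ := hd x
    obtain ⟨u, hu⟩ := hf s hs
    exact ⟨u⁻¹, p, by rw [← hp, ← hu]; simp⟩
  obtain ⟨u, p, rfl⟩ := aux x
  obtain ⟨v, q, rfl⟩ := aux y
  obtain ⟨h1, d, s, t, hs, ht, hst⟩ := claim4 f hf hi p q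
  constructor
  · intro h
    have h2 := h1 h.of_mul_left_right.of_mul_right_right
    have h3 : El (f p) (v * f q) := (El_unit v.isUnit _).swap.mul h2
    exact ((El_unit u.isUnit _).swap.mul h3.swap).swap
  · refine ⟨d, u * s, v * t, by rw [hs]; ring, by rw [ht]; ring, ?_⟩
    rw [isCoprime_mul_unit_left_left u.isUnit, isCoprime_mul_unit_left_right v.isUnit]
    exact hst

end sus
end BG

namespace BG
open Polynomial

/-- monic polynomials -/
def monics (A : Type) [CommRing A] : Submonoid A[X] where
  carrier := {p | p.Monic}
  one_mem' := monic_one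
  mul_mem' := fun h h' => Monic.mul h h'

theorem mem_monics {A : Type} [CommRing A] {p : A[X]} : p ∈ monics A ↔ p.Monic := Iff.rfl

/-- localization at monics -/
abbrev LM (A : Type) [CommRing A] : Type := Localization (monics A)

theorem monics_le (A : Type) [CommRing A] [IsDomain A] : monics A ≤ nonZeroDivisors A[X] := by
  intro p hp
  exact mem_nonZeroDivisors_of_ne_zero (Monic.ne_zero hp)

theorem lφ_unit {C : Type} [CommRing C] {p : C[X]} (hp : p.Monic) : IsUnit (lφ C p) := by
  nontriviality C
  have h0 : (lφ C p).coeff (-(p.natDegree:ℤ)) = 1 := by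
    rw [lφ_coeff, if_pos (by omega)]; simpa using hp.leadingCoeff
  have hord : (lφ C p).order = -(p.natDegree:ℤ) := by
    apply le_antisymm
    · apply HahnSeries.order_le_of_coeff_ne_zero
      rw [h0]; exact one_ne_zero
    · by_contra hlt
      have hne : (lφ C p) ≠ 0 := by rintro h; rw [h] at h0; simp at h0
      have := (HahnSeries.coeff_order_eq_zero (x := lφ C p)).not.mpr hne
      rw [lφ_coeff] at this
      split_ifs at this with h
      · exact this (coeff_eq_zero_of_natDegree_lt (by omega))
      · exact this rfl
  apply HahnSeries.isUnit_of_isUnit_leadingCoeff_AddUnitOrder _ (AddGroup.isAddUnit _)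
  rw [HahnSeries.leadingCoeff_eq, hord, h0]
  exact isUnit_one

section
variable (A : Type) [CommRing A] [IsDomain A] [IsLocalRing A] [IsPrincipalIdealRing A]

instance LM_dom : IsDomain (LM A) := IsLocalization.isDomain_of_le_nonZeroDivisors (M := monics A) _ (monics_le A)

theorem LM_facts : (∀ p : A[X], p.Monic → IsUnit (algebraMap A[X] (LM A) p)) ∧ Function.Injective (algebraMap A[X] (LM A)) ∧
    (∀ x : LM A, ∃ s : A[X], s.Monic ∧ ∃ p, algebraMap A[X] (LM A) s * x = algebraMap A[X] (LM A) p) := by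
  refine ⟨fun p hp => IsLocalization.map_units (LM A) (⟨p, hp⟩ : monics A), IsLocalization.injective _ (monics_le A), ?_⟩
  intro x
  obtain ⟨⟨p, s⟩, h⟩ := IsLocalization.surj (monics A) x
  exact ⟨s, s.2, p, by rw [← h, mul_comm]⟩

theorem LM_full {n : ℕ} (hn : 3 ≤ n) : Full n (LM A) := by
  obtain ⟨h1, h2, h3⟩ := LM_facts A
  refine bezout_Full hn ?_ ?_
  · exact fun a b => (claim5 _ h1 h2 h3 a b).2
  · exact fun a b => (claim5 _ h1 h2 h3 a b).1

instance LM_pid : IsPrincipalIdealRing (LM A) := by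
  obtain ⟨h1, h2, h3⟩ := LM_facts A
  haveI : IsNoetherianRing (LM A) := IsLocalization.isNoetherianRing (monics A) _ inferInstance
  haveI : IsBezout (LM A) := by
    rw [IsBezout.iff_span_pair_isPrincipal]
    intro x y
    obtain ⟨d, s, t, rfl, rfl, u, v, huv⟩ := (claim5 _ h1 h2 h3 x y).2
    refine ⟨d, ?_⟩
    apply le_antisymm
    · rw [Ideal.span_le]
      rintro z (rfl | rfl)
      · exact Ideal.mem_span_singleton.mpr (dvd_mul_right _ _)
      · exact Ideal.mem_span_singleton.mpr (dvd_mul_right _ _)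
    · change Ideal.span {d} ≤ _
      rw [Ideal.span_singleton_le_iff_mem, Ideal.mem_span_pair]
      exact ⟨u, v, by linear_combination d * huv⟩
  infer_instance
end

theorem fact {n k : ℕ} {A M L Q : Type} [CommRing A] [CommRing M] [CommRing L] [CommRing Q] (ψ : Q[X] →+* L)
    (ι : MvPolynomial (Fin k) A →+* Q) (f : A[X] →+* M) (β : M →+* L) (hβ : ∀ p : A[X], β (f p) = ψ (p.map (ι.comp MvPolynomial.C)))
    (hB : Full n (MvPolynomial (Fin k) M)) (g : SL n (MvPolynomial (Fin k) A)[X]) : mp ψ (mp (mapRingHom ι) g) ∈ E n L := by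
  let F : (MvPolynomial (Fin k) A)[X] →+* MvPolynomial (Fin k) M :=
    eval₂RingHom (MvPolynomial.map (f.comp C)) (MvPolynomial.C (f X))
  let G : MvPolynomial (Fin k) M →+* L :=
    MvPolynomial.eval₂Hom β (fun i => ψ (C (ι (MvPolynomial.X i))))
  have e : ψ.comp (mapRingHom ι) = G.comp F := by
    ext1
    · refine MvPolynomial.ringHom_ext (fun r => ?_) (fun i => ?_)
      · simp [F, G, hβ]
      · simp [F, G]
    · simp [F, G, hβ]
  rw [mp_comp, e, ← mp_comp]
  exact mp_mem G (hB _)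

theorem suslin_local {n : ℕ} (hn : 3 ≤ n) (k : ℕ) : ∀ (A : Type) [CommRing A] [IsDomain A] [IsLocalRing A] [IsPrincipalIdealRing A],
    Full n (MvPolynomial (Fin k) A) := by
  induction k with
  | zero =>
    intro A _ _ _ _
    exact Full.of_equiv (MvPolynomial.isEmptyRingEquiv A (Fin 0)).symm (sr1_Full (by omega) (sr1_local A))
  | succ k ih =>
    intro A _ _ _ _
    refine Full.of_equiv (MvPolynomial.finSuccEquiv A k).symm.toRingEquiv ?_
    have hB : Full n (MvPolynomial (Fin k) (LM A)) := by
      refine lg_mv hn k (LM_full A hn) ?_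
      intro m hm
      exact ih (Localization.AtPrime m)
    intro g
    have key := localGlobal (A := MvPolynomial (Fin k) A) (P := MvPolynomial (Fin k) A) hn g ?_
    · have h2 := mul_mem key (mp_mem (C : _ →+* (MvPolynomial (Fin k) A)[X]) (ih A (mp (evalRingHom 0) g)))
      rw [mp_comp] at h2
      simpa using h2
    · intro m hm
      let Q := Localization.AtPrime m
      let ι := algebraMap (MvPolynomial (Fin k) A) Q
      refine ⟨Q, inferInstance, ι, IsLocalization.injective _ m.primeCompl_le_nonZeroDivisors, ?_, ?_⟩
      · intro q
        obtain ⟨⟨p, s⟩, h⟩ := IsLocalization.surj m.primeCompl q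
        exact ⟨s, s.2, p, by rw [← h, mul_comm]; rfl⟩
      · apply (laurentSys Q).MI hn
        change mp (lφ Q) _ ∈ _
        let j : A →+* Q := ι.comp MvPolynomial.C
        let β : LM A →+* LaurentSeries Q := IsLocalization.lift (M := monics A) (g := (lφ Q).comp (mapRingHom j)) (by
          rintro ⟨p, hp⟩
          exact lφ_unit (Monic.map j hp))
        have hβ : ∀ p : A[X], β (algebraMap _ _ p) = lφ Q (p.map j) := fun p => IsLocalization.lift_eq _ p
        exact fact (lφ Q) ι (algebraMap A[X] (LM A)) β hβ hB g

theorem suslin {n : ℕ} (hn : 3 ≤ n) (k : ℕ) : Full n (MvPolynomial (Fin k) ℤ) := by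
  refine lg_mv hn k (full_int hn) ?_
  intro m hm
  exact suslin_local hn k _

end BG

namespace BG
namespace StSys
section
variable {n : ℕ} {A : Type} [CommRing A] {Γ : Type} [Group Γ] (S : StSys n A Γ)

theorem comm_mz {i j k l : Fin n} (hij : i ≠ j) (hkl : k ≠ l) (ho : ¬ (k = j ∧ l = i)) {a b : A} (hab : a * b = 0) :
    Commute (S.x i j a) (S.x k l b) := by
  by_cases hjk : j = k
  · subst hjk
    have hil : i ≠ l := fun h => ho ⟨rfl, h.symm⟩
    have := S.c1 i j l hij hkl hil a b
    rw [hab, S.x_zero hil, one_mul] at this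
    exact this
  · by_cases hil : i = l
    · subst hil
      have := S.c1 k i j hkl hij (Ne.symm hjk) b a
      rw [mul_comm b a, hab, S.x_zero (Ne.symm hjk), one_mul] at this
      exact this.symm
    · exact S.c2 i j k l hij hkl hjk hil a b

theorem comm_split (hn : 3 ≤ n) {i j : Fin n} (hij : i ≠ j) {s a a' : A} (h1 : s * a = 0) (h2 : s * a' = 0) :
    Commute (S.x i j s) (S.x j i (a * a')) := by
  obtain ⟨k, hi, hj⟩ := exists_third hn i j
  rw [S.comm_eq hj.symm hi hij.symm]
  have c1 : Commute (S.x i j s) (S.x j k a) := S.comm_mz hij hj.symm (fun h => hi h.2) h1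
  have c2 : Commute (S.x i j s) (S.x k i a') := S.comm_mz hij hi (fun h => hj h.1) h2
  exact ((c1.mul_right c2).mul_right c1.inv_right).mul_right c2.inv_right

theorem cent_of {z : Γ} (h : ∀ k l, k ≠ l → ∀ a, Commute z (S.x k l a)) {g : Γ} (hg : g ∈ S.XG Set.univ) : Commute z g := by
  refine S.XG_induction (p := fun g => Commute z g) (Commute.one_right z) ?_ hg
  intro i j hij _ a g _ ih
  exact (h i j hij a).mul_right ih

variable {S} in
theorem MonAct.cent {z z' : Γ} {m : Fin n → Aˣ} (h : S.MonAct z 1 m) (h' : S.MonAct z' 1 m) {g : Γ} (hg : g ∈ S.XG Set.univ) :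
    Commute (z⁻¹ * z') g := by
  refine S.cent_of ?_ hg
  intro k l hkl a
  have e1 := h k l hkl a
  have e2 := h' k l hkl a
  rw [← e1] at e2
  change _ = _
  calc z⁻¹ * z' * S.x k l a = z⁻¹ * (z' * S.x k l a * z'⁻¹) * z' := by group
    _ = _ := by rw [e2]; group

theorem x_mem {i j : Fin n} (hij : i ≠ j) (a : A) : S.x i j a ∈ S.XG Set.univ := S.x_mem_XG hij (Set.mem_univ _) a

theorem w_mem {i j : Fin n} (hij : i ≠ j) (u : Aˣ) : S.w i j u ∈ S.XG Set.univ := by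
  unfold w
  exact mul_mem (mul_mem (S.x_mem hij _) (S.x_mem hij.symm _)) (S.x_mem hij _)

theorem h_mem {i j : Fin n} (hij : i ≠ j) (u : Aˣ) : S.h i j u ∈ S.XG Set.univ := by
  unfold h
  exact mul_mem (S.w_mem hij _) (S.w_mem hij _)

/-- good units -/
def Gd (u : Aˣ) : Prop := ∀ i j k, i ≠ j → i ≠ k → j ≠ k → ∀ v, Commute (S.h i j u) (S.h i k v)

theorem tor_of_good (hn : 3 ≤ n) (H : ∀ u, S.Gd u) {i k : Fin n} (hik : i ≠ k) (u v : Aˣ) :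
    S.h i k u * S.h i k v = S.h i k (u * v) := by
  obtain ⟨j, hi, hk⟩ := exists_third hn i k
  have c := H u i j k hi.symm hik hk v
  have e := S.h_conj_mon (S.h_mon hn hi.symm u) hik v
  rw [c.eq, mul_inv_cancel_right] at e
  simp only [Equiv.Perm.one_apply, dg, if_true, hik.symm, hk.symm, if_false, inv_one, mul_one] at e
  have c2 : Commute (S.h i k u) (S.h i k v) := by
    have c' := H v i j k hi.symm hik hk u
    have e' := S.h_conj_mon (S.h_mon hn hi.symm v) hik u
    rw [c'.eq, mul_inv_cancel_right] at e'
    simp only [Equiv.Perm.one_apply, dg, if_true, hik.symm, hk.symm, if_false, inv_one, mul_one] at e'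
    rw [eq_mul_inv_iff_mul_eq] at e e'
    change _ = _
    rw [e', e, mul_comm]
  rw [c2.eq]
  exact eq_mul_inv_iff_mul_eq.mp e

/-- restrict to an idempotent -/
def scale (e : A) (he : e * e = e) : StSys n A Γ where
  x i j a := S.x i j (e * a)
  add i j h a b := by rw [mul_add, S.add i j h]
  c1 i j k h1 h2 h3 a b := by
    rw [S.c1 i j k h1 h2 h3]
    congr 3
    linear_combination (a * b) * he
  c2 i j k l h1 h2 h3 h4 a b := S.c2 i j k l h1 h2 h3 h4 _ _

theorem scale_x (e : A) (he : e * e = e) (i j : Fin n) (a : A) : (S.scale e he).x i j a = S.x i j (e * a) := rfl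

theorem comm_orth (hn : 3 ≤ n) {e : A} (he : e * e = e) {i j k l : Fin n} (hij : i ≠ j) (hkl : k ≠ l) (a b : A) :
    Commute (S.x i j (e * a)) (S.x k l ((1 - e) * b)) := by
  by_cases ho : k = j ∧ l = i
  · obtain ⟨rfl, rfl⟩ := ho
    have := S.comm_split hn hij (s := e * a) (a := (1 - e) * b) (a' := 1 - e) (by linear_combination -(a * b) * he) (by linear_combination -a * he)
    convert this using 2
    linear_combination (-b) * he
  · exact S.comm_mz hij hkl ho (by linear_combination -(a * b) * he)

theorem scale_norm (hn : 3 ≤ n) {e : A} (he : e * e = e) (hgen : S.XG Set.univ = ⊤) : ((S.scale e he).XG Set.univ).Normal := by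
  have key : ∀ g ∈ S.XG Set.univ, ∀ u ∈ (S.scale e he).XG Set.univ, g * u * g⁻¹ ∈ (S.scale e he).XG Set.univ := by
    intro g hg
    refine S.XG_induction (p := fun g => ∀ u ∈ (S.scale e he).XG Set.univ, g * u * g⁻¹ ∈ (S.scale e he).XG Set.univ) ?_ ?_ hg
    · intro u hu; simpa using hu
    · intro i j hij _ a g _ ih u hu
      have h1 := ih u hu
      have e1 : S.x i j a * g * u * (S.x i j a * g)⁻¹ = S.x i j a * (g * u * g⁻¹) * (S.x i j a)⁻¹ := by group
      rw [e1]
      generalize g * u * g⁻¹ = v at h1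
      have e2 : S.x i j a = S.x i j (e * a) * S.x i j ((1 - e) * a) := by rw [← S.add i j hij]; congr 1; ring
      have c : Commute (S.x i j ((1 - e) * a)) v := by
        refine (S.scale e he).cent_of ?_ h1
        intro k l hkl b
        exact (S.comm_orth hn he hkl hij b a).symm
      have e3 : S.x i j a * v * (S.x i j a)⁻¹ = S.x i j (e * a) * v * (S.x i j (e * a))⁻¹ := by
        rw [e2, mul_assoc (S.x i j (e * a)), c.eq]; group
      rw [e3]
      have : S.x i j (e * a) ∈ (S.scale e he).XG Set.univ := (S.scale e he).x_mem hij a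
      exact mul_mem (mul_mem this h1) (inv_mem this)
  exact ⟨fun u hu g => key g (by rw [hgen]; trivial) u hu⟩

theorem scale_w (hn : 3 ≤ n) {e : A} (he : e * e = e) (he' : (1 - e) * (1 - e) = 1 - e) {i j : Fin n} (hij : i ≠ j) (v : Aˣ) :
    S.w i j v = (S.scale e he).w i j v * (S.scale (1 - e) he').w i j v ∧
    ∀ v', Commute ((S.scale e he).w i j v) ((S.scale (1 - e) he').w i j v') := by
  have sp : ∀ i j, i ≠ j → ∀ a, S.x i j a = S.x i j (e * a) * S.x i j ((1 - e) * a) := by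
    intro i j hij a
    rw [← S.add i j hij]; congr 1; ring
  simp only [w, scale_x]
  have c1 := fun a b => S.comm_orth hn he hij hij a b
  have c2 := fun a b => S.comm_orth hn he hij hij.symm a b
  have c3 := fun a b => S.comm_orth hn he hij.symm hij a b
  have c4 := fun a b => S.comm_orth hn he hij.symm hij.symm a b
  constructor
  · rw [sp i j hij v, sp j i hij.symm (-↑v⁻¹)]
    have d1 := c3 (-↑v⁻¹) v
    have d2 := (c1 v v).mul_left (d1)
    calc _ = S.x i j (e * ↑v) * (S.x i j ((1 - e) * ↑v) * S.x j i (e * -↑v⁻¹)) * (S.x j i ((1 - e) * -↑v⁻¹) *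
      S.x i j (e * ↑v)) * S.x i j ((1 - e) * ↑v) := by group
      _ = S.x i j (e * ↑v) * S.x j i (e * -↑v⁻¹) * (S.x i j ((1 - e) * ↑v) * S.x i j (e * ↑v)) * (S.x j i ((1 - e) * -↑v⁻¹)) * S.x i j ((1 - e) * ↑v) := by
        rw [← d1.eq, ← (c2 v (-↑v⁻¹)).eq]; group
      _ = _ := by rw [← (c1 v v).eq]; group
  · intro v'
    have d1 := ((c1 v v').mul_right (c2 v (-↑v'⁻¹))).mul_right (c1 v v')
    have d2 := ((c3 (-↑v⁻¹) v').mul_right (c4 (-↑v⁻¹) (-↑v'⁻¹))).mul_right (c3 (-↑v⁻¹) v')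
    exact (d1.mul_left d2).mul_left d1

theorem scale_h (hn : 3 ≤ n) {e : A} (he : e * e = e) {i j : Fin n} (hij : i ≠ j) (v : Aˣ) (hv : (1 - e) * (v : A) = 1 - e) :
    S.h i j v = (S.scale e he).h i j v := by
  have he' : (1 - e) * (1 - e) = 1 - e := by linear_combination he
  obtain ⟨h1, -⟩ := S.scale_w hn he he' hij v
  obtain ⟨h2, h3⟩ := S.scale_w hn he he' hij (-1)
  have h4 : (S.scale (1 - e) he').w i j v = (S.scale (1 - e) he').w i j 1 := by
    have : (1 - e) * ((v⁻¹ : Aˣ) : A) = 1 - e := by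
      calc (1 - e) * ((v⁻¹ : Aˣ) : A) = (1 - e) * (v : A) * ((v⁻¹ : Aˣ) : A) := by rw [hv]
        _ = _ := by rw [mul_assoc, Units.mul_inv, mul_one]
    simp only [w, scale_x, mul_neg, hv, this, Units.val_one, inv_one, mul_one]
  rw [h, h1, h2, h4, h]
  have h5 := (h3 1).eq
  calc _ = (S.scale e he).w i j v * ((S.scale (1 - e) he').w i j 1 * (S.scale e he).w i j (-1)) * (S.scale (1 - e) he').w i j (-1) := by group
    _ = _ := by rw [← h5, (S.scale (1-e) he').w_neg hij]; group

variable {S} in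
theorem MonAct.pow {z : Γ} {m : Fin n → Aˣ} (h : S.MonAct z 1 m) (N : ℕ) : S.MonAct (z ^ N) 1 (fun k => m k ^ N) := by
  induction N with
  | zero => intro k l hkl a; simp
  | succ N ih =>
    rw [pow_succ]
    refine (ih.mul h).congr (mul_one _) ?_
    funext k
    simp [pow_succ]

theorem case_field (hn : 3 ≤ n) {e : A} (he : e * e = e) {F : Type} [Field F] (f : A →+* F) (hf : Function.Surjective f)
    (hfe : ∀ a, f a = 0 ↔ e * a = 0) (π : Γ →* SL n A) (hπ : ∀ i j, i ≠ j → ∀ a, π (S.x i j a) = tv i j a)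
    {θ : Aˣ} (hθ : S.Gd θ) (hgθ : ∀ u : Fˣ, ∃ N : ℕ, (u : F) = f θ ^ N) {g : Γ} (hg : g ∈ (S.scale e he).XG Set.univ)
    (h1 : π g = 1) : g = 1 := by
  obtain ⟨T, hT⟩ := (S.scale e he).exists_desc f hf (by
    intro i j hij a ha
    rw [scale_x, (hfe a).mp ha, S.x_zero hij])
  have fe : f e = 1 := by
    have : f (1 - e) = 0 := by rw [hfe]; linear_combination -he
    rw [map_sub, map_one, sub_eq_zero] at this
    exact this.symm
  have lift : ∀ v : Fˣ, ∃ v' : Aˣ, f v' = v ∧ ∀ i j, i ≠ j → T.h i j v = S.h i j v' := by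
    intro v
    obtain ⟨a, ha⟩ := hf v
    obtain ⟨b, hb⟩ := hf ↑v⁻¹
    have hab : e * (a * b - 1) = 0 := by
      rw [← hfe, map_sub, map_mul, ha, hb, map_one, Units.mul_inv, sub_self]
    let v' : Aˣ := Units.mkOfMulEqOne (e * a + (1 - e)) (e * b + (1 - e)) (by linear_combination (1 - a - b + a * b) * he + hab)
    have hv' : (v' : A) = e * a + (1 - e) := rfl
    have fv : f v' = v := by rw [hv']; simp [fe, ha]
    refine ⟨v', fv, fun i j hij => ?_⟩
    rw [desc_h hT hij v' v fv.symm, ← S.scale_h hn he hij v']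
    rw [hv']; linear_combination (1 - a) * he
  have good : ∀ u, T.Gd u := by
    intro u i j k hij hik hjk v
    obtain ⟨v', -, hv⟩ := lift v
    obtain ⟨N, hN⟩ := hgθ u
    have c1 : Commute (S.h i j θ ^ N) (T.h i k v) := by
      rw [hv i k hik]
      exact (hθ i j k hij hik hjk v').pow_left N
    have m1 : T.MonAct (S.h i j θ) 1 (fun k => Units.map f.toMonoidHom (dg i j θ k)) := by
      intro k l hkl c
      obtain ⟨a, rfl⟩ := hf c
      rw [hT k l hkl, scale_x, S.h_mon hn hij θ k l hkl]
      have := hT k l hkl (↑(dg i j θ k) * a * ↑(dg i j θ l)⁻¹)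
      rw [scale_x] at this
      simp only [Equiv.Perm.one_apply]
      rw [show (↑(dg i j θ k) * (e * a) * ↑(dg i j θ l)⁻¹ : A) = e * (↑(dg i j θ k) * a * ↑(dg i j θ l)⁻¹) by ring, ← this]
      simp
    have m2 : T.MonAct (S.h i j θ ^ N) 1 (dg i j u) := by
      refine (m1.pow N).congr rfl ?_
      funext k
      have hu : u = Units.map f.toMonoidHom θ ^ N := by ext; simpa using hN
      simp only [dg]
      split_ifs
      · rw [hu]
      · rw [hu]; simp
      · simp
    have c2 := m2.cent (T.h_mon hn hij u) (T.h_mem hik v)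
    have := c1.mul_left c2
    rwa [mul_inv_cancel_left] at this
  have hgT : g ∈ T.XG Set.univ := by
    refine Subgroup.closure_mono ?_ hg
    rintro _ ⟨i, j, hij, h, a, rfl⟩
    exact ⟨i, j, hij, h, f a, (hT i j hij a).symm⟩
  refine T.field_pres ((mp f).comp π) ?_ hn (fun i j hij u v => T.tor_of_good hn good hij u v) hgT ?_
  · intro i j hij c
    obtain ⟨a, rfl⟩ := hf c
    rw [hT i j hij, scale_x, MonoidHom.comp_apply, hπ i j hij, mp_tv, map_mul, fe, one_mul]
  · rw [MonoidHom.comp_apply, h1, map_one]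
end
end StSys
end BG

namespace BG
namespace StSys

/-- the unit `1 + c` -/
def u1 {A : Type} [CommRing A] (c : A) (hc : c * c = 0) : Aˣ := Units.mkOfMulEqOne (1 + c) (1 - c) (by linear_combination -hc)

theorem u1_val {A : Type} [CommRing A] (c : A) (hc : c * c = 0) : (u1 c hc : A) = 1 + c := rfl
theorem u1_inv {A : Type} [CommRing A] (c : A) (hc : c * c = 0) : ((u1 c hc)⁻¹ : Aˣ) = 1 - c := rfl

/-- sign character -/
def chi {n : ℕ} (A : Type) [CommRing A] (i j k : Fin n) : A := if k = i then 1 else if k = j then -1 else 0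

section
variable {n : ℕ} {A : Type} [CommRing A] {Γ : Type} [Group Γ] (S : StSys n A Γ)

/-- diagonal commutator -/
def HH (i j : Fin n) (a s : A) : Γ := S.x i j (a * a * s) * S.x i j a * S.x j i s * (S.x i j a)⁻¹ * (S.x j i s)⁻¹

theorem conjH {i j : Fin n} (hij : i ≠ j) (a s : A) :
    S.x i j a * S.x j i s * (S.x i j a)⁻¹ = S.x i j (-(a * a * s)) * S.HH i j a s * S.x j i s := by
  rw [HH, S.x_neg hij]; group

theorem HH_acts {i j : Fin n} (hij : i ≠ j) (a s : A) (hs : s * s = 0) : S.Acts (S.HH i j a s) i j (1 + a * s) 0 0 (1 - a * s) := by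
  rw [HH, ← S.x_neg hij, ← S.x_neg hij.symm]
  have := ((((Acts.x (S := S) hij (a * a * s)).mul (Acts.x (S := S) hij a)).mul (Acts.x' (S := S) hij s)).mul (Acts.x (S := S) hij (-a))).mul (Acts.x' (S := S) hij (-s))
  refine this.congr ?_ ?_ ?_ ?_
  · linear_combination (a ^ 2 + a ^ 3 * s) * hs
  · linear_combination (-a ^ 3) * hs
  · linear_combination a * hs
  · ring

theorem HH_mon (hn : 3 ≤ n) {i j : Fin n} (hij : i ≠ j) (a s : A) (hs : s * s = 0) :
    S.MonAct (S.HH i j a s) 1 (dg i j (u1 (a * s) (by linear_combination (a * a) * hs))) :=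
  Acts.monDiag hn hij ((S.HH_acts hij a s hs).congr rfl rfl rfl rfl)

theorem HH_conj (hn : 3 ≤ n) {i j : Fin n} (hij : i ≠ j) (a s : A) (hs : s * s = 0) {k l : Fin n} (hkl : k ≠ l) (b : A) :
    S.HH i j a s * S.x k l b * (S.HH i j a s)⁻¹ = S.x k l (b + (chi A i j k - chi A i j l) * (a * s) * b) := by
  rw [S.HH_mon hn hij a s hs k l hkl b]
  simp only [Equiv.Perm.one_apply]
  congr 1
  have e1 : ∀ k, (dg i j (u1 (a * s) (by linear_combination (a * a) * hs)) k : A) = 1 + chi A i j k * (a * s) := by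
    intro k
    simp only [dg, chi]
    split_ifs
    · rw [u1_val]; ring
    · rw [u1_inv]; ring
    · simp
  have e2 : ∀ k, (((dg i j (u1 (a * s) (by linear_combination (a * a) * hs)) k)⁻¹ : Aˣ) : A) = 1 - chi A i j k * (a * s) := by
    intro k
    simp only [dg, chi]
    split_ifs
    · rw [u1_inv]; ring
    · rw [inv_inv, u1_val]; ring
    · simp
  rw [e1, e2]
  linear_combination (- chi A i j k * chi A i j l * a * a * b) * hs

theorem HH_comm (hn : 3 ≤ n) {i j : Fin n} (hij : i ≠ j) (a s : A) (hs : s * s = 0) {k l : Fin n} (hkl : k ≠ l) {b : A} (hb : s * b = 0) :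
    Commute (S.HH i j a s) (S.x k l b) := by
  have := S.HH_conj hn hij a s hs hkl b
  rw [show b + (chi A i j k - chi A i j l) * (a * s) * b = b by linear_combination ((chi A i j k - chi A i j l) * a) * hb,
    mul_inv_eq_iff_eq_mul] at this
  exact this

theorem conj_HH (hn : 3 ≤ n) {i j : Fin n} (hij : i ≠ j) (a s : A) (hs : s * s = 0) {k l : Fin n} (hkl : k ≠ l) (b : A) :
    S.x k l b * S.HH i j a s * (S.x k l b)⁻¹ = S.HH i j a s * S.x k l (-((chi A i j k - chi A i j l) * (a * s) * b)) := by
  set c := (chi A i j k - chi A i j l) * (a * s) with hc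
  have h1 := S.HH_conj hn hij a s hs hkl (b - c * b)
  rw [← hc, show b - c * b + c * (b - c * b) = b by rw [hc]; linear_combination (- (chi A i j k - chi A i j l) * (chi A i j k - chi A i j l) * a * a * b) * hs] at h1
  rw [show b - c * b = -(c * b) + b by ring, S.add k l hkl, S.x_neg hkl, mul_inv_eq_iff_eq_mul] at h1
  rw [S.x_neg hkl, ← h1]
  group

theorem HH_zero_left {i j : Fin n} (hij : i ≠ j) (s : A) : S.HH i j 0 s = 1 := by
  simp [HH, S.x_zero hij]
theorem HH_zero_right {i j : Fin n} (hij : i ≠ j) (a : A) : S.HH i j a 0 = 1 := by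
  simp [HH, S.x_zero hij, S.x_zero hij.symm]

theorem HH_add (hn : 3 ≤ n) {i j : Fin n} (hij : i ≠ j) (a b s : A) (hs : s * s = 0) :
    S.HH i j (a + b) s = S.HH i j a s * S.HH i j b s := by
  have h1 := S.conjH hij (a + b) s
  have h2 := S.conjH hij a s
  have h3 := S.conjH hij b s
  have h4 := S.conj_HH hn hij a s hs hij b
  have c0 : chi A i j i - chi A i j j = 2 := by simp [chi, hij.symm]; ring
  rw [c0] at h4
  have c1 : Commute (S.HH i j a s) (S.x i j (-(2 * (a * s) * b))) := S.HH_comm hn hij a s hs hij (by linear_combination (-2 * a * b) * hs)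
  have c2 : Commute (S.HH i j a s) (S.x i j (-(b * b * s))) := S.HH_comm hn hij a s hs hij (by linear_combination (-b * b) * hs)
  have h5 : S.x i j (a + b) * S.x j i s * (S.x i j (a + b))⁻¹ = S.x i j (-((a + b) * (a + b) * s)) * (S.HH i j a s * S.HH i j b s) * S.x j i s := by
    have e : S.x i j (a + b) = S.x i j b * S.x i j a := by rw [add_comm, S.add i j hij]
    have e0 : S.x i j (-((a + b) * (a + b) * s)) = S.x i j (-(a * a * s)) * (S.x i j (-(2 * (a * s) * b)) * S.x i j (-(b * b * s))) := by
      rw [← S.add i j hij, ← S.add i j hij]; congr 1; ring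
    have e1 : S.x i j b * S.x i j (-(a * a * s)) * (S.x i j b)⁻¹ = S.x i j (-(a * a * s)) := S.conj0 hij hij hij.symm hij _ _
    calc _ = S.x i j b * (S.x i j a * S.x j i s * (S.x i j a)⁻¹) * (S.x i j b)⁻¹ := by rw [e]; group
      _ = (S.x i j b * S.x i j (-(a * a * s)) * (S.x i j b)⁻¹) * (S.x i j b * S.HH i j a s * (S.x i j b)⁻¹) * (S.x i j b * S.x j i s * (S.x i j b)⁻¹) := by rw [h2]; group
      _ = S.x i j (-(a * a * s)) * (S.HH i j a s * S.x i j (-(2 * (a * s) * b))) * (S.x i j (-(b * b * s)) * S.HH i j b s * S.x j i s) := by rw [e1, h4, h3]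
      _ = S.x i j (-(a * a * s)) * S.x i j (-(2 * (a * s) * b)) * (S.HH i j a s * S.x i j (-(b * b * s))) * (S.HH i j b s * S.x j i s) := by rw [c1.eq]; group
      _ = _ := by rw [c2.eq, e0]; group
  rw [h1] at h5
  simpa using h5

theorem HH_neg (hn : 3 ≤ n) {i j : Fin n} (hij : i ≠ j) (a s : A) (hs : s * s = 0) :
    S.HH i j (-a) s = (S.HH i j a s)⁻¹ := by
  rw [eq_inv_iff_mul_eq_one, ← S.HH_add hn hij _ _ _ hs, neg_add_cancel, S.HH_zero_left hij]

/-- `HH` with both arguments in a square zero ideal -/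
theorem HH_J {i j : Fin n} (hij : i ≠ j) {s t : A} (hst : s * t = 0) :
    S.HH i j s t = S.x i j s * S.x j i t * (S.x i j s)⁻¹ * (S.x j i t)⁻¹ := by
  rw [HH, mul_assoc s, hst, mul_zero, S.x_zero hij, one_mul]

theorem HH_cent (hn : 3 ≤ n) (hgen : S.XG Set.univ = ⊤) {i j : Fin n} (hij : i ≠ j) {s t : A} (hst : s * t = 0) (ht : t * t = 0) (g : Γ) :
    Commute (S.HH i j s t) g := by
  refine S.cent_of ?_ (g := g) (by rw [hgen]; trivial)
  intro k l hkl b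
  have := S.HH_conj hn hij s t ht hkl b
  rw [hst, mul_zero, zero_mul, add_zero, mul_inv_eq_iff_eq_mul] at this
  exact this

theorem HH_E1 (hn : 3 ≤ n) (hgen : S.XG Set.univ = ⊤) {i j k : Fin n} (hij : i ≠ j) (hik : i ≠ k) (hjk : j ≠ k) {s t : A} (b : A) (hst : s * t = 0)
    (hs : s * s = 0) (ht : t * t = 0) : S.HH i j s (b * t) = S.HH i k (s * b) t := by
  rw [S.HH_J hij (by linear_combination b * hst)]
  have c0 := S.HH_cent hn hgen hik (s := s * b) (t := t) (by linear_combination b * hst) ht (S.x j i (b * t))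
  rw [S.HH_J hik (by linear_combination b * hst)] at c0 ⊢
  have h1 : S.x i j s * S.x j k b * (S.x i j s)⁻¹ = S.x i k (s * b) * S.x j k b := S.conj1 hij hjk hik s b
  have h2 : S.x i j s * S.x k i t * (S.x i j s)⁻¹ = S.x k i t := by
    rw [S.conj2 hik.symm hij hjk.symm, mul_comm t s, hst, neg_zero, S.x_zero hjk.symm, one_mul]
  have h3 : Commute (S.x i k (s * b)) (S.x j i (b * t)) := S.comm_mz hik hij.symm (fun h => hjk h.1) (by linear_combination (b * b) * hst)
  have h4 : S.x j i (b * t) = S.x j k b * S.x k i t * (S.x j k b)⁻¹ * (S.x k i t)⁻¹ := S.comm_eq hjk hik.symm hij.symm b t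
  have h5 : S.x i j s * S.x j i (b * t) * (S.x i j s)⁻¹ = S.x j i (b * t) * (S.x i k (s * b) * S.x k i t * (S.x i k (s * b))⁻¹ * (S.x k i t)⁻¹) := by
    rw [h4, conj_comm, h1, h2]
    calc _ = S.x i k (s * b) * (S.x j k b * S.x k i t * (S.x j k b)⁻¹ * (S.x k i t)⁻¹) * S.x k i t * (S.x i k (s * b))⁻¹ * (S.x k i t)⁻¹ := by group
      _ = _ := by rw [← h4, h3.eq]; group
  rw [h5, ← c0.eq]; group

end
end StSys
end BG

namespace BG
namespace StSys

theorem collect {Γ : Type} [Group Γ] {p1 H1 p2 p3 V y H2 : Γ} (a1 : Commute p1 H1) (a2 : Commute p1 p2) (a3 : Commute p1 p3) (a4 : Commute p1 V)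
    (b1 : Commute p2 p3) (b2 : Commute p2 V) (b3 : Commute p2 y) (c1 : Commute V y) (c2 : Commute V H2) (d1 : Commute p3 H1) (d2 : Commute y H2) :
    p1 * (H1 * p2) * (p3 * V) * (p1⁻¹ * y) * (p2⁻¹ * H2) * V⁻¹ = p3 * (H1 * H2) * y := by
  have e1 : Commute p1 (H1 * p2 * p3 * V) := ((a1.mul_right a2).mul_right a3).mul_right a4
  have e2 : Commute p2 (p3 * V * y) := (b1.mul_right b2).mul_right b3
  have e3 : Commute V (y * H2) := c1.mul_right c2
  calc _ = p1 * (H1 * p2 * p3 * V) * p1⁻¹ * y * p2⁻¹ * H2 * V⁻¹ := by group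
    _ = H1 * (p2 * (p3 * V * y)) * p2⁻¹ * H2 * V⁻¹ := by rw [e1.eq]; group
    _ = H1 * p3 * (V * (y * H2)) * V⁻¹ := by rw [e2.eq]; group
    _ = (H1 * p3) * (y * H2) := by rw [e3.eq]; group
    _ = _ := by rw [← d1.eq, d2.eq]; group

section
variable {n : ℕ} {A : Type} [CommRing A] {Γ : Type} [Group Γ] (S : StSys n A Γ)

theorem HH_good (hn : 3 ≤ n) (hgen : S.XG Set.univ = ⊤) {i j : Fin n} (hij : i ≠ j) {u : Aˣ} (hu : S.Gd u) (s : A) (hs : s * s = 0) :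
    S.HH i j u s = S.HH i j 1 (u * s) := by
  obtain ⟨k, hi, hj⟩ := exists_third hn i j
  have hus : (u * s : A) * (u * s) = 0 := by linear_combination (u * u : A) * hs
  have m1 := S.HH_mon hn hij 1 (u * s) hus
  have c1 := (S.h_mon hn hij _).cent m1 (g := S.h i k u) (by rw [hgen]; trivial)
  have c2 := hu i k j hi.symm hij hj (u1 (1 * (u * s)) (by linear_combination hus))
  have c3 := c2.mul_right c1.symm
  rw [mul_inv_cancel_left] at c3
  have mz := S.h_mon hn hi.symm u
  have e1 : ∀ a, S.h i k u * S.x i j a * (S.h i k u)⁻¹ = S.x i j (u * a) := by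
    intro a
    rw [mz i j hij a]
    simp [dg, hij.symm, hj.symm]
  have e2 : ∀ a, S.h i k u * S.x j i a * (S.h i k u)⁻¹ = S.x j i (a * ↑u⁻¹) := by
    intro a
    rw [mz j i hij.symm a]
    simp [dg, hij.symm, hj.symm]
  have e3 : S.h i k u * S.HH i j 1 (u * s) * (S.h i k u)⁻¹ = S.HH i j u s := by
    have : S.h i k u * S.HH i j 1 (u * s) * (S.h i k u)⁻¹ = (S.h i k u * S.x i j (1 * 1 * (u * s)) * (S.h i k u)⁻¹) * (S.h i k u * S.x i j 1 * (S.h i k u)⁻¹)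
      * (S.h i k u * S.x j i (u * s) * (S.h i k u)⁻¹) * (S.h i k u * S.x i j 1 * (S.h i k u)⁻¹)⁻¹ * (S.h i k u * S.x j i (u * s) * (S.h i k u)⁻¹)⁻¹ := by
      rw [HH]; group
    rw [this, e1, e1, e2, HH]
    have e4 : (u * s * ↑u⁻¹ : A) = s := by rw [mul_comm (u:A), mul_assoc, Units.mul_inv, mul_one]
    rw [e4, mul_one, mul_one, one_mul, ← mul_assoc]
  rw [← e3, c3.eq, mul_inv_cancel_right]

theorem HH_diag (hn : 3 ≤ n) (hgen : S.XG Set.univ = ⊤) {i j : Fin n} (hij : i ≠ j) (hu : S.Gd (-1)) (s : A) (hs : s * s = 0) :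
    S.HH i j s s = 1 := by
  have h0 : S.HH i j 1 (-s) = (S.HH i j 1 s)⁻¹ := by
    have := S.HH_good hn hgen hij hu s hs
    rw [Units.val_neg, Units.val_one, neg_one_mul] at this
    rw [← this, S.HH_neg hn hij _ _ hs]
  have h1 := S.conjH hij 1 s
  have h2 := S.conjH hij 1 (-s)
  rw [h0, S.x_neg hij.symm, ← conj_inv, h1] at h2
  have c1 : Commute (S.HH i j 1 s) (S.x i j s) := S.HH_comm hn hij 1 s hs hij hs
  have c2 : Commute (S.HH i j 1 s) (S.x j i s) := S.HH_comm hn hij 1 s hs hij.symm hs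
  rw [mul_neg, mul_one, one_mul, neg_neg, S.x_neg hij] at h2
  generalize S.HH i j 1 s = H at *
  rw [S.HH_J hij hs]
  generalize S.x i j s = x at *
  generalize S.x j i s = y at *
  have h3 : y⁻¹ * H⁻¹ * x = x * H⁻¹ * y⁻¹ := by rw [← h2]; group
  have h4 : x * y⁻¹ = y⁻¹ * x := by
    have e1 := c2.inv_left.inv_right.eq
    have e2 := c1.inv_left.eq
    have e3 : H⁻¹ * (y⁻¹ * x) = H⁻¹ * (x * y⁻¹) := by
      rw [← mul_assoc, e1, h3, ← e2, mul_assoc]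
    exact (mul_left_cancel e3).symm
  have h5 : y * x = x * y := by
    calc y * x = y * (x * y⁻¹) * y := by group
      _ = _ := by rw [h4]; group
  rw [← h5]; group

variable {J : Ideal A} 

theorem HH_JJ (hn : 3 ≤ n) (hgen : S.XG Set.univ = ⊤) (hu : S.Gd (-1)) {s₀ : A} (hs₀ : s₀ * s₀ = 0)
    (hsq : ∀ c : A, ∃ x y : A, c * s₀ = (x * x - y * y) * s₀) {i j : Fin n} (hij : i ≠ j) (a b : A) :
    S.HH i j (a * s₀) (b * s₀) = 1 := by
  have key : ∀ i k, i ≠ k → ∀ c, S.HH i k (c * s₀) s₀ = 1 := by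
    intro i k hik c
    obtain ⟨j, hi, hk⟩ := exists_third hn i k
    obtain ⟨x, y, hxy⟩ := hsq c
    have q : ∀ x, S.HH i k (x * x * s₀) s₀ = 1 := by
      intro x
      have := S.HH_E1 hn hgen hi.symm hik hk (s := x * s₀) (t := s₀) x (by linear_combination x * hs₀) (by linear_combination x * x * hs₀) hs₀
      rw [S.HH_diag hn hgen hi.symm hu (x * s₀) (by linear_combination x * x * hs₀)] at this
      rw [this]; congr 1; ring
    rw [hxy, show (x * x - y * y) * s₀ = x * x * s₀ + -(y * y * s₀) by ring, S.HH_add hn hik _ _ _ hs₀, S.HH_neg hn hik _ _ hs₀, q, q]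
    simp
  obtain ⟨k, hi, hj⟩ := exists_third hn i j
  rw [S.HH_E1 hn hgen hij hi.symm hj.symm b (by linear_combination a * hs₀) (by linear_combination a * a * hs₀) hs₀,
    show a * s₀ * b = a * b * s₀ by ring, key i k hi.symm]

/-- commutativity of the `J`-parts -/
def CJ (J : Ideal A) : Prop := (∀ s ∈ J, ∀ t ∈ J, s * t = 0) ∧ ∀ i j, i ≠ j → ∀ k l, k ≠ l → ∀ s ∈ J, ∀ t ∈ J, Commute (S.x i j s) (S.x k l t)

theorem CJ_of (hn : 3 ≤ n) (hgen : S.XG Set.univ = ⊤) (hu : S.Gd (-1)) {s₀ : A} (hs₀ : s₀ * s₀ = 0)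
    (hsq : ∀ c : A, ∃ x y : A, c * s₀ = (x * x - y * y) * s₀) (hJ : ∀ s ∈ J, ∃ a, s = a * s₀) : S.CJ J := by
  have h1 : ∀ s ∈ J, ∀ t ∈ J, s * t = 0 := by
    intro s hs t ht
    obtain ⟨a, rfl⟩ := hJ s hs
    obtain ⟨b, rfl⟩ := hJ t ht
    linear_combination a * b * hs₀
  refine ⟨h1, ?_⟩
  intro i j hij k l hkl s hs t ht
  by_cases ho : k = j ∧ l = i
  · obtain ⟨rfl, rfl⟩ := ho
    have := S.HH_J hij (h1 s hs t ht)
    obtain ⟨a, rfl⟩ := hJ s hs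
    obtain ⟨b, rfl⟩ := hJ t ht
    rw [S.HH_JJ hn hgen hu hs₀ hsq hij] at this
    exact (commutatorElement_eq_one_iff_commute.mp (by rw [commutatorElement_def]; exact this.symm))
  · exact S.comm_mz hij hkl ho (h1 s hs t ht)

variable {S} (hC : S.CJ J)

theorem CJ.HH_x (hC : S.CJ J) (hn : 3 ≤ n) {i j k l : Fin n} (hij : i ≠ j) (hkl : k ≠ l) (a : A) {s t : A} (hs : s ∈ J) (ht : t ∈ J) :
    Commute (S.HH i j a s) (S.x k l t) := S.HH_comm hn hij a s (hC.1 s hs s hs) hkl (hC.1 s hs t ht)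

theorem CJ.HH_HH (hC : S.CJ J) (hn : 3 ≤ n) {i j k l : Fin n} (hij : i ≠ j) (hkl : k ≠ l) (a b : A) {s t : A} (hs : s ∈ J) (ht : t ∈ J) :
    Commute (S.HH i j a s) (S.HH k l b t) := by
  have hh := S.conj_HH hn hkl b t (hC.1 t ht t ht) (k := i) (l := j) hij 
  have e1 : ∀ c, S.x i j c * S.HH k l b t * (S.x i j c)⁻¹ = S.HH k l b t * S.x i j (-((chi A k l i - chi A k l j) * (b * t) * c)) := hh
  -- write HH i j a s as a product of x i j (J) and x_ij(a) x_ji(s) x_ij(a)⁻¹ x_ji(s)⁻¹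
  have c0 : ∀ p q, p ≠ q → ∀ r ∈ J, Commute (S.HH k l b t) (S.x p q r) := fun p q hpq r hr => hC.HH_x hn hkl hpq b ht hr
  set c := (chi A k l i - chi A k l j) * (b * t) * a with hc
  have hcJ : c ∈ J := by
    rw [hc, show (chi A k l i - chi A k l j) * (b * t) * a = ((chi A k l i - chi A k l j) * b * a) * t by ring]
    exact J.mul_mem_left _ ht
  have c1 : Commute (S.x i j a * S.x j i s * (S.x i j a)⁻¹) (S.HH k l b t) := by
    have e2 := e1 (-a)
    rw [S.x_neg hij, inv_inv] at e2
    have e3 : (S.x i j a)⁻¹ * S.HH k l b t * S.x i j a = S.HH k l b t * S.x i j c := by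
      rw [e2]; congr 2; rw [hc]; ring
    have c2 : Commute (S.x j i s) (S.HH k l b t * S.x i j c) := (c0 j i hij.symm s hs).symm.mul_right (hC.2 j i hij.symm i j hij s hs c hcJ)
    rw [← e3] at c2
    have c4 := congrArg (fun g => S.x i j a * g * (S.x i j a)⁻¹) c2.eq
    change _ = _
    calc _ = S.x i j a * (S.x j i s * ((S.x i j a)⁻¹ * S.HH k l b t * S.x i j a)) * (S.x i j a)⁻¹ := by group
      _ = _ := by rw [c4]; group
  rw [HH]
  have d1 := (c0 i j hij (a * a * s) (J.mul_mem_left _ hs)).symm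
  have d2 := (c0 j i hij.symm s hs).symm.inv_left
  have := (d1.mul_left c1).mul_left d2
  simpa only [mul_assoc] using this

theorem CJ.HH_add_right (hC : S.CJ J) (hn : 3 ≤ n) {i j : Fin n} (hij : i ≠ j) (a : A) {s t : A} (hs : s ∈ J) (ht : t ∈ J) :
    S.HH i j a (s + t) = S.HH i j a s * S.HH i j a t := by
  have h1 := S.conjH hij a (s + t)
  rw [S.add j i hij.symm] at h1
  have h2 : S.x i j a * (S.x j i s * S.x j i t) * (S.x i j a)⁻¹ = S.x i j (-(a * a * (s + t))) * (S.HH i j a s * S.HH i j a t) * (S.x j i s * S.x j i t) := by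
    have e1 : S.x i j (-(a * a * (s + t))) = S.x i j (-(a * a * s)) * S.x i j (-(a * a * t)) := by
      rw [← S.add i j hij]; congr 1; ring
    have mt : -(a * a * t) ∈ J := J.neg_mem (J.mul_mem_left _ ht)
    have c1 : Commute (S.x j i s) (S.x i j (-(a * a * t)) * S.HH i j a t) := (hC.2 j i hij.symm i j hij s hs _ mt).mul_right (hC.HH_x hn hij hij.symm a ht hs).symm
    have c2 := hC.HH_x hn hij hij a hs mt
    calc _ = (S.x i j a * S.x j i s * (S.x i j a)⁻¹) * (S.x i j a * S.x j i t * (S.x i j a)⁻¹) := by group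
      _ = S.x i j (-(a * a * s)) * S.HH i j a s * (S.x j i s * (S.x i j (-(a * a * t)) * S.HH i j a t)) * S.x j i t := by rw [S.conjH hij, S.conjH hij]; group
      _ = S.x i j (-(a * a * s)) * (S.HH i j a s * S.x i j (-(a * a * t))) * S.HH i j a t * S.x j i s * S.x j i t := by rw [c1.eq]; group
      _ = _ := by rw [c2.eq, e1]; group
  rw [h2] at h1
  simpa using h1.symm

theorem CJ.HH_R (hC : S.CJ J) (hn : 3 ≤ n) {i j k : Fin n} (hij : i ≠ j) (hik : i ≠ k) (hjk : j ≠ k) (a b : A) {s : A} (hs : s ∈ J) :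
    S.HH i j a (b * s) = S.HH j k b (-(s * a)) * S.HH i k (a * b) s := by
  have mJ : ∀ c, c * s ∈ J := fun c => J.mul_mem_left c hs
  have mV : -(s * a) ∈ J := J.neg_mem (J.mul_mem_right _ hs)
  have ss := hC.1 s hs s hs
  have v1 : S.x i j a * S.x j k b * (S.x i j a)⁻¹ = S.x i k (a * b) * S.x j k b := S.conj1 hij hjk hik a b
  have v2 : S.x i j a * S.x k i s * (S.x i j a)⁻¹ = S.x k j (-(s * a)) * S.x k i s := S.conj2 hik.symm hij hjk.symm s a
  have v3 : S.x j i (b * s) = S.x j k b * S.x k i s * (S.x j k b)⁻¹ * (S.x k i s)⁻¹ := S.comm_eq hjk hik.symm hij.symm b s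
  have v4 : S.x j k b * S.x k j (-(s * a)) * (S.x j k b)⁻¹ = S.x j k (b * b * a * s) * S.HH j k b (-(s * a)) * S.x k j (-(s * a)) := by
    rw [S.conjH hjk]; congr 3; ring
  have v5 : S.x j k b * S.x k i s * (S.x j k b)⁻¹ = S.x j i (b * s) * S.x k i s := S.conj1 hjk hik.symm hij.symm b s
  have u1 : S.x i k (a * b) * S.x j k (b * b * a * s) * (S.x i k (a * b))⁻¹ = S.x j k (b * b * a * s) := S.conj0 hik hjk hjk.symm hik _ _
  have u2 : S.x i k (a * b) * S.HH j k b (-(s * a)) * (S.x i k (a * b))⁻¹ = S.HH j k b (-(s * a)) * S.x i k (a * a * b * b * s) := by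
    rw [S.conj_HH hn hjk b _ (hC.1 _ mV _ mV) hik]
    congr 2
    simp only [chi, hij, hik, hjk.symm, if_true, if_false]; ring
  have u3 : S.x i k (a * b) * S.x k j (-(s * a)) * (S.x i k (a * b))⁻¹ = S.x i j (-(a * a * (b * s))) * S.x k j (-(s * a)) := by
    rw [S.conj1 hik hjk.symm hij]; congr 2; ring
  have u4 : S.x i k (a * b) * S.x j i (b * s) * (S.x i k (a * b))⁻¹ = (S.x j k (b * b * a * s))⁻¹ * S.x j i (b * s) := by
    rw [S.conj2 hij.symm hik hjk, ← S.x_neg hjk]; congr 2; ring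
  have u5 : S.x i k (a * b) * S.x k i s * (S.x i k (a * b))⁻¹ = (S.x i k (a * a * b * b * s))⁻¹ * S.HH i k (a * b) s * S.x k i s := by
    rw [S.conjH hik, ← S.x_neg hik]; congr 3; ring
  have h1 := S.conjH hij a (b * s)
  have mp3 : -(a * a * (b * s)) ∈ J := J.neg_mem (J.mul_mem_left _ (mJ b))
  have h2 : S.x i j a * S.x j i (b * s) * (S.x i j a)⁻¹ = S.x i j (-(a * a * (b * s))) * (S.HH j k b (-(s * a)) * S.HH i k (a * b) s) * S.x j i (b * s) := by
    rw [← collect (p1 := S.x j k (b * b * a * s)) (p2 := S.x i k (a * a * b * b * s)) (V := S.x k j (-(s * a)))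
      (hC.HH_x hn hjk hjk b mV (mJ _)).symm (hC.2 j k hjk i k hik _ (mJ _) _ (mJ _)) (hC.2 j k hjk i j hij _ (mJ _) _ mp3) (hC.2 j k hjk k j hjk.symm _ (mJ _) _ mV)
      (hC.2 i k hik i j hij _ (mJ _) _ mp3) (hC.2 i k hik k j hjk.symm _ (mJ _) _ mV) (hC.2 i k hik j i hij.symm _ (mJ _) _ (mJ _))
      (hC.2 k j hjk.symm j i hij.symm _ mV _ (mJ _)) (hC.HH_x hn hik hjk.symm _ hs mV).symm (hC.HH_x hn hjk hij b mV mp3).symm (hC.HH_x hn hik hij.symm _ hs (mJ _)).symm]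
    rw [← u2, ← u3, ← u4, eq_mul_inv_of_mul_eq u5.symm]
    nth_rewrite 1 [← u1]
    nth_rewrite 1 [v3]
    rw [conj_comm, v1, v2]
    generalize S.x k i s = K at *
    calc _ = S.x i k (a * b) * (S.x j k b * S.x k j (-(s * a)) * (S.x j k b)⁻¹) * (S.x j k b * K * (S.x j k b)⁻¹) * (S.x i k (a * b))⁻¹ * K⁻¹ * (S.x k j (-(s * a)))⁻¹ := by group
      _ = _ := by rw [v4, v5]; group
  rw [h2] at h1
  simpa using h1.symm

theorem CJ.HH_lin (hC : S.CJ J) (hn : 3 ≤ n) (hgen : S.XG Set.univ = ⊤)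
    (hcl : Subring.closure ({a : A | ∃ u : Aˣ, S.Gd u ∧ (u : A) = a} ∪ {f : A | f * f = f}) = ⊤)
    (hid : ∀ f : A, f * f = f → (∀ s ∈ J, f * s = 0) ∨ (∀ s ∈ J, f * s = s)) 
    (a : A) : ∀ i j, i ≠ j → ∀ s ∈ J, S.HH i j a s = S.HH i j 1 (a * s) := by
  have sq : ∀ s ∈ J, s * s = 0 := fun s hs => hC.1 s hs s hs
  have ha : a ∈ Subring.closure ({a : A | ∃ u : Aˣ, S.Gd u ∧ (u : A) = a} ∪ {f : A | f * f = f}) := by rw [hcl]; trivial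
  have kill : ∀ f : A, f * f = f → (∀ s ∈ J, f * s = 0) → ∀ i j, i ≠ j → ∀ s ∈ J, S.HH i j f s = 1 := by
    intro f hf h0 i j hij s hs
    have c := S.comm_split hn hij.symm (s := s) (a := f) (a' := f) (by rw [mul_comm, h0 s hs]) (by rw [mul_comm, h0 s hs])
    rw [hf] at c
    rw [HH, mul_assoc f, h0 s hs, mul_zero, S.x_zero hij, one_mul, ← c.eq]; group
  have one0 : ∀ i j, i ≠ j → S.HH i j 1 0 = 1 := fun i j hij => S.HH_zero_right hij 1
  induction ha using Subring.closure_induction with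
  | mem a ha =>
    intro i j hij s hs
    rcases ha with ⟨u, hu, rfl⟩ | hf
    · exact S.HH_good hn hgen hij hu s (sq s hs)
    · have hf : a * a = a := hf
      rcases hid a hf with h0 | h0
      · rw [h0 s hs, one0 i j hij, kill a hf h0 i j hij s hs]
      · rw [h0 s hs]
        have := S.HH_add hn hij a (1 - a) s (sq s hs)
        rw [add_sub_cancel, kill (1 - a) (by linear_combination hf) (fun s hs => by linear_combination -(h0 s hs)) i j hij s hs, mul_one] at this
        exact this.symm
  | zero => intro i j hij s hs; rw [zero_mul, one0 i j hij, S.HH_zero_left hij]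
  | one => intro i j hij s hs; rw [one_mul]
  | add x y _ _ hx hy => 
    intro i j hij s hs
    rw [S.HH_add hn hij _ _ _ (sq s hs), hx i j hij s hs, hy i j hij s hs, add_mul, hC.HH_add_right hn hij 1 (J.mul_mem_left _ hs) (J.mul_mem_left _ hs)]
  | neg x _ hx =>
    intro i j hij s hs
    have m := J.mul_mem_left x hs
    rw [S.HH_neg hn hij _ _ (sq s hs), hx i j hij s hs, inv_eq_iff_mul_eq_one, ← hC.HH_add_right hn hij 1 m (by rw [neg_mul]; exact J.neg_mem m),
      ← add_mul, add_neg_cancel, zero_mul, one0 i j hij]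
  | mul x y _ _ hx hy =>
    intro i k hik s hs
    obtain ⟨j, hi, hk⟩ := exists_third hn i k
    have r1 := hC.HH_R hn hi.symm hik hk x y hs
    have r2 := hC.HH_R hn hi.symm hik hk 1 1 (J.mul_mem_left (x * y) hs)
    rw [hx i j hi.symm _ (J.mul_mem_left _ hs), hy j k hk _ (J.neg_mem (J.mul_mem_right _ hs))] at r1
    rw [one_mul, mul_one, mul_one] at r2
    rw [← mul_assoc, r2, show y * -(s * x) = -(x * y * s) by ring] at r1
    exact (mul_left_cancel r1).symm

end
end StSys
end BG

namespace BG
namespace StSys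
section
variable {n : ℕ} {A : Type} [CommRing A] {Γ : Type} [Group Γ] {S : StSys n A Γ} {J : Ideal A}

theorem CJ.hh_sum (hC : S.CJ J) (hn : 3 ≤ n) {i j k : Fin n} (hij : i ≠ j) (hik : i ≠ k) (hjk : j ≠ k) {s : A} (hs : s ∈ J) :
    S.HH i j 1 s = S.HH j k 1 (-s) * S.HH i k 1 s := by
  have := hC.HH_R hn hij hik hjk 1 1 hs
  simpa using this

theorem CJ.hh_neg (hC : S.CJ J) (hn : 3 ≤ n) {i j : Fin n} (hij : i ≠ j) {s : A} (hs : s ∈ J) :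
    S.HH i j 1 (-s) = (S.HH i j 1 s)⁻¹ := by
  rw [eq_inv_iff_mul_eq_one, ← hC.HH_add_right hn hij 1 (J.neg_mem hs) hs, neg_add_cancel, S.HH_zero_right hij]

theorem CJ.hh_symm (hC : S.CJ J) (hn : 3 ≤ n) {j k : Fin n} (hjk : j ≠ k) {s : A} (hs : s ∈ J) :
    S.HH k j 1 s = S.HH j k 1 (-s) := by
  obtain ⟨i, hj, hk⟩ := exists_third hn j k
  have h1 := hC.hh_sum hn hj hk hjk hs
  have h2 := hC.hh_sum hn hk hj hjk.symm hs
  rw [h2, ← mul_assoc, hC.hh_neg hn hjk hs, hC.hh_neg hn hjk.symm hs] at h1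
  have h3 := mul_eq_right.mp h1.symm
  rw [hC.hh_neg hn hjk hs]
  rw [mul_eq_one_iff_eq_inv, inv_inv] at h3
  exact h3.symm

variable (S) in
/-- generators of the `J`-part -/
def ff (z : Fin n) (p : Fin n × Fin n) (s : A) : Γ :=
  if p.1 ≠ p.2 then S.x p.1 p.2 s else if p.1 ≠ z then S.HH p.1 z 1 s else 1

theorem ff_x (z : Fin n) {k l : Fin n} (hkl : k ≠ l) (s : A) : S.ff z (k, l) s = S.x k l s := by simp [ff, hkl]
theorem ff_h (z : Fin n) {k : Fin n} (hk : k ≠ z) (s : A) : S.ff z (k, k) s = S.HH k z 1 s := by simp [ff, hk]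

variable (S) (J) in
/-- the `J`-part -/
def MJ (z : Fin n) : Subgroup Γ := Subgroup.closure {t | ∃ p, p ≠ (z, z) ∧ ∃ s ∈ J, t = S.ff z p s}

theorem ff_mem (z : Fin n) {p : Fin n × Fin n} (hp : p ≠ (z, z)) {s : A} (hs : s ∈ J) : S.ff z p s ∈ S.MJ J z :=
  Subgroup.subset_closure ⟨p, hp, s, hs, rfl⟩

theorem x_MJ (z : Fin n) {k l : Fin n} (hkl : k ≠ l) {s : A} (hs : s ∈ J) : S.x k l s ∈ S.MJ J z := by
  rw [← ff_x (S := S) z hkl]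
  refine ff_mem z ?_ hs
  intro h; rw [Prod.mk.injEq] at h; exact hkl (h.1.trans h.2.symm)

theorem CJ.hh_MJ (hC : S.CJ J) (hn : 3 ≤ n) (z : Fin n) {k l : Fin n} (hkl : k ≠ l) {s : A} (hs : s ∈ J) : S.HH k l 1 s ∈ S.MJ J z := by
  have key : ∀ k, k ≠ z → ∀ s ∈ J, S.HH k z 1 s ∈ S.MJ J z := by
    intro k hk s hs
    rw [← ff_h (S := S) z hk]
    refine ff_mem z ?_ hs
    intro h; rw [Prod.mk.injEq] at h; exact hk h.1
  by_cases hl : l = z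
  · subst hl; exact key k hkl s hs
  · by_cases hk : k = z
    · subst hk; rw [hC.hh_symm hn hl hs]; exact key l hl _ (J.neg_mem hs)
    · rw [hC.hh_sum hn hkl hk hl hs]
      exact mul_mem (key l hl _ (J.neg_mem hs)) (key k hk _ hs)

theorem CJ.MJ_conj (hC : S.CJ J) (hn : 3 ≤ n) (hlin : ∀ a i j, i ≠ j → ∀ s ∈ J, S.HH i j a s = S.HH i j 1 (a * s)) (z : Fin n)
    {k l : Fin n} (hkl : k ≠ l) (a : A) {u : Γ} (hu : u ∈ S.MJ J z) : S.x k l a * u * (S.x k l a)⁻¹ ∈ S.MJ J z := by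
  refine conj_closure ?_ hu
  rintro t ⟨⟨i, j⟩, hp, s, hs, rfl⟩
  by_cases hij : i = j
  · subst hij
    have hi : i ≠ z := fun h => hp (by rw [h])
    rw [ff_h z hi, S.conj_HH hn hi 1 s (hC.1 s hs s hs) hkl]
    refine mul_mem (hC.hh_MJ hn z hi hs) (x_MJ z hkl (J.neg_mem ?_))
    rw [one_mul, mul_right_comm]
    exact J.mul_mem_left _ hs
  · rw [ff_x z hij]
    by_cases hli : l = i
    · subst hli
      by_cases hjk : j = k
      · subst hjk
        rw [S.conjH hkl, hlin a _ _ hkl s hs]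
        exact mul_mem (mul_mem (x_MJ z hkl (J.neg_mem (J.mul_mem_left _ hs))) (hC.hh_MJ hn z hkl (J.mul_mem_left _ hs))) (x_MJ z hij hs)
      · rw [S.conj1 hkl hij (Ne.symm hjk)]
        exact mul_mem (x_MJ z (Ne.symm hjk) (J.mul_mem_left _ hs)) (x_MJ z hij hs)
    · by_cases hjk : j = k
      · subst hjk
        rw [S.conj2 hij hkl (Ne.symm hli)]
        exact mul_mem (x_MJ z (Ne.symm hli) (J.neg_mem (J.mul_mem_right _ hs))) (x_MJ z hij hs)
      · rw [S.conj0 hkl hij hli (Ne.symm hjk)]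
        exact x_MJ z hij hs

theorem CJ.MJ_normal (hC : S.CJ J) (hn : 3 ≤ n) (hgen : S.XG Set.univ = ⊤) (hlin : ∀ a i j, i ≠ j → ∀ s ∈ J, S.HH i j a s = S.HH i j 1 (a * s)) (z : Fin n) :
    (S.MJ J z).Normal := by
  refine ⟨fun u hu g => ?_⟩
  have hg : g ∈ S.XG Set.univ := by rw [hgen]; trivial
  refine S.XG_induction (p := fun g => g * u * g⁻¹ ∈ S.MJ J z) ?_ ?_ hg
  · simpa using hu
  · intro i j hij _ a g _ ih
    have := hC.MJ_conj hn hlin z hij a ih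
    convert this using 1
    group

theorem CJ.ff_add (hC : S.CJ J) (hn : 3 ≤ n) (z : Fin n) (p : Fin n × Fin n) {s t : A} (hs : s ∈ J) (ht : t ∈ J) :
    S.ff z p (s + t) = S.ff z p s * S.ff z p t := by
  unfold ff
  split_ifs with h1 h2
  · exact S.add _ _ h1 s t
  · exact hC.HH_add_right hn h2 1 hs ht
  · simp

theorem CJ.ff_comm (hC : S.CJ J) (hn : 3 ≤ n) (z : Fin n) (p q : Fin n × Fin n) {s t : A} (hs : s ∈ J) (ht : t ∈ J) :
    Commute (S.ff z p s) (S.ff z q t) := by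
  unfold ff
  split_ifs with h1 h2 h3 h4 h5 h6 h7
  · exact hC.2 _ _ h1 _ _ h2 s hs t ht
  · exact (hC.HH_x hn h3 h1 1 ht hs).symm
  · exact Commute.one_right _
  · exact hC.HH_x hn h4 h5 1 hs ht
  · exact hC.HH_HH hn h4 h6 1 1 hs ht
  all_goals simp

theorem mat_HH {i j : Fin n} (hij : i ≠ j) {s : A} (hs : s * s = 0) (π : Γ →* SL n A) (hπ : ∀ i j, i ≠ j → ∀ a, π (S.x i j a) = tv i j a) (g : SL n A) (a b : Fin n) :
    mat (π (S.HH i j 1 s) * g) a b = mat g a b + chi A i j a * s * mat g a b := by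
  rw [HH, ← S.x_neg hij, ← S.x_neg hij.symm]
  simp only [map_mul, hπ i j hij, hπ j i hij.symm, mul_assoc]
  by_cases hi : a = i
  · subst hi
    simp only [tv_mul_apply hij, tv_mul_apply hij.symm, chi, if_true, hij, hij.symm, if_false]
    linear_combination (mat g a b - mat g j b + s * mat g a b) * hs
  · by_cases hj : a = j
    · subst hj
      simp only [tv_mul_apply hij, tv_mul_apply hij.symm, chi, if_true, hij, hij.symm, if_false]
      linear_combination (mat g i b) * hs
    · simp only [tv_mul_apply hij, tv_mul_apply hij.symm, chi, hi, hj, if_false]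
      ring

theorem CJ.mat_ff (hC : S.CJ J) (z : Fin n) {p : Fin n × Fin n} (hp : p ≠ (z, z)) {s : A} (hs : s ∈ J) (π : Γ →* SL n A)
    (hπ : ∀ i j, i ≠ j → ∀ a, π (S.x i j a) = tv i j a) {g : SL n A} (hg : ∀ a b, mat g a b - (1 : Matrix (Fin n) (Fin n) A) a b ∈ J) :
    (∀ a b, mat (π (S.ff z p s) * g) a b - (1 : Matrix (Fin n) (Fin n) A) a b ∈ J) ∧
    ∀ a b, (a, b) ≠ (z, z) → mat (π (S.ff z p s) * g) a b = mat g a b + if (a, b) = p then s else 0 := by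
  obtain ⟨k, l⟩ := p
  have hsg : ∀ a b, s * mat g a b = s * (1 : Matrix (Fin n) (Fin n) A) a b := fun a b => by linear_combination hC.1 s hs _ (hg a b)
  by_cases hkl : k = l
  · subst hkl
    have hk : k ≠ z := fun h => hp (by rw [h])
    rw [ff_h z hk]
    simp only [mat_HH hk (hC.1 s hs s hs) π hπ, mul_assoc, hsg]
    constructor
    · intro a b
      rw [add_sub_right_comm]
      refine J.add_mem (hg a b) (J.mul_mem_left _ (J.mul_mem_right _ hs))
    · intro a b hab
      congr 1
      simp only [chi, Matrix.one_apply, Prod.mk.injEq, ne_eq] at hab ⊢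
      by_cases h1 : a = b
      · subst h1
        by_cases h2 : a = k
        · subst h2; simp
        · have : a ≠ z := fun h => hab ⟨h, h⟩
          simp [h2, this]
      · have : ¬ (a = k ∧ b = k) := fun h => h1 (h.1.trans h.2.symm)
        simp [h1, this]
  · rw [ff_x z hkl, hπ k l hkl]
    simp only [tv_mul_apply hkl, hsg]
    constructor
    · intro a b
      rw [add_sub_right_comm]
      refine J.add_mem (hg a b) ?_
      split_ifs
      · exact J.mul_mem_right _ hs
      · exact J.zero_mem
    · intro a b _
      congr 1
      simp only [Matrix.one_apply, Prod.mk.injEq]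
      by_cases h1 : a = k
      · by_cases h2 : l = b
        · simp [h1, h2]
        · simp [h1, h2, Ne.symm h2]
      · simp [h1]

theorem CJ.case_sqz (hC : S.CJ J) (hn : 3 ≤ n) (hgen : S.XG Set.univ = ⊤) (hlin : ∀ a i j, i ≠ j → ∀ s ∈ J, S.HH i j a s = S.HH i j 1 (a * s))
    (π : Γ →* SL n A) (hπ : ∀ i j, i ≠ j → ∀ a, π (S.x i j a) = tv i j a) {g : Γ}
    (hg : g ∈ Subgroup.normalClosure {t | ∃ i j, i ≠ j ∧ ∃ s ∈ J, t = S.x i j s}) (h1 : π g = 1) : g = 1 := by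
  let z : Fin n := ⟨0, by omega⟩
  have hM : g ∈ S.MJ J z := by
    have := hC.MJ_normal hn hgen hlin z
    refine Subgroup.normalClosure_le_normal (N := S.MJ J z) ?_ hg
    rintro t ⟨i, j, hij, s, hs, rfl⟩
    exact x_MJ z hij hs
  clear hg
  let ϕ : Fin n × Fin n → Multiplicative J →* Γ := fun p => MonoidHom.mk' (fun s : Multiplicative J => S.ff z p (Multiplicative.toAdd s : J))
    (fun s t => hC.ff_add hn z p (Multiplicative.toAdd s).2 (Multiplicative.toAdd t).2)
  obtain ⟨Φ, hΦ0, hΦ⟩ := exists_param ϕ (fun p q _ a b => hC.ff_comm hn z p q (Multiplicative.toAdd a).2 (Multiplicative.toAdd b).2)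
  have hΦ' : ∀ p (s : J) c, S.ff z p s * Φ c = Φ (Pi.single p s + c) := fun p s c => hΦ p s c
  have key : ∀ g ∈ S.MJ J z, ∃ c : Fin n × Fin n → J, g = Φ c ∧ c (z, z) = 0 ∧ (∀ a b, mat (π g) a b - (1 : Matrix (Fin n) (Fin n) A) a b ∈ J) ∧
      ∀ a b, (a, b) ≠ (z, z) → mat (π g) a b = (1 : Matrix (Fin n) (Fin n) A) a b + c (a, b) := by
    intro g hg
    have step : ∀ p, p ≠ (z, z) → ∀ s ∈ J, ∀ g : Γ, (∃ c : Fin n × Fin n → J, g = Φ c ∧ c (z, z) = 0 ∧ (∀ a b, mat (π g) a b - (1 : Matrix (Fin n) (Fin n) A) a b ∈ J) ∧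
      ∀ a b, (a, b) ≠ (z, z) → mat (π g) a b = (1 : Matrix (Fin n) (Fin n) A) a b + c (a, b)) → (∃ c : Fin n × Fin n → J, S.ff z p s * g = Φ c ∧ c (z, z) = 0 ∧ (∀ a b, mat (π (S.ff z p s * g)) a b - (1 : Matrix (Fin n) (Fin n) A) a b ∈ J) ∧
      ∀ a b, (a, b) ≠ (z, z) → mat (π (S.ff z p s * g)) a b = (1 : Matrix (Fin n) (Fin n) A) a b + c (a, b)) := by
      rintro p hp s hs g ⟨c, e1, e2, e3, e4⟩
      obtain ⟨q1, q2⟩ := hC.mat_ff z hp hs π hπ e3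
      refine ⟨Pi.single p ⟨s, hs⟩ + c, ?_, ?_, ?_, ?_⟩
      · rw [e1, ← hΦ' p ⟨s, hs⟩ c]
      · rw [Pi.add_apply, e2, Pi.single_eq_of_ne (Ne.symm hp), add_zero]
      · rw [map_mul]; exact q1
      · intro a b hab
        rw [map_mul, q2 a b hab, e4 a b hab, Pi.add_apply, Pi.single_apply]
        split_ifs <;> push_cast <;> ring
    refine Subgroup.closure_induction_left (p := fun g _ => ∃ c : Fin n × Fin n → J, g = Φ c ∧ c (z, z) = 0 ∧ (∀ a b, mat (π g) a b - (1 : Matrix (Fin n) (Fin n) A) a b ∈ J) ∧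
      ∀ a b, (a, b) ≠ (z, z) → mat (π g) a b = (1 : Matrix (Fin n) (Fin n) A) a b + c (a, b)) ?_ ?_ ?_ hg
    · exact ⟨0, hΦ0.symm, rfl, by simp, by simp⟩
    · rintro t ⟨p, hp, s, hs, rfl⟩ y _ ih
      exact step p hp s hs y ih
    · rintro t ⟨p, hp, s, hs, rfl⟩ y _ ih
      have : (S.ff z p s)⁻¹ = S.ff z p (-s) := by
        rw [inv_eq_iff_mul_eq_one, ← hC.ff_add hn z p hs (J.neg_mem hs), add_neg_cancel]
        unfold ff
        split_ifs with h1 h2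
        · exact S.x_zero h1
        · exact S.HH_zero_right h2 1
        · rfl
      rw [this]
      exact step p hp (-s) (J.neg_mem hs) y ih
  obtain ⟨c, e1, e2, -, e4⟩ := key g hM
  have : c = 0 := by
    funext ⟨a, b⟩
    by_cases hab : (a, b) = (z, z)
    · rw [hab]; exact e2
    · have := e4 a b hab
      rw [h1, mat_one, left_eq_add] at this
      exact Subtype.ext this
  rw [e1, this, hΦ0]

end
end StSys
end BG

namespace BG
namespace StSys

/-- systems with enough good units -/
structure GoodSys {n : ℕ} {A : Type} [CommRing A] {Γ : Type} [Group Γ] (S : StSys n A Γ) : Prop where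
  hgen : S.XG Set.univ = ⊤
  hm1 : S.Gd (-1)
  hcl : Subring.closure ({a : A | ∃ u : Aˣ, S.Gd u ∧ (u : A) = a} ∪ {f : A | f * f = f}) = ⊤
  hmax : ∀ M : Ideal A, M.IsMaximal → ∃ θ : Aˣ, S.Gd θ ∧ ∀ a, a ∉ M → ∃ N : ℕ, a - (θ : A) ^ N ∈ M

theorem sr1_unit_lift {A A' : Type} [CommRing A] [CommRing A'] (h : SR1 A) (f : A →+* A') (hf : Function.Surjective f) (v : A'ˣ) :
    ∃ u : Aˣ, f u = v := by
  obtain ⟨a, ha⟩ := hf v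
  obtain ⟨b, hb⟩ := hf ↑v⁻¹
  obtain ⟨c, hc⟩ := h a (1 - a * b) ⟨b, 1, by ring⟩
  refine ⟨hc.unit, ?_⟩
  rw [IsUnit.unit_spec]
  simp [ha, hb]

theorem GoodSys.desc {n : ℕ} {A A' : Type} [CommRing A] [CommRing A'] [Finite A] {Γ Γ' : Type} [Group Γ] [Group Γ'] {S : StSys n A Γ} (G : S.GoodSys)
    (f : A →+* A') (hf : Function.Surjective f) (ψ : Γ →* Γ') (hψ : Function.Surjective ψ) {S' : StSys n A' Γ'}
    (hS : ∀ i j, i ≠ j → ∀ a, S'.x i j (f a) = (S.map ψ).x i j a) : S'.GoodSys := by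
  have hg : ∀ u : Aˣ, S.Gd u → S'.Gd (Units.map f.toMonoidHom u) := by
    intro u hu i j k hij hik hjk v
    obtain ⟨v', hv'⟩ := sr1_unit_lift (sr1_finite A) f hf v
    rw [desc_h hS hij u _ rfl, desc_h hS hik v' v hv'.symm, map_h, map_h]
    exact (hu i j k hij hik hjk v').map ψ
  refine ⟨?_, ?_, ?_, ?_⟩
  · rw [eq_top_iff]
    intro γ _
    obtain ⟨g, rfl⟩ := hψ γ
    have h1 : g ∈ S.XG Set.univ := by rw [G.hgen]; trivial
    refine S.XG_induction (p := fun g => ψ g ∈ S'.XG Set.univ) ?_ ?_ h1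
    · rw [map_one]; exact one_mem _
    · intro i j hij _ a g _ ih
      rw [map_mul]
      refine mul_mem ?_ ih
      rw [← map_x, ← hS i j hij]
      exact S'.x_mem hij _
  · have := hg _ G.hm1
    convert this using 1
    ext; simp
  · rw [eq_top_iff, ← RingHom.range_eq_top_of_surjective f hf, RingHom.range_eq_map, ← G.hcl, RingHom.map_closure]
    refine Subring.closure_mono ?_
    rintro _ ⟨a, ⟨u, hu, rfl⟩ | ha, rfl⟩
    · exact Or.inl ⟨_, hg u hu, rfl⟩
    · refine Or.inr ?_
      have ha : a * a = a := ha
      change f a * f a = f a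
      rw [← map_mul, ha]
  · intro M hM
    obtain ⟨θ, h1, h2⟩ := G.hmax (M.comap f) (Ideal.comap_isMaximal_of_surjective f hf)
    refine ⟨_, hg θ h1, ?_⟩
    intro a ha
    obtain ⟨a, rfl⟩ := hf a
    obtain ⟨N, hN⟩ := h2 a ha
    refine ⟨N, ?_⟩
    rw [Ideal.mem_comap] at hN
    simpa using hN

/-- annihilator of an element -/
def Ann {A : Type} [CommRing A] (s : A) : Ideal A := LinearMap.ker (LinearMap.toSpanSingleton A A s)

theorem mem_Ann {A : Type} [CommRing A] {s a : A} : a ∈ Ann s ↔ a * s = 0 := by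
  rw [Ann, LinearMap.mem_ker, LinearMap.toSpanSingleton_apply, smul_eq_mul]

theorem Ann_max {A : Type} [CommRing A] {s : A} (h0 : s ≠ 0) (h : ∀ c, c * s ≠ 0 → ∃ d, d * c * s = s) : (Ann s).IsMaximal := by
  rw [Ideal.isMaximal_iff]
  refine ⟨fun h => h0 (by simpa [mem_Ann] using h), ?_⟩
  intro J x hJ hx hxJ
  obtain ⟨d, hd⟩ := h x (fun h => hx (mem_Ann.mpr h))
  have h1 : 1 - d * x ∈ Ann s := by rw [mem_Ann]; linear_combination -hd
  have := J.add_mem (hJ h1) (J.mul_mem_left d hxJ)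
  simpa using this

theorem sq_lemma {A : Type} [CommRing A] [Finite A] {s : A} (h0 : s ≠ 0) (h : ∀ c, c * s ≠ 0 → ∃ d, d * c * s = s) (c : A) :
    ∃ x y : A, c * s = (x * x - y * y) * s := by
  by_cases h2 : (2 : A) * s = 0
  · have hM := Ann_max h0 h
    letI := Ideal.Quotient.field (Ann s)
    have : Finite (A ⧸ Ann s) := Finite.of_surjective _ Ideal.Quotient.mk_surjective
    have e2 : (2 : A ⧸ Ann s) = 0 := by
      have : Ideal.Quotient.mk (Ann s) 2 = 0 := Ideal.Quotient.eq_zero_iff_mem.mpr (mem_Ann.mpr h2)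
      rwa [map_ofNat] at this
    have hc : CharP (A ⧸ Ann s) 2 := CharTwo.of_one_ne_zero_of_two_eq_zero one_ne_zero e2
    obtain ⟨y, hy⟩ := FiniteField.isSquare_of_char_two (ringChar.eq _ 2) (Ideal.Quotient.mk (Ann s) c)
    obtain ⟨x, rfl⟩ := Ideal.Quotient.mk_surjective y
    rw [← map_mul, Ideal.Quotient.eq, mem_Ann] at hy
    exact ⟨x, 0, by linear_combination hy⟩
  · obtain ⟨d, hd⟩ := h 2 h2
    exact ⟨d * (c + 1), d * (c - 1), by linear_combination -(c + 2 * d * c) * hd⟩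

theorem pres_step {n : ℕ} (hn : 3 ≤ n) {A : Type} [CommRing A] [Finite A] [Nontrivial A] {Γ : Type} [Group Γ] (S : StSys n A Γ) (G : S.GoodSys)
    (π : Γ →* SL n A) (hπ : ∀ i j, i ≠ j → ∀ a, π (S.x i j a) = tv i j a) {J : Ideal A} (hJ : IsAtom J) {g : Γ}
    (hg : g ∈ Subgroup.normalClosure {t | ∃ i j, i ≠ j ∧ ∃ s ∈ J, t = S.x i j s}) (h1 : π g = 1) : g = 1 := by
  have sub : ∀ s ∈ J, s ≠ 0 → Ideal.span {s} = J := by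
    intro s hs h0
    by_contra hne
    have h1 : Ideal.span {s} ≤ J := by rw [Ideal.span_singleton_le_iff_mem]; exact hs
    have := hJ.2 _ (lt_of_le_of_ne h1 hne)
    rw [Ideal.span_singleton_eq_bot] at this
    exact h0 this
  have gen : ∀ s ∈ J, s ≠ 0 → ∀ t ∈ J, ∃ a, t = a * s := by
    intro s hs h0 t ht
    rw [← sub s hs h0, Ideal.mem_span_singleton'] at ht
    obtain ⟨a, ha⟩ := ht
    exact ⟨a, ha.symm⟩
  have inv : ∀ s ∈ J, s ≠ 0 → ∀ c, c * s ≠ 0 → ∃ d, d * c * s = s := by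
    intro s hs h0 c hc
    obtain ⟨d, hd⟩ := gen (c * s) (J.mul_mem_left _ hs) hc s hs
    exact ⟨d, by rw [mul_assoc]; exact hd.symm⟩
  obtain ⟨s₀, hs₀, h0⟩ := Submodule.exists_mem_ne_zero_of_ne_bot hJ.1
  by_cases hsq : s₀ * s₀ = 0
  · have hC : S.CJ J := S.CJ_of hn G.hgen G.hm1 hsq (sq_lemma h0 (inv s₀ hs₀ h0)) (gen s₀ hs₀ h0)
    have hid : ∀ f : A, f * f = f → (∀ s ∈ J, f * s = 0) ∨ (∀ s ∈ J, f * s = s) := by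
      intro f hf
      by_cases hfs : f * s₀ = 0
      · left
        intro s hs
        obtain ⟨a, rfl⟩ := gen s₀ hs₀ h0 s hs
        linear_combination a * hfs
      · right
        intro s hs
        obtain ⟨a, rfl⟩ := gen s₀ hs₀ h0 s hs
        obtain ⟨d, hd⟩ := inv s₀ hs₀ h0 f hfs
        linear_combination (a * d * s₀) * hf - a * (f - 1) * hd
    exact hC.case_sqz hn G.hgen (hC.HH_lin hn G.hgen G.hcl hid) π hπ hg h1
  · have hs2 : s₀ * s₀ ∈ J := J.mul_mem_left _ hs₀
    obtain ⟨d, hd⟩ := gen _ hs2 hsq s₀ hs₀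
    set e := d * s₀ with he0
    have he : e * e = e := by rw [he0]; linear_combination -d * hd
    have heJ : e ∈ J := J.mul_mem_left _ hs₀
    have hes : e * s₀ = s₀ := by rw [he0]; linear_combination -hd
    have e0 : e ≠ 0 := by
      intro h
      rw [h, zero_mul] at hes
      exact h0 hes.symm
    have hM := Ann_max e0 (inv e heJ e0)
    letI := Ideal.Quotient.field (Ann e)
    obtain ⟨θ, hθ, hθ2⟩ := G.hmax _ hM
    have hgs : g ∈ (S.scale e he).XG Set.univ := by
      have := S.scale_norm hn he G.hgen
      refine Subgroup.normalClosure_le_normal (N := (S.scale e he).XG Set.univ) ?_ hg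
      rintro t ⟨i, j, hij, s, hs, rfl⟩
      obtain ⟨a, rfl⟩ := gen e heJ e0 s hs
      have := (S.scale e he).x_mem hij a
      rwa [scale_x, mul_comm] at this
    refine S.case_field hn he (Ideal.Quotient.mk (Ann e)) Ideal.Quotient.mk_surjective ?_ π hπ hθ ?_ hgs h1
    · intro a
      rw [Ideal.Quotient.eq_zero_iff_mem, mem_Ann, mul_comm]
    · intro u
      obtain ⟨a, ha⟩ := Ideal.Quotient.mk_surjective (u : A ⧸ Ann e)
      have : a ∉ Ann e := by
        intro h
        rw [← Ideal.Quotient.eq_zero_iff_mem, ha] at h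
        exact u.ne_zero h
      obtain ⟨N, hN⟩ := hθ2 a this
      refine ⟨N, ?_⟩
      rw [← ha, ← map_pow, Ideal.Quotient.eq]
      exact hN

theorem pres {n : ℕ} (hn : 3 ≤ n) (m : ℕ) : ∀ (A : Type) [CommRing A] [Finite A], Nat.card A = m → ∀ (Γ : Type) [Group Γ] (S : StSys n A Γ), S.GoodSys → 
    ∀ (π : Γ →* SL n A), (∀ i j, i ≠ j → ∀ a, π (S.x i j a) = tv i j a) → ∀ g, π g = 1 → g = 1 := by
  induction m using Nat.strong_induction_on with
  | _ m IH =>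
  intro A _ _ hm Γ _ S G π hπ g hg
  rcases subsingleton_or_nontrivial A with hA | hA
  · have hgm : g ∈ S.XG Set.univ := by rw [G.hgen]; trivial
    clear hg
    refine S.XG_induction (p := fun g => g = 1) rfl ?_ hgm
    intro i j hij _ a g _ ih
    rw [ih, Subsingleton.elim a 0, S.x_zero hij, one_mul]
  · obtain ⟨J, hJ⟩ := IsAtomic.exists_atom (Ideal A)
    refine S.pres_step hn G π hπ hJ ?_ hg
    set N := Subgroup.normalClosure {t | ∃ i j, i ≠ j ∧ ∃ s ∈ J, t = S.x i j s} with hN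
    obtain ⟨S', hS'⟩ := (S.map (QuotientGroup.mk' N)).exists_desc (Ideal.Quotient.mk J) Ideal.Quotient.mk_surjective (by
      intro i j hij a ha
      rw [StSys.map_x, QuotientGroup.mk'_apply, QuotientGroup.eq_one_iff]
      exact Subgroup.subset_normalClosure ⟨i, j, hij, a, Ideal.Quotient.eq_zero_iff_mem.mp ha, rfl⟩)
    have G' : S'.GoodSys := G.desc _ Ideal.Quotient.mk_surjective _ (QuotientGroup.mk'_surjective N) hS'
    have hker : ∀ t ∈ N, ((mp (Ideal.Quotient.mk J)).comp π) t = 1 := by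
      intro t ht
      have : N ≤ ((mp (Ideal.Quotient.mk J)).comp π).ker := by
        apply Subgroup.normalClosure_le_normal
        rintro t ⟨i, j, hij, s, hs, rfl⟩
        change mp _ (π (S.x i j s)) = 1
        rw [hπ i j hij, mp_tv, Ideal.Quotient.eq_zero_iff_mem.mpr hs, tv_zero]
      exact this ht
    have hfin : Finite (A ⧸ J) := Finite.of_surjective _ Ideal.Quotient.mk_surjective
    have hlt : Nat.card (A ⧸ J) < m := by
      rw [← hm]
      refine lt_of_le_of_ne (Nat.card_le_card_of_surjective _ (Ideal.Quotient.mk_surjective (I := J))) ?_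
      intro h
      have hinj := ((Nat.bijective_iff_surjective_and_card (Ideal.Quotient.mk J)).mpr ⟨Ideal.Quotient.mk_surjective, h.symm⟩).1
      obtain ⟨s, hs, h0⟩ := Submodule.exists_mem_ne_zero_of_ne_bot hJ.1
      apply h0
      apply hinj
      rw [map_zero, Ideal.Quotient.eq_zero_iff_mem]
      exact hs
    have := IH _ hlt (A ⧸ J) rfl (Γ ⧸ N) S' G' (QuotientGroup.lift N _ hker) ?_ (QuotientGroup.mk' N g) ?_
    · rwa [QuotientGroup.mk'_apply, QuotientGroup.eq_one_iff] at this
    · intro i j hij a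
      obtain ⟨a, rfl⟩ := Ideal.Quotient.mk_surjective a
      rw [hS' i j hij]
      change mp _ (π (S.x i j a)) = _
      rw [hπ i j hij, mp_tv]
    · change mp _ (π g) = _
      rw [hg, map_one]

end StSys
end BG

namespace BG
namespace StSys
section
variable {n : ℕ} {A : Type} [CommRing A] {Γ : Type} [Group Γ] (S : StSys n A Γ)

variable {S} in
theorem MonAct.comm_eq (hgen : S.XG Set.univ = ⊤) {z z' y y' : Γ} {m m' : Fin n → Aˣ} (hz : S.MonAct z 1 m) (hz' : S.MonAct z' 1 m)
    (hy : S.MonAct y 1 m') (hy' : S.MonAct y' 1 m') : z * y * z⁻¹ * y⁻¹ = z' * y' * z'⁻¹ * y'⁻¹ := by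
  have hc : ∀ g, Commute (z⁻¹ * z') g := fun g => hz.cent hz' (by rw [hgen]; trivial)
  have hd : ∀ g, Commute (y⁻¹ * y') g := fun g => hy.cent hy' (by rw [hgen]; trivial)
  obtain ⟨c, e1⟩ : ∃ c, c = z⁻¹ * z' := ⟨_, rfl⟩
  obtain ⟨d, e2⟩ : ∃ d, d = y⁻¹ * y' := ⟨_, rfl⟩
  rw [← e1] at hc
  rw [← e2] at hd
  obtain rfl : z' = z * c := by rw [e1]; group
  obtain rfl : y' = y * d := by rw [e2]; group
  symm
  calc z * c * (y * d) * (z * c)⁻¹ * (y * d)⁻¹ = z * (c * (y * d)) * c⁻¹ * z⁻¹ * d⁻¹ * y⁻¹ := by group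
    _ = z * y * (d * z⁻¹) * d⁻¹ * y⁻¹ := by rw [(hc _).eq]; group
    _ = _ := by rw [(hd _).eq]; group

/-- four letter lift of `diag(u, u⁻¹)` -/
def zz (i j : Fin n) (u : Aˣ) : Γ := S.x i j (u - 1) * S.x j i 1 * S.x i j (↑u⁻¹ - 1) * S.x j i (-u)

theorem zz_mon (hn : 3 ≤ n) {i j : Fin n} (hij : i ≠ j) (u : Aˣ) : S.MonAct (S.zz i j u) 1 (dg i j u) := by
  refine Acts.monDiag hn hij ?_
  have := (((Acts.x (S := S) hij (u - 1 : A)).mul (Acts.x' (S := S) hij (1 : A))).mul (Acts.x (S := S) hij (↑u⁻¹ - 1 : A))).mul (Acts.x' (S := S) hij (-u : A))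
  have hu : (u : A) * ↑u⁻¹ = 1 := Units.mul_inv u
  refine this.congr ?_ ?_ ?_ ?_
  · linear_combination -(u : A) * hu
  · linear_combination hu
  · linear_combination -hu
  · ring

/-- the central symbol -/
def sym (i j k : Fin n) (u v : Aˣ) : Γ := S.zz i j u * S.zz i k v * (S.zz i j u)⁻¹ * (S.zz i k v)⁻¹

variable {S} in
theorem MonAct.comm_cent {z y : Γ} {m m' : Fin n → Aˣ} (hz : S.MonAct z 1 m)
    (hy : S.MonAct y 1 m') (g : Γ) (hgen : S.XG Set.univ = ⊤) : Commute (z * y * z⁻¹ * y⁻¹) g := by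
  have h1 : S.MonAct (z * y) 1 (fun k => m k * m' k) := (hz.mul hy).congr (mul_one _) rfl
  have h2 : S.MonAct (y * z) 1 (fun k => m k * m' k) := (hy.mul hz).congr (mul_one _) (by funext k; exact mul_comm _ _)
  have h3 : ∀ g, Commute ((y * z)⁻¹ * (z * y)) g := fun g => h2.cent h1 (by rw [hgen]; trivial)
  have h4 : z * y * z⁻¹ * y⁻¹ = (y * z)⁻¹ * (z * y) := by
    have := (h3 (y * z)).eq
    calc z * y * z⁻¹ * y⁻¹ = (y * z) * ((y * z)⁻¹ * (z * y)) * (y * z)⁻¹ := by group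
      _ = _ := by rw [← this]; group
  rw [h4]; exact h3 g

theorem sym_cent (hn : 3 ≤ n) (hgen : S.XG Set.univ = ⊤) {i j k : Fin n} (hij : i ≠ j) (hik : i ≠ k) (u v : Aˣ) (g : Γ) :
    Commute (S.sym i j k u v) g := (S.zz_mon hn hij u).comm_cent (S.zz_mon hn hik v) g hgen

theorem dg_mul (i j : Fin n) (u v : Aˣ) (k : Fin n) : dg i j (u * v) k = dg i j u k * dg i j v k := by
  simp only [dg]
  split_ifs
  · rfl
  · rw [mul_inv]
  · rw [mul_one]

theorem sym_mul (hn : 3 ≤ n) (hgen : S.XG Set.univ = ⊤) {i j k : Fin n} (hij : i ≠ j) (hik : i ≠ k) (u v v' : Aˣ) :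
    S.sym i j k u (v * v') = S.sym i j k u v * S.sym i j k u v' := by
  have h1 : S.MonAct (S.zz i k v * S.zz i k v') 1 (dg i k (v * v')) := 
    ((S.zz_mon hn hik v).mul (S.zz_mon hn hik v')).congr (mul_one _) (by funext l; rw [dg_mul]; rfl)
  have h2 := (S.zz_mon hn hij u).comm_eq hgen (S.zz_mon hn hij u) (S.zz_mon hn hik (v * v')) h1
  have h3 := S.sym_cent hn hgen hij hik u v' (S.zz i k v)⁻¹
  rw [sym, h2]
  change _ = _ at h3
  simp only [sym] at h3 ⊢
  generalize S.zz i j u = a at *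
  generalize S.zz i k v = b at *
  generalize S.zz i k v' = c at *
  calc _ = a * b * a⁻¹ * ((a * c * a⁻¹ * c⁻¹) * b⁻¹) := by group
    _ = _ := by rw [h3]; group

end
end StSys
end BG

namespace BG
namespace StSys

theorem zz_tv {n : ℕ} {A : Type} [CommRing A] {i j : Fin n} (hij : i ≠ j) (u : Aˣ) :
    mat ((tvSys n A).zz i j u) = Matrix.diagonal (fun k => ((dg i j u k : Aˣ) : A)) := by
  have hu : (u : A) * ↑u⁻¹ = 1 := Units.mul_inv u
  ext a b
  have e : (tvSys n A).zz i j u = tv i j (u - 1 : A) * (tv j i 1 * (tv i j (↑u⁻¹ - 1 : A) * (tv j i (-u : A) * 1))) := by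
    rw [zz, mul_one, mul_assoc, mul_assoc]; rfl
  rw [e, Matrix.diagonal_apply]
  simp only [tv_mul_apply hij, tv_mul_apply hij.symm, mat_one_apply, dg]
  by_cases h1 : a = i
  · subst h1
    simp only [hij, hij.symm, if_true, if_false]
    by_cases h3 : a = b
    · subst h3
      simp only [hij, hij.symm, if_true, if_false]
      linear_combination -(u : A) * hu
    · by_cases h4 : j = b
      · subst h4
        simp only [hij, hij.symm, if_true, if_false]
        linear_combination hu
      · simp [h3, h4]
  · by_cases h2 : a = j
    · subst h2
      simp only [hij, hij.symm, if_true, if_false]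
      by_cases h3 : a = b
      · subst h3
        simp only [hij, hij.symm, if_true, if_false]
        linear_combination (0 : A)
      · by_cases h4 : i = b
        · subst h4
          simp only [hij, hij.symm, if_true, if_false]
          linear_combination -hu
        · simp [h3, h4]
    · simp only [h1, h2, if_false, add_zero, Units.val_one]

theorem map_sym {n : ℕ} {A : Type} [CommRing A] {Γ Γ' : Type} [Group Γ] [Group Γ'] (S : StSys n A Γ) (ψ : Γ →* Γ') (S' : StSys n A Γ')
    (h : ∀ i j, i ≠ j → ∀ a, ψ (S.x i j a) = S'.x i j a) {i j k : Fin n} (hij : i ≠ j) (hik : i ≠ k) (u v : Aˣ) :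
    ψ (S.sym i j k u v) = S'.sym i j k u v := by
  have key : ∀ i j, i ≠ j → ∀ u : Aˣ, ψ (S.zz i j u) = S'.zz i j u := by
    intro i j hij u
    simp only [zz, map_mul, h _ _ hij, h _ _ hij.symm]
  simp only [sym, map_mul, map_inv, key _ _ hij, key _ _ hik]

theorem sym_tv {n : ℕ} {A : Type} [CommRing A] {i j k : Fin n} (hij : i ≠ j) (hik : i ≠ k) (u v : Aˣ) :
    (tvSys n A).sym i j k u v = 1 := by
  rw [sym, mul_inv_eq_one, mul_inv_eq_iff_eq_mul]
  apply mat_inj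
  rw [mat_mul, mat_mul, zz_tv hij, zz_tv hik, Matrix.diagonal_mul_diagonal, Matrix.diagonal_mul_diagonal]
  congr 1
  funext l
  exact mul_comm _ _

section
variable {n : ℕ} {A : Type} [CommRing A] {Γ : Type} [Group Γ] (S : StSys n A Γ)

theorem exists_mon (hn : 3 ≤ n) (σ : Equiv.Perm (Fin n)) : ∃ P m, S.MonAct P σ m := by
  induction σ using Equiv.Perm.swap_induction_on with
  | one => exact ⟨1, fun _ => 1, by intro k l hkl a; simp⟩
  | swap_mul f x y hxy ih =>
    obtain ⟨P, m, h⟩ := ih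
    exact ⟨_, _, (S.w_mon hn hxy 1).mul h⟩

theorem exists_perm3 {a b c i j k : Fin n} (hab : a ≠ b) (hac : a ≠ c) (hbc : b ≠ c) (hij : i ≠ j) (hik : i ≠ k) (hjk : j ≠ k) :
    ∃ σ : Equiv.Perm (Fin n), σ a = i ∧ σ b = j ∧ σ c = k := by
  classical
  have h1 : Equiv.swap a i b ≠ i := fun h => hab (by
    have := Equiv.swap_apply_left a i
    exact ((Equiv.swap a i).injective (this.trans h.symm)))
  set b' := Equiv.swap a i b with hb'
  have e1 : Equiv.swap b' j i = i := Equiv.swap_apply_of_ne_of_ne h1.symm hij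
  set c' := Equiv.swap b' j (Equiv.swap a i c) with hc'
  have h2 : c' ≠ i := by
    intro h
    rw [← e1, hc'] at h
    have h := (Equiv.swap b' j).injective h
    exact hac ((Equiv.swap a i).injective ((Equiv.swap_apply_left a i).trans h.symm))
  have h3 : c' ≠ j := by
    intro h
    rw [hc'] at h
    have h := (Equiv.swap b' j).injective (h.trans (Equiv.swap_apply_left b' j).symm)
    exact hbc ((Equiv.swap a i).injective (hb'.symm.trans h.symm))
  refine ⟨Equiv.swap c' k * Equiv.swap b' j * Equiv.swap a i, ?_, ?_, ?_⟩
  · simp only [Equiv.Perm.mul_apply, Equiv.swap_apply_left, e1]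
    exact Equiv.swap_apply_of_ne_of_ne h2.symm hik
  · simp only [Equiv.Perm.mul_apply, ← hb', Equiv.swap_apply_left]
    exact Equiv.swap_apply_of_ne_of_ne h3.symm hjk
  · simp only [Equiv.Perm.mul_apply, ← hc', Equiv.swap_apply_left]

theorem conj_mon {P z : Γ} {σ : Equiv.Perm (Fin n)} {m : Fin n → Aˣ} (hP : S.MonAct P σ m) {i j i' j' : Fin n} {u : Aˣ}
    (hz : S.MonAct z 1 (dg i j u)) (hi : σ i = i') (hj : σ j = j') : S.MonAct (P * z * P⁻¹) 1 (dg i' j' u) := by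
  refine ((hP.mul hz).mul hP.inv).congr (by simp) ?_
  funext k
  obtain ⟨l, rfl⟩ := σ.surjective k
  subst hi hj
  simp [dg]

theorem sym_comm (hn : 3 ≤ n) (hgen : S.XG Set.univ = ⊤) {a b c i j k : Fin n} (hab : a ≠ b) (hac : a ≠ c) (hbc : b ≠ c) (hij : i ≠ j) (hik : i ≠ k) (hjk : j ≠ k)
    (u v : Aˣ) : S.h i j u * S.h i k v * (S.h i j u)⁻¹ * (S.h i k v)⁻¹ = S.sym a b c u v := by
  obtain ⟨σ, h1, h2, h3⟩ := exists_perm3 hab hac hbc hij hik hjk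
  obtain ⟨P, m, hP⟩ := S.exists_mon hn σ
  have e1 := S.conj_mon hP (S.zz_mon hn hab u) h1 h2
  have e2 := S.conj_mon hP (S.zz_mon hn hac v) h1 h3
  rw [(S.h_mon hn hij u).comm_eq hgen e1 (S.h_mon hn hik v) e2]
  have hc := (S.sym_cent hn hgen hab hac u v P).eq
  calc _ = P * S.sym a b c u v * P⁻¹ := by rw [sym]; group
    _ = _ := by rw [← hc]; group

theorem core (hn : 3 ≤ n) [Finite A] (hgen : S.XG Set.univ = ⊤) (π : Γ →* SL n A) (hπ : ∀ i j, i ≠ j → ∀ a, π (S.x i j a) = tv i j a)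
    {a b c : Fin n} (hab : a ≠ b) (hac : a ≠ c) (hbc : b ≠ c) {m : ℕ} (u : Fin m → Aˣ)
    (hcl : Subring.closure ({x : A | ∃ l, (u l : A) = x} ∪ {f : A | f * f = f}) = ⊤) (hm1 : ∃ l, u l = -1)
    (hmax : ∀ M : Ideal A, M.IsMaximal → ∃ l, ∀ a, a ∉ M → ∃ N : ℕ, a - (u l : A) ^ N ∈ M) (γ : Γ) (hγ : π γ = 1) :
    ∃ v : Fin m → Aˣ, γ = (List.ofFn fun l => S.sym a b c (u l) (v l)).prod := by
  classical
  letI : CommGroup (Subgroup.center Γ) := { (inferInstance : Group (Subgroup.center Γ)) with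
    mul_comm := fun x y => Subtype.ext ((Subgroup.mem_center_iff.mp y.2 x.1)) }
  let f : Aˣ → (Aˣ →* Subgroup.center Γ) := fun u => MonoidHom.mk' (fun v => ⟨S.sym a b c u v, Subgroup.mem_center_iff.mpr fun g => (S.sym_cent hn hgen hab hac u v g).symm.eq⟩)
    (fun v v' => Subtype.ext (S.sym_mul hn hgen hab hac u v v'))
  let F : (Fin m → Aˣ) →* Subgroup.center Γ := 
    { toFun := fun v => ∏ l, f (u l) (v l)
      map_one' := by simp
      map_mul' := fun v v' => by simp [Finset.prod_mul_distrib] }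
  let C : Subgroup Γ := F.range.map (Subgroup.center Γ).subtype
  have hF : ∀ v, ((F v : Subgroup.center Γ) : Γ) = (List.ofFn fun l => S.sym a b c (u l) (v l)).prod := by
    intro v
    change (Subgroup.center Γ).subtype (∏ l, f (u l) (v l)) = _
    rw [← List.prod_ofFn, map_list_prod, List.map_ofFn]
    rfl
  have hCn : C.Normal := by
    refine ⟨fun x hx g => ?_⟩
    have : x ∈ Subgroup.center Γ := by
      obtain ⟨y, _, rfl⟩ := hx
      exact y.2
    rw [Subgroup.mem_center_iff.mp this g, mul_inv_cancel_right]
    exact hx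
  have hsC : ∀ l v, S.sym a b c (u l) v ∈ C := by
    intro l v
    refine ⟨F (Pi.mulSingle l v), ⟨_, rfl⟩, ?_⟩
    have : F (Pi.mulSingle l v) = f (u l) v := by
      change ∏ l', f (u l') ((Pi.mulSingle l v : Fin m → Aˣ) l') = _
      rw [Finset.prod_eq_single l]
      · simp
      · intro l' _ hl
        rw [Pi.mulSingle_eq_of_ne hl, map_one]
      · simp
    rw [this]; rfl
  suffices γ ∈ C by
    obtain ⟨_, ⟨v, rfl⟩, rfl⟩ := this
    exact ⟨v, hF v⟩
  have hCπ : C ≤ π.ker := by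
    rintro _ ⟨_, ⟨v, rfl⟩, rfl⟩
    rw [MonoidHom.mem_ker]
    change π ((F v : Subgroup.center Γ) : Γ) = 1
    rw [hF, map_list_prod, List.map_ofFn]
    refine List.prod_eq_one ?_
    intro x hx
    rw [List.mem_ofFn] at hx
    obtain ⟨l, rfl⟩ := hx
    change π (S.sym a b c (u l) (v l)) = 1
    rw [S.map_sym π (tvSys n A) hπ hab hac, sym_tv hab hac]
  have hGd : ∀ l, (S.map (QuotientGroup.mk' C)).Gd (u l) := by
    intro l i j k hij hik hjk v
    rw [map_h, map_h]
    change _ = _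
    rw [← mul_inv_eq_iff_eq_mul, ← mul_inv_eq_one]
    simp only [← map_mul, ← map_inv]
    rw [S.sym_comm hn hgen hab hac hbc hij hik hjk]
    exact (QuotientGroup.eq_one_iff _).mpr (hsC l v)
  have good : (S.map (QuotientGroup.mk' C)).GoodSys := by
    refine ⟨?_, ?_, ?_, ?_⟩
    · rw [eq_top_iff]
      intro γ _
      obtain ⟨g, rfl⟩ := QuotientGroup.mk'_surjective C γ
      have h1 : g ∈ S.XG Set.univ := by rw [hgen]; trivial
      refine S.XG_induction (p := fun g => QuotientGroup.mk' C g ∈ (S.map (QuotientGroup.mk' C)).XG Set.univ) ?_ ?_ h1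
      · rw [map_one]; exact one_mem _
      · intro i j hij _ a g _ ih
        rw [map_mul]
        exact mul_mem ((S.map (QuotientGroup.mk' C)).x_mem hij _) ih
    · obtain ⟨l, hl⟩ := hm1
      rw [← hl]; exact hGd l
    · rw [eq_top_iff, ← hcl]
      refine Subring.closure_mono (Set.union_subset_union ?_ subset_rfl)
      rintro x ⟨l, rfl⟩
      exact ⟨u l, hGd l, rfl⟩
    · intro M hM
      obtain ⟨l, hl⟩ := hmax M hM
      exact ⟨u l, hGd l, hl⟩
  have := pres hn (Nat.card A) A rfl (Γ ⧸ C) (S.map (QuotientGroup.mk' C)) good (QuotientGroup.lift C π hCπ)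
    (fun i j hij a => hπ i j hij a) (QuotientGroup.mk' C γ) hγ
  exact (QuotientGroup.eq_one_iff _).mp this

end
end StSys
end BG

namespace BG

theorem exists_theta (A : Type) [CommRing A] [Finite A] : ∃ θ : Aˣ, ∀ M : Ideal A, M.IsMaximal → ∀ a, a ∉ M → ∃ N : ℕ, a - (θ : A) ^ N ∈ M := by
  classical
  have hgen : ∀ M : MaximalSpectrum A, ∃ t : A, t ∉ M.asIdeal ∧ ∀ a, a ∉ M.asIdeal → ∃ N : ℕ, a - t ^ N ∈ M.asIdeal := by
    intro M
    have := M.isMaximal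
    letI : Field (A ⧸ M.asIdeal) := Ideal.Quotient.field _
    haveI : Finite (A ⧸ M.asIdeal) := Finite.of_surjective _ Ideal.Quotient.mk_surjective
    obtain ⟨g, hg⟩ := IsCyclic.exists_generator (α := (A ⧸ M.asIdeal)ˣ)
    obtain ⟨t, ht⟩ := Ideal.Quotient.mk_surjective (g : A ⧸ M.asIdeal)
    refine ⟨t, ?_, ?_⟩
    · rw [← Ideal.Quotient.eq_zero_iff_mem, ht]; exact g.ne_zero
    · intro a ha
      rw [← Ideal.Quotient.eq_zero_iff_mem] at ha
      have := hg (Units.mk0 _ ha)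
      rw [← mem_powers_iff_mem_zpowers] at this
      obtain ⟨N, hN⟩ := this
      refine ⟨N, ?_⟩
      rw [← Ideal.Quotient.eq_zero_iff_mem, map_sub, map_pow, ht, sub_eq_zero]
      have := congrArg Units.val hN
      simpa using this.symm
  choose t ht1 ht2 using hgen
  obtain ⟨θ, hθ⟩ := Ideal.exists_forall_sub_mem_ideal (I := fun M : MaximalSpectrum A => M.asIdeal)
    (fun M M' h => Ideal.isCoprime_of_isMaximal (fun h' => h (MaximalSpectrum.ext h'))) t
  have hu : IsUnit θ := by
    by_contra h
    obtain ⟨M, hM, hm⟩ := exists_max_ideal_of_mem_nonunits h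
    have := hθ ⟨M, hM⟩
    exact ht1 ⟨M, hM⟩ (by simpa using sub_mem hm this)
  refine ⟨hu.unit, fun M hM a ha => ?_⟩
  obtain ⟨N, hN⟩ := ht2 ⟨M, hM⟩ a ha
  refine ⟨N, ?_⟩
  have h1 := Ideal.mem_of_dvd M (sub_dvd_pow_sub_pow θ (t ⟨M, hM⟩) N) (hθ ⟨M, hM⟩)
  have := sub_mem hN h1
  rw [IsUnit.unit_spec]
  simpa using this

theorem exists_unit_idem {A : Type} [CommRing A] [Finite A] (x : A) : ∃ (u : Aˣ) (f : A), f * f = f ∧ x = u - f := by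
  obtain ⟨N, hN, he⟩ := finite_idem_pow x
  obtain ⟨N, rfl⟩ : ∃ M, N = M + 1 := ⟨N - 1, by omega⟩
  have he : x ^ (N+1) * x ^ (N+1) = x ^ (N+1) := he
  set e := x ^ (N+1) with hed
  have hf : (1 - e) * (1 - e) = 1 - e := by linear_combination he
  have h1 : IsUnit (e * x + (1 - e)) := by
    refine IsUnit.of_mul_eq_one (e * x ^ N + (1 - e)) ?_
    have : x * x ^ N = e := by rw [hed]; ring
    linear_combination (e * e) * this + (e + 2 - (x + x ^ N)) * he
  have h2 : IsUnit (1 + (1 - e) * x) := by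
    refine IsNilpotent.isUnit_one_add ⟨N + 1, ?_⟩
    rw [mul_pow, ← hed]
    have : (1 - e) ^ (N+1) = 1 - e := IsIdempotentElem.pow_succ_eq N hf
    rw [this]; linear_combination -he
  refine ⟨(h1.mul h2).unit, 1 - e, hf, ?_⟩
  rw [IsUnit.unit_spec]
  linear_combination (-x + x * x) * he

theorem exists_units {k : ℕ} {A : Type} [CommRing A] [Finite A] (f : MvPolynomial (Fin k) ℤ →+* A) (hf : Function.Surjective f) :
    ∃ u : Fin (k + 2) → Aˣ, Subring.closure ({x : A | ∃ l, (u l : A) = x} ∪ {f : A | f * f = f}) = ⊤ ∧ (∃ l, u l = -1) ∧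
    (∀ M : Ideal A, M.IsMaximal → ∃ l, ∀ a, a ∉ M → ∃ N : ℕ, a - (u l : A) ^ N ∈ M) := by
  obtain ⟨θ, hθ⟩ := exists_theta A
  choose ul fl hfl hx using fun l : Fin k => exists_unit_idem (f (MvPolynomial.X l))
  refine ⟨Fin.cons (-1) (Fin.cons θ ul), ?_, ⟨0, by simp⟩, fun M hM => ⟨1, ?_⟩⟩
  · rw [eq_top_iff]
    intro a _
    obtain ⟨p, rfl⟩ := hf a
    set K := Subring.closure ({x : A | ∃ l, ((Fin.cons (-1) (Fin.cons θ ul) : Fin (k+2) → Aˣ) l : A) = x} ∪ {f : A | f * f = f}) with hK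
    induction p using MvPolynomial.induction_on with
    | C a =>
      have : f (MvPolynomial.C a) = (a : A) := by simp
      rw [this]; exact intCast_mem K a
    | add p q hp hq => rw [map_add]; exact add_mem (hp trivial) (hq trivial)
    | mul_X p l hp =>
      rw [map_mul]
      refine mul_mem (hp trivial) ?_
      rw [hx]
      refine sub_mem (Subring.subset_closure (Or.inl ⟨l.succ.succ, by simp⟩)) (Subring.subset_closure (Or.inr (hfl l)))
  · exact hθ M hM

end BG

namespace BG
open StSys

theorem inv_zz {n : ℕ} {A : Type} [CommRing A] {Γ : Type} [Group Γ] (S : StSys n A Γ) {i j : Fin n} (hij : i ≠ j) (u : Aˣ) :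
    (S.zz i j u)⁻¹ = S.x j i u * (S.x i j (1 - ↑u⁻¹) * (S.x j i (-1) * S.x i j (1 - u))) := by
  simp only [zz, mul_inv_rev, ← S.x_neg hij, ← S.x_neg hij.symm, neg_neg, neg_sub]

/-- the sixteen letter pattern of a symbol -/
def symPat {n : ℕ} (i j k : Fin n) : List (Fin n × Fin n) :=
  [(i,j),(j,i),(i,j),(j,i)] ++ [(i,k),(k,i),(i,k),(k,i)] ++ [(j,i),(i,j),(j,i),(i,j)] ++ [(k,i),(i,k),(k,i),(i,k)]

theorem sym_pat {n : ℕ} {A : Type} [CommRing A] {Γ : Type} [Group Γ] (S : StSys n A Γ) {i j k : Fin n} (hij : i ≠ j) (hik : i ≠ k) (u v : Aˣ) :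
    S.sym i j k u v ∈ Pat S.x (symPat i j k) := by
  have h4 : ∀ (p q : Fin n) (a b c d : A), S.x p q a * (S.x q p b * (S.x p q c * S.x q p d)) ∈ Pat S.x [(p,q),(q,p),(p,q),(q,p)] :=
    fun p q a b c d => ⟨a, _, ⟨b, _, ⟨c, _, Pat_single _ q p d, rfl⟩, rfl⟩, rfl⟩
  have hz : ∀ p q u, S.zz p q u ∈ Pat S.x [(p,q),(q,p),(p,q),(q,p)] := by
    intro p q u
    rw [zz, mul_assoc, mul_assoc]; exact h4 _ _ _ _ _ _
  refine Pat_append _ (Pat_append _ (Pat_append _ (hz _ _ _) (hz _ _ _)) ?_) ?_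
  · rw [inv_zz S hij]; exact h4 _ _ _ _ _ _
  · rw [inv_zz S hik]; exact h4 _ _ _ _ _ _

/-- repeat a pattern -/
def rep {α : Type} (L : List α) : ℕ → List α
  | 0 => []
  | m + 1 => L ++ rep L m

theorem rep_length {α : Type} (L : List α) (m : ℕ) : (rep L m).length = L.length * m := by
  induction m with
  | zero => rfl
  | succ m ih => rw [rep, List.length_append, ih]; ring

theorem rep_mem {α : Type} {L : List α} {m : ℕ} {p : α} (h : p ∈ rep L m) : p ∈ L := by
  induction m with
  | zero => simp [rep] at h
  | succ m ih => rw [rep, List.mem_append] at h; exact h.elim id ih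

theorem rep_pat {n : ℕ} {A : Type} {Γ : Type} [Group Γ] (x : Fin n → Fin n → A → Γ) {L : List (Fin n × Fin n)} {m : ℕ} (s : Fin m → Γ)
    (h : ∀ l, s l ∈ Pat x L) : (List.ofFn s).prod ∈ Pat x (rep L m) := by
  induction m with
  | zero => simp [rep, Pat]
  | succ m ih =>
    rw [List.ofFn_succ, List.prod_cons]
    exact Pat_append _ (h 0) (ih _ fun l => h _)

theorem pat_lift {n : ℕ} {A A' : Type} {Γ Γ' : Type} [Group Γ] [Group Γ'] (x : Fin n → Fin n → A → Γ) (x' : Fin n → Fin n → A' → Γ')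
    (ψ : Γ →* Γ') (f : A → A') (hf : Function.Surjective f) {L : List (Fin n × Fin n)} (hL : ∀ p ∈ L, p.1 ≠ p.2)
    (h : ∀ i j, i ≠ j → ∀ a, ψ (x i j a) = x' i j (f a)) {g : Γ'} (hg : g ∈ Pat x' L) : ∃ g', g' ∈ Pat x L ∧ ψ g' = g := by
  induction L generalizing g with
  | nil => simp only [Pat, Set.mem_singleton_iff] at hg; exact ⟨1, rfl, by rw [hg, map_one]⟩
  | cons p L ih =>
    obtain ⟨r, k, hk, rfl⟩ := hg
    obtain ⟨k', h1, h2⟩ := ih (fun q hq => hL q (List.mem_cons_of_mem _ hq)) hk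
    obtain ⟨r', rfl⟩ := hf r
    exact ⟨x p.1 p.2 r' * k', ⟨r', k', h1, rfl⟩, by rw [map_mul, h2, h _ _ (hL p List.mem_cons_self)]⟩

theorem pat_fn {n : ℕ} {A : Type} {Γ : Type} [Group Γ] (x : Fin n → Fin n → A → Γ) {L : List (Fin n × Fin n)} {g : Γ} (hg : g ∈ Pat x L) :
    ∃ r : Fin L.length → A, g = (List.ofFn fun s => x (L.get s).1 (L.get s).2 (r s)).prod := by
  induction L generalizing g with
  | nil => simp only [Pat, Set.mem_singleton_iff] at hg; exact ⟨fun s => s.elim0, by rw [hg]; simp⟩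
  | cons p L ih =>
    obtain ⟨a, k, hk, rfl⟩ := hg
    obtain ⟨r, rfl⟩ := ih hk
    refine ⟨Fin.cons a r, ?_⟩
    rw [show (List.ofFn fun s : Fin (p :: L).length => x ((p :: L).get s).1 ((p :: L).get s).2 ((Fin.cons a r : Fin (L.length + 1) → A) s)) = _ from List.ofFn_succ (n := L.length), List.prod_cons]
    rfl

theorem main_pat (n k : ℕ) (hn : 3 ≤ n) : ∃ L : List (Fin n × Fin n), (∀ p ∈ L, p.1 ≠ p.2) ∧ L.length = (3 * n ^ 2 - n - 2) / 2 + 18 * (k + 2) ∧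
    ∀ H : Subgroup (SL n (MvPolynomial (Fin k) ℤ)), H.Normal → H.FiniteIndex → ∀ g, ∃ p ∈ Pat (tv (R := MvPolynomial (Fin k) ℤ)) L, p⁻¹ * g ∈ H := by
  classical
  obtain ⟨L0, hL0, hlen, hfull⟩ := sr1_full_pattern n (by omega)
  let a : Fin n := ⟨0, by omega⟩
  let b : Fin n := ⟨1, by omega⟩
  let c : Fin n := ⟨2, by omega⟩
  have hab : a ≠ b := by simp [a, b]
  have hac : a ≠ c := by simp [a, c]
  have hbc : b ≠ c := by simp [b, c]
  have hLs : ∀ p ∈ rep (symPat a b c) (k+2), p.1 ≠ p.2 := by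
    intro p hp
    have hp := rep_mem hp
    simp only [symPat, List.cons_append, List.nil_append, List.mem_cons, List.not_mem_nil, or_false] at hp
    rcases hp with h|h|h|h|h|h|h|h|h|h|h|h|h|h|h|h <;> subst h <;> first | exact hab | exact hac | exact hab.symm | exact hac.symm
  refine ⟨L0 ++ rep (symPat a b c) (k+2) ++ rep [(a,b)] (2 * (k+2)), ?_, ?_, ?_⟩
  · intro p hp
    rw [List.mem_append, List.mem_append] at hp
    rcases hp with (hp | hp) | hp
    · exact hL0 p hp
    · exact hLs p hp
    · have := rep_mem hp
      rw [List.mem_singleton] at this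
      subst this; exact hab
  · rw [List.length_append, List.length_append, rep_length, rep_length, hlen]
    simp only [symPat, List.length_append, List.length_cons, List.length_nil]
    ring
  intro H hH hfin g
  let R := MvPolynomial (Fin k) ℤ
  let T := tvSys n R
  -- the ideal
  let I : Ideal R :=
    { carrier := {r | ∀ i j : Fin n, i ≠ j → tv i j r ∈ H}
      zero_mem' := fun i j _ => by rw [tv_zero]; exact one_mem _
      add_mem' := fun {r s} hr hs i j hij => by rw [tv_add]; exact mul_mem (hr i j hij) (hs i j hij)
      smul_mem' := fun r s hs i j hij => by
        obtain ⟨l, hi, hj⟩ := exists_third hn i j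
        have := T.comm_eq (hi.symm) hj hij r s
        change tv i j (r * s) = tv i l r * tv l j s * (tv i l r)⁻¹ * (tv l j s)⁻¹ at this
        change tv i j (r * s) ∈ H
        rw [this]
        exact mul_mem (hH.conj_mem _ (hs l j hj) _) (inv_mem (hs l j hj)) }
  have hI : ∀ r, r ∈ I ↔ ∀ i j : Fin n, i ≠ j → tv i j r ∈ H := fun r => Iff.rfl
  let f : R →+* R ⧸ I := Ideal.Quotient.mk I
  have hf : Function.Surjective f := Ideal.Quotient.mk_surjective
  haveI : Finite (R ⧸ I) := by
    haveI : Finite (SL n R ⧸ H) := inferInstance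
    choose s hs using hf
    refine Finite.of_injective (β := Fin n × Fin n → SL n R ⧸ H) (fun x p => (QuotientGroup.mk (tv p.1 p.2 (s x)) : SL n R ⧸ H)) ?_
    intro x y hxy
    rw [← hs x, ← hs y]
    rw [eq_comm]
    refine Ideal.Quotient.eq.mpr ?_
    rw [hI]
    intro i j hij
    have := congrFun hxy (i, j)
    have := QuotientGroup.eq.mp this
    rw [sub_eq_add_neg, add_comm, tv_add, tv_neg]
    exact this
  let N : Subgroup (SL n R) := H ⊓ (mp f).ker
  haveI hN : N.Normal := inferInstance
  let ψ : SL n R →* SL n R ⧸ N := QuotientGroup.mk' N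
  have hψ : Function.Surjective ψ := QuotientGroup.mk'_surjective N
  obtain ⟨S, hS⟩ := (T.map ψ).exists_desc f hf (by
    intro i j hij r hr
    refine (QuotientGroup.eq_one_iff _).mpr ⟨?_, ?_⟩
    · exact (hI r).mp (Ideal.Quotient.eq_zero_iff_mem.mp hr) i j hij
    · change mp f (tv i j r) = 1
      rw [mp_tv, hr, tv_zero])
  have hS : ∀ i j, i ≠ j → ∀ r, ψ (tv i j r) = S.x i j (f r) := fun i j hij r => (hS i j hij r).symm
  have hgen : S.XG Set.univ = ⊤ := by
    rw [eq_top_iff]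
    intro γ _
    obtain ⟨g, rfl⟩ := hψ γ
    refine E_induction (n := n) (R := R) (p := fun g => ψ g ∈ S.XG Set.univ) ?_ ?_ (suslin hn k g)
    · rw [map_one]; exact one_mem _
    · intro i j hij r e _ ih
      rw [map_mul, hS i j hij]
      exact mul_mem (S.x_mem hij _) ih
  let π : SL n R ⧸ N →* SL n (R ⧸ I) := QuotientGroup.lift N (mp f) (fun x hx => hx.2)
  have hπ : ∀ i j, i ≠ j → ∀ a, π (S.x i j a) = tv i j a := by
    intro i j hij a
    obtain ⟨r, rfl⟩ := hf a
    rw [← hS i j hij]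
    exact mp_tv f i j r
  obtain ⟨u, hcl, hm1, hmax⟩ := exists_units f hf
  obtain ⟨p, hp, hpg⟩ := pat_lift (tv (n := n) (R := R)) (tv (n := n) (R := R ⧸ I)) (mp f) f hf hL0 (fun i j _ r => mp_tv f i j r)
    (hfull (R ⧸ I) (sr1_finite _) (mp f g))
  have hk : π (ψ (p⁻¹ * g)) = 1 := by
    change mp f (p⁻¹ * g) = 1
    rw [map_mul, map_inv, hpg, inv_mul_cancel]
  obtain ⟨v, hv⟩ := S.core hn hgen π hπ hab hac hbc u hcl hm1 hmax _ hk
  have hm := rep_pat S.x _ (fun l => sym_pat S hab hac (u l) (v l))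
  rw [← hv] at hm
  obtain ⟨q, hq, hqg⟩ := pat_lift (tv (n := n) (R := R)) S.x ψ f hf hLs hS hm
  refine ⟨p * q * 1, Pat_append _ (Pat_append _ hp hq) (Pat_one _ 0 (fun i j => tv_zero i j) _), ?_⟩
  have : q⁻¹ * (p⁻¹ * g) ∈ N := QuotientGroup.eq.mp hqg
  have e : (p * q * 1)⁻¹ * g = q⁻¹ * (p⁻¹ * g) := by group
  rw [e]; exact this.1

end BG

theorem finite_quotients_bounded_elementary_generation (d k : ℕ) (hd : 3 ≤ d) :
    ∃ f : Fin ((3 * d ^ 2 - d - 2) / 2 + 18 * (k + 2)) → {p : Fin d × Fin d // p.1 ≠ p.2},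
      ∀ H : Subgroup (Matrix.SpecialLinearGroup (Fin d) (MvPolynomial (Fin k) ℤ)),
        H.Normal → H.FiniteIndex →
          ∀ g : Matrix.SpecialLinearGroup (Fin d) (MvPolynomial (Fin k) ℤ),
            ∃ (r : Fin ((3 * d ^ 2 - d - 2) / 2 + 18 * (k + 2)) → MvPolynomial (Fin k) ℤ)
              (h : Matrix.SpecialLinearGroup (Fin d) (MvPolynomial (Fin k) ℤ)),
              h ∈ H ∧
              g = (List.ofFn fun s => elem (f s).1.1 (f s).1.2 (f s).2 (r s)).prod * h := by
  obtain ⟨L, hL, hlen, hmain⟩ := BG.main_pat d k hd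
  rw [← hlen]
  refine ⟨fun s => ⟨L.get s, hL _ (List.get_mem _ _)⟩, ?_⟩
  intro H hH hfin g
  obtain ⟨p, hp, hpg⟩ := hmain H hH hfin g
  obtain ⟨r, hr⟩ := BG.pat_fn _ hp
  refine ⟨r, p⁻¹ * g, hpg, ?_⟩
  have e : (List.ofFn fun s => elem (L.get s).1 (L.get s).2 (hL _ (List.get_mem _ _)) (r s)).prod = p := by
    rw [hr]
    congr 2
    funext s
    exact (BG.tv_of_ne _ _).symm
  change g = (List.ofFn fun s => elem (L.get s).1 (L.get s).2 (hL _ (List.get_mem _ _)) (r s)).prod * (p⁻¹ * g)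
  rw [e, mul_inv_cancel_left]
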